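/- arXiv:2204.10642 — 3 statements merged into one kernel-verified Lean document; each statement's English description precedes it below -/
import Mathlib

section
/- Let G be a finite group, S ⊆ G a symmetric subset (S = S⁻¹), t > 0 and M a positive integer such that 2M · Σ_{(π,V)} (dim V)² · (6·exp(−t·√(dim V)/64) + 2·exp(−(dim V)/12)) < 1, where the sum ranges over a set of representatives of the isomorphism classes of non-trivial irreducible complex representations (π, V) of G. Then for any functions f_1, …, f_M : G → ℝ there exists an orthonormal basis B of ℓ²(G) consisting of real-valued eigenfunctions of the adjacency operator of Cay(G, S) such that for every φ ∈ B and every j = 1, …, M one has |Σ_{g∈G} f_j(g)|φ(g)|² − (1/|G|)·Σ_{g∈G} f_j(g)| ≤ t·‖f_j‖_{ℓ²}/√|G|. -/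
open scoped BigOperators

/-- A representation is irreducible if its only invariant subspaces are `⊥` and `⊤`. -/
def RepIrreducible {G : Type*} [Group G] {W : Type*} [AddCommGroup W] [Module ℂ W]
    (ρ : Representation ℂ G W) : Prop :=
  ∀ U : Submodule ℂ W, (∀ g : G, ∀ x ∈ U, ρ g x ∈ U) → U = ⊥ ∨ U = ⊤

/-- A representation is non-trivial if some group element does not act as the identity. -/
def RepNontrivial {G : Type*} [Group G] {W : Type*} [AddCommGroup W] [Module ℂ W]
    (ρ : Representation ℂ G W) : Prop :=
  ∃ g : G, ρ g ≠ 1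

/-- Two representations are isomorphic if there is an intertwining linear equivalence. -/
def RepIso {G : Type*} [Group G] {W₁ W₂ : Type*} [AddCommGroup W₁] [Module ℂ W₁]
    [AddCommGroup W₂] [Module ℂ W₂]
    (ρ₁ : Representation ℂ G W₁) (ρ₂ : Representation ℂ G W₂) : Prop :=
  ∃ e : W₁ ≃ₗ[ℂ] W₂, ∀ (g : G) (x : W₁), e (ρ₁ g x) = ρ₂ g (e x)


section
open MeasureTheory ProbabilityTheory

lemma que_exp_aux {z : ℝ} (h2 : z ≤ 1/2) : 1 ≤ (1 - z) * Real.exp (z + z^2) := by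
  rcases le_total z 0 with h | h
  · have := Real.add_one_le_exp (z + z^2)
    nlinarith [mul_le_mul_of_nonneg_left this (by linarith : (0:ℝ) ≤ 1 - z), mul_nonneg (sq_nonneg z) (neg_nonneg.2 h)]
  · have := Real.quadratic_le_exp_of_nonneg (x := z + z^2) (by positivity)
    have h3 := mul_le_mul_of_nonneg_left this (by linarith : (0:ℝ) ≤ 1 - z)
    have h4 : 2 * z ≤ (1 - z) * (1 + z)^2 := by nlinarith [mul_nonneg h h, mul_nonneg h (by linarith : (0:ℝ) ≤ 1/2 - z), mul_nonneg (mul_nonneg h h) (by linarith : (0:ℝ) ≤ 1/2 - z)]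
    nlinarith [mul_le_mul_of_nonneg_left h4 (sq_nonneg z)]

lemma que_gauss_one {l : ℝ} (h1 : -(1/4) ≤ l) (h2 : l ≤ 1/4) :
    Integrable (fun x : ℝ => Real.exp (l * x^2)) (gaussianReal 0 1) ∧
    ∫ x, Real.exp (l * x^2) ∂(gaussianReal 0 1) ≤ Real.exp (l + 2 * l^2) := by
  have key : ∫ x, Real.exp (l * x^2) ∂(gaussianReal 0 1) = √ (1 / (1 - 2 * l)) := by
    rw [integral_gaussianReal_eq_integral_smul (by simp)]
    have : ∀ x : ℝ, gaussianPDFReal 0 1 x • Real.exp (l * x^2)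
        = (√(2 * Real.pi))⁻¹ * Real.exp (-(1/2 - l) * x^2) := by
      intro x
      simp only [gaussianPDFReal, smul_eq_mul, NNReal.coe_one, mul_one, sub_zero, mul_assoc]
      rw [← Real.exp_add]
      congr 2
      ring
    simp_rw [this]
    rw [integral_const_mul, integral_gaussian, ← Real.sqrt_inv, ← Real.sqrt_mul (by positivity)]
    congr 1
    have : (1 - 2 * l) ≠ 0 := by linarith
    have : (1 / 2 - l) ≠ 0 := by linarith
    have := Real.pi_pos.ne'
    field_simp
  constructor
  · by_contra hc
    have := integral_undef hc
    rw [key] at this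
    have h3 : 0 < √ (1 / (1 - 2 * l)) := Real.sqrt_pos.2 (by apply div_pos <;> linarith)
    linarith
  · rw [key, Real.sqrt_le_left (Real.exp_nonneg _), ← Real.exp_nat_mul, div_le_iff₀ (by linarith)]
    have := que_exp_aux (z := 2 * l) (by linarith)
    have e : ((2:ℕ):ℝ) * (l + 2 * l^2) = 2 * l + (2 * l)^2 := by push_cast; ring
    rw [mul_comm, e]
    exact this

section
variable {E : Type} [NormedAddCommGroup E] [InnerProductSpace ℝ E] [FiniteDimensional ℝ E]
  [MeasurableSpace E] [BorelSpace E] {D : ℕ}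

lemma que_gauss_prod (a : OrthonormalBasis (Fin D) ℝ E) (l : Fin D → ℝ)
    (h1 : ∀ i, -(1/4) ≤ l i) (h2 : ∀ i, l i ≤ 1/4) :
    Integrable (fun x : E => Real.exp (∑ i, l i * (inner ℝ (a i) x)^2)) (stdGaussian E) ∧
    ∫ x : E, Real.exp (∑ i, l i * (inner ℝ (a i) x)^2) ∂(stdGaussian E)
      ≤ Real.exp (∑ i, (l i + 2 * (l i)^2)) := by
  have hin : ∀ (y : Fin D → ℝ) i, inner ℝ (a i) (∑ k, y k • a k) = y i := by
    intro y i
    rw [← OrthonormalBasis.repr_apply_apply]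
    simp [map_sum, Pi.single_apply]
  have hm : Measurable (fun x : Fin D → ℝ => ∑ i, x i • a i) := by fun_prop
  have hc : Continuous (fun x : E => Real.exp (∑ i, l i * (inner ℝ (a i) x)^2)) := by fun_prop
  rw [stdGaussian_eq_map_pi_orthonormalBasis a]
  rw [integrable_map_measure hc.aestronglyMeasurable hm.aemeasurable,
    integral_map hm.aemeasurable hc.aestronglyMeasurable]
  simp only [Function.comp_def, hin, Real.exp_sum]
  constructor
  · exact Integrable.fintype_prod (f := fun i x => Real.exp (l i * x^2)) (fun i => (que_gauss_one (h1 i) (h2 i)).1)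
  · rw [integral_fintype_prod_eq_prod (f := fun i x => Real.exp (l i * x^2))]
    exact Finset.prod_le_prod (fun i _ => integral_nonneg (fun x => Real.exp_nonneg _))
      (fun i _ => (que_gauss_one (h1 i) (h2 i)).2)

lemma que_gauss_norm (a : OrthonormalBasis (Fin D) ℝ E) :
    Integrable (fun x : E => ‖x‖^2) (stdGaussian E) ∧ ∫ x : E, ‖x‖^2 ∂(stdGaussian E) = D := by
  have h1 : Integrable (fun x : E => ‖x‖^2) (stdGaussian E) := by
    have : MemLp (id : E → E) 2 (stdGaussian E) := IsGaussian.memLp_two_id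
    exact this.integrable_norm_pow (by norm_num)
  refine ⟨h1, ?_⟩
  have h2 : ∀ x : E, ‖x‖^2 = ∑ i, (inner ℝ (a i) x)^2 := by
    intro x
    rw [← a.sum_sq_norm_inner_right x]; simp
  simp_rw [h2]
  have hb : ∀ i, Integrable (fun x : E => (inner ℝ (a i) x)^2) (stdGaussian E) := by
    intro i
    refine h1.mono' (by fun_prop) (Filter.Eventually.of_forall fun x => ?_)
    rw [h2, Real.norm_of_nonneg (sq_nonneg _)]
    exact Finset.single_le_sum (f := fun i => (inner ℝ (a i) x)^2) (fun i _ => sq_nonneg _) (Finset.mem_univ i)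
  rw [integral_finsetSum _ (fun i _ => hb i)]
  have hv : ∀ i, ∫ x : E, (inner ℝ (a i) x)^2 ∂(stdGaussian E) = 1 := by
    intro i
    have := variance_dual_stdGaussian (innerSL ℝ (a i))
    rw [variance_of_integral_eq_zero (by fun_prop) (integral_strongDual_stdGaussian _)] at this
    simpa using this
  simp [hv]
end
section
set_option linter.unusedSectionVars false
variable {E : Type} [NormedAddCommGroup E] [InnerProductSpace ℝ E] [FiniteDimensional ℝ E]

lemma que_compact : CompactSpace (unitary (E →L[ℝ] E)) := by
  have : ProperSpace (E →L[ℝ] E) := FiniteDimensional.proper ℝ _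
  refine isCompact_iff_compactSpace.1 ?_
  refine Metric.isCompact_of_isClosed_isBounded (isClosed_unitary) ?_
  refine (Metric.isBounded_iff_subset_closedBall 0).2 ⟨1, fun u hu => ?_⟩
  rw [mem_closedBall_zero_iff]
  refine ContinuousLinearMap.opNorm_le_bound _ zero_le_one fun x => ?_
  rw [ContinuousLinearMap.norm_map_of_mem_unitary hu, one_mul]

lemma que_trans (v w : E) (h : ‖v‖ = ‖w‖) : ∃ Q : unitary (E →L[ℝ] E), (Q : E →L[ℝ] E) v = w := by
  refine ⟨Unitary.linearIsometryEquiv.symm (Submodule.reflection (ℝ ∙ (v - w))ᗮ), ?_⟩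
  simpa using Submodule.reflection_sub h

variable [MeasurableSpace E] [BorelSpace E] {D : ℕ}

/-- the quadratic form of an operator -/
noncomputable def queQ (A : E →L[ℝ] E) (x : E) : ℝ := inner ℝ x (A x)

lemma queQ_smul (A : E →L[ℝ] E) (c : ℝ) (x : E) : queQ A (c • x) = c^2 * queQ A x := by
  simp [queQ, real_inner_smul_left, real_inner_smul_right]; ring

lemma que_cont (A : E →L[ℝ] E) :
    Continuous (fun p : E × unitary (E →L[ℝ] E) => queQ A (((p.2⁻¹ : unitary (E →L[ℝ] E)) : E →L[ℝ] E) p.1)) := by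
  unfold queQ
  fun_prop

lemma que_sphere [MeasurableSpace (unitary (E →L[ℝ] E))] [BorelSpace (unitary (E →L[ℝ] E))]
    (μ : Measure (unitary (E →L[ℝ] E))) [IsProbabilityMeasure μ] [μ.IsMulLeftInvariant]
    (a : OrthonormalBasis (Fin D) ℝ E) (A : E →L[ℝ] E) (hA : ∀ x, queQ A x ≤ ‖x‖^2 / 4)
    (v : E) (hv : ‖v‖ = 1) :
    ∫ T, Real.exp (D * queQ A (((T⁻¹ : unitary (E →L[ℝ] E)) : E →L[ℝ] E) v)) ∂μ
      ≤ ∫ x, Real.exp (queQ A x) ∂(stdGaussian E) := by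
  have : CompactSpace (unitary (E →L[ℝ] E)) := que_compact
  have : ProperSpace (E →L[ℝ] E) := FiniteDimensional.proper ℝ _
  have : SecondCountableTopology (E →L[ℝ] E) := inferInstance
  set Q : unitary (E →L[ℝ] E) → ℝ := fun T => queQ A (((T⁻¹ : unitary (E →L[ℝ] E)) : E →L[ℝ] E) v) with hQ
  have hQc : Continuous Q := by
    have := (que_cont A).comp (Continuous.prodMk_right v)
    exact this
  have hintg : ∀ g : unitary (E →L[ℝ] E) → ℝ, Continuous g → Integrable g μ := by
    intro g hg
    exact hg.integrable_of_hasCompactSupport (HasCompactSupport.of_compactSpace g)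
  -- invariance
  have hinv : ∀ x : E, ∫ T, Real.exp (queQ A (((T⁻¹ : unitary (E →L[ℝ] E)) : E →L[ℝ] E) x)) ∂μ
      = ∫ T, Real.exp (‖x‖^2 * Q T) ∂μ := by
    intro x
    obtain ⟨R, hR⟩ := que_trans (‖x‖ • v) x (by simp [norm_smul, hv])
    rw [← integral_mul_left_eq_self _ R]
    congr 1
    ext T
    congr 1
    rw [hQ, ← queQ_smul]
    congr 1
    have hR' : ((R⁻¹ : unitary (E →L[ℝ] E)) : E →L[ℝ] E) x = ‖x‖ • v := by
      conv_lhs => rw [← hR]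
      rw [← mul_apply_eq_comp, ← Submonoid.coe_mul, inv_mul_cancel]
      simp
    rw [mul_inv_rev, Submonoid.coe_mul, mul_apply_eq_comp, hR', map_smul]
  have hprod : Integrable (fun p : E × unitary (E →L[ℝ] E) =>
      Real.exp (queQ A (((p.2⁻¹ : unitary (E →L[ℝ] E)) : E →L[ℝ] E) p.1))) ((stdGaussian E).prod μ) := by
    have h0 : Integrable (fun x : E => Real.exp (‖x‖^2 / 4)) (stdGaussian E) := by
      have := (que_gauss_prod a (fun _ => 1/4) (by intro; norm_num) (by intro; norm_num)).1
      convert this using 3 with x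
      rw [← Finset.mul_sum, ← a.sum_sq_norm_inner_right x]; simp; ring
    refine (h0.comp_fst μ).mono' ?_ ?_
    · exact (Real.continuous_exp.comp (que_cont A)).aestronglyMeasurable
    · refine Filter.Eventually.of_forall fun p => ?_
      rw [Real.norm_of_nonneg (Real.exp_nonneg _), Real.exp_le_exp]
      refine (hA _).trans_eq ?_
      rw [Unitary.norm_map]
  have hswap := integral_integral_swap (f := fun x T => Real.exp (queQ A (((T⁻¹ : unitary (E →L[ℝ] E)) : E →L[ℝ] E) x))) hprod
  have hright : ∀ T : unitary (E →L[ℝ] E),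
      ∫ x, Real.exp (queQ A (((T⁻¹ : unitary (E →L[ℝ] E)) : E →L[ℝ] E) x)) ∂(stdGaussian E)
        = ∫ x, Real.exp (queQ A x) ∂(stdGaussian E) := by
    intro T
    have h1 := stdGaussian_map (Unitary.linearIsometryEquiv T⁻¹)
    conv_rhs => rw [← h1]
    rw [integral_map]
    · rfl
    · exact (Unitary.linearIsometryEquiv T⁻¹).continuous.aemeasurable
    · unfold queQ
      exact Continuous.aestronglyMeasurable (by fun_prop)
  simp_rw [hright, hinv] at hswap
  rw [integral_const] at hswap
  simp only [probReal_univ, one_smul] at hswap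
  rw [← hswap]
  have hF : Integrable (fun x => ∫ T, Real.exp (‖x‖^2 * Q T) ∂μ) (stdGaussian E) := by
    have := hprod.integral_prod_left
    simpa only [hinv] using this
  obtain ⟨hn1, hn2⟩ := que_gauss_norm a
  set α := ∫ T, Real.exp (D * Q T) ∂μ
  set β := ∫ T, Real.exp (D * Q T) * Q T ∂μ
  have hlow : ∀ x : E, α + (‖x‖^2 - D) * β ≤ ∫ T, Real.exp (‖x‖^2 * Q T) ∂μ := by
    intro x
    rw [← integral_const_mul, ← integral_add (hintg _ (by fun_prop)) (hintg _ (by fun_prop))]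
    refine integral_mono (hintg _ (by fun_prop)) (hintg _ (by fun_prop)) fun T => ?_
    have h1 := Real.add_one_le_exp ((‖x‖^2 - D) * Q T)
    have h2 : Real.exp (‖x‖^2 * Q T) = Real.exp (D * Q T) * Real.exp ((‖x‖^2 - D) * Q T) := by
      rw [← Real.exp_add]; congr 1; ring
    simp only
    rw [h2]
    nlinarith [mul_le_mul_of_nonneg_left h1 (Real.exp_nonneg (D * Q T))]
  have hi : Integrable (fun x : E => (‖x‖^2 - D) * β) (stdGaussian E) :=
    (hn1.sub (integrable_const _)).mul_const _
  have := integral_mono ((integrable_const α).add hi) hF hlow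
  refine le_trans (le_of_eq ?_) this
  simp only [Pi.add_apply]
  rw [integral_add (integrable_const α) hi, integral_mul_const,
    integral_sub hn1 (integrable_const _), hn2]
  simp
end
section
variable {E : Type} [NormedAddCommGroup E] [InnerProductSpace ℝ E] [FiniteDimensional ℝ E] {D : ℕ}

lemma que_gauss_quad [MeasurableSpace E] [BorelSpace E] (hn : Module.finrank ℝ E = D) (A : E →L[ℝ] E)
    (hs : ∀ x y, inner ℝ (A x) y = inner ℝ x (A y))
    (H0 : ∀ a : OrthonormalBasis (Fin D) ℝ E, ∑ i, queQ A (a i) = 0)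
    (H1 : ∀ a : OrthonormalBasis (Fin D) ℝ E, ∑ i, (queQ A (a i))^2 ≤ 1/16) :
    (∀ x, queQ A x ≤ ‖x‖^2 / 4) ∧ ∫ x, Real.exp (queQ A x) ∂(stdGaussian E) ≤ Real.exp (1/8) := by
  have hsym : (A : E →ₗ[ℝ] E).IsSymmetric := hs
  set a := hsym.eigenvectorBasis hn with ha
  set l := hsym.eigenvalues hn with hl
  have hAa : ∀ i, A (a i) = l i • a i := fun i => hsym.apply_eigenvectorBasis hn i
  have hli : ∀ i, queQ A (a i) = l i := by
    intro i
    simp [queQ, hAa, real_inner_smul_right]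
  have hq : ∀ x, queQ A x = ∑ i, l i * (inner ℝ (a i) x)^2 := by
    intro x
    unfold queQ
    rw [← a.sum_inner_mul_inner x (A x)]
    refine Finset.sum_congr rfl fun i _ => ?_
    rw [← hs, hAa, real_inner_smul_left, real_inner_comm]
    ring
  have hsq := H1 a
  have hz := H0 a
  simp_rw [hli] at hsq hz
  have hb : ∀ i, (l i)^2 ≤ 1/16 := fun i =>
    (Finset.single_le_sum (f := fun i => (l i)^2) (fun i _ => sq_nonneg _) (Finset.mem_univ i)).trans hsq
  have hb1 : ∀ i, -(1/4) ≤ l i := fun i => by nlinarith [hb i]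
  have hb2 : ∀ i, l i ≤ 1/4 := fun i => by nlinarith [hb i]
  constructor
  · intro x
    rw [hq, ← a.sum_sq_norm_inner_right x, Finset.sum_div]
    refine Finset.sum_le_sum fun i _ => ?_
    have := mul_le_mul_of_nonneg_right (hb2 i) (sq_nonneg (inner ℝ (a i) x))
    simp only [Real.norm_eq_abs, sq_abs]
    linarith
  · simp_rw [hq]
    refine (que_gauss_prod a l hb1 hb2).2.trans ?_
    rw [Real.exp_le_exp, Finset.sum_add_distrib, hz, ← Finset.mul_sum]
    linarith

lemma que_key (hn : Module.finrank ℝ E = D) {J : Type} [Fintype J] (A : J → E →L[ℝ] E)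
    (hs : ∀ j x y, inner ℝ (A j x) y = inner ℝ x (A j y))
    (H0 : ∀ j, ∀ a : OrthonormalBasis (Fin D) ℝ E, ∑ i, queQ (A j) (a i) = 0)
    (H1 : ∀ j, ∀ a : OrthonormalBasis (Fin D) ℝ E, ∑ i, (queQ (A j) (a i))^2 ≤ 1/16) :
    ∃ b : OrthonormalBasis (Fin D) ℝ E, ∀ k j,
      D * queQ (A j) (b k) ≤ Real.log (Fintype.card J * D) + 1/8 := by
  borelize E
  have : BorelSpace ↥(unitary (E →L[ℝ] E)) := inferInstance
  have : CompactSpace (unitary (E →L[ℝ] E)) := que_compact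
  let μ : Measure (unitary (E →L[ℝ] E)) := Measure.haarMeasure ⊤
  have hμ : IsProbabilityMeasure μ := ⟨Measure.haarMeasure_self⟩
  have hμi : μ.IsMulLeftInvariant := inferInstance
  let a : OrthonormalBasis (Fin D) ℝ E := (stdOrthonormalBasis ℝ E).reindex (finCongr hn)
  have hintg : ∀ g : unitary (E →L[ℝ] E) → ℝ, Continuous g → Integrable g μ := by
    intro g hg
    exact hg.integrable_of_hasCompactSupport (HasCompactSupport.of_compactSpace g)
  have hc : ∀ k j, Integrable (fun T : unitary (E →L[ℝ] E) =>
      Real.exp (D * queQ (A j) (((T⁻¹ : unitary (E →L[ℝ] E)) : E →L[ℝ] E) (a k)))) μ := by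
    intro k j
    apply hintg
    have h1 : Continuous (fun T : unitary (E →L[ℝ] E) =>
      (queQ (A j) (((T⁻¹ : unitary (E →L[ℝ] E)) : E →L[ℝ] E) (a k)))) := by
      have := (que_cont (A j)).comp (Continuous.prodMk_right (a k))
      exact this
    fun_prop
  have hle : ∀ k j, ∫ T, Real.exp (D * queQ (A j) (((T⁻¹ : unitary (E →L[ℝ] E)) : E →L[ℝ] E) (a k))) ∂μ
      ≤ Real.exp (1/8) := by
    intro k j
    obtain ⟨h1, h2⟩ := que_gauss_quad hn (A j) (hs j) (H0 j) (H1 j)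
    exact (que_sphere μ a (A j) h1 (a k) (a.orthonormal.1 k)).trans h2
  have hI : Integrable (fun T : unitary (E →L[ℝ] E) => ∑ k, ∑ j,
      Real.exp (D * queQ (A j) (((T⁻¹ : unitary (E →L[ℝ] E)) : E →L[ℝ] E) (a k)))) μ :=
    integrable_finsetSum _ fun k _ => integrable_finsetSum _ fun j _ => hc k j
  obtain ⟨T, hT⟩ := exists_le_integral hI
  have hT2 : ∑ k, ∑ j, Real.exp (D * queQ (A j) (((T⁻¹ : unitary (E →L[ℝ] E)) : E →L[ℝ] E) (a k)))
      ≤ D * (Fintype.card J * Real.exp (1/8)) := by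
    refine hT.trans ?_
    rw [integral_finsetSum _ (fun k _ => integrable_finsetSum _ fun j _ => hc k j)]
    calc _ ≤ ∑ k : Fin D, ∑ j : J, Real.exp (1/8) := by
          refine Finset.sum_le_sum fun k _ => ?_
          rw [integral_finsetSum _ (fun j _ => hc k j)]
          exact Finset.sum_le_sum fun j _ => hle k j
      _ = _ := by simp
  refine ⟨a.map (Unitary.linearIsometryEquiv T⁻¹), fun k j => ?_⟩
  have h3 : Real.exp (D * queQ (A j) (((T⁻¹ : unitary (E →L[ℝ] E)) : E →L[ℝ] E) (a k)))
      ≤ D * (Fintype.card J * Real.exp (1/8)) := by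
    refine le_trans ?_ hT2
    refine le_trans ?_ (Finset.single_le_sum (f := fun k => ∑ j, Real.exp (D * queQ (A j) (((T⁻¹ : unitary (E →L[ℝ] E)) : E →L[ℝ] E) (a k)))) (fun k _ => Finset.sum_nonneg fun j _ => Real.exp_nonneg _) (Finset.mem_univ k))
    exact Finset.single_le_sum (f := fun j => Real.exp (D * queQ (A j) (((T⁻¹ : unitary (E →L[ℝ] E)) : E →L[ℝ] E) (a k)))) (fun j _ => Real.exp_nonneg _) (Finset.mem_univ j)
  have hD : (0:ℝ) < D := by have := k.pos; exact_mod_cast this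
  have hJ : (0:ℝ) < Fintype.card J := by
    have : 0 < Fintype.card J := Fintype.card_pos_iff.2 ⟨j⟩
    exact_mod_cast this
  rw [← Real.le_log_iff_exp_le (by positivity), ← mul_assoc, Real.log_mul (by positivity) (by positivity),
    Real.log_exp, mul_comm (D:ℝ) (Fintype.card J : ℝ)] at h3
  exact h3
end
section
variable {G : Type} [Group G] [Fintype G]

lemma que_ker (W : Set (G → ℝ)) (p : G → G → ℝ) (ps : ∀ g h, p g h = p h g) (hmem : ∀ g, p g ∈ W)
    (hrep : ∀ f ∈ W, ∀ g, ∑ h, p g h * f h = f g)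
    (hL : ∀ x : G, ∀ f ∈ W, (fun g => f (x * g)) ∈ W) (x g h : G) : p (x * g) (x * h) = p g h := by
  have h1 : ∀ f ∈ W, ∀ g, ∑ h, p (x * g) (x * h) * f h = f g := by
    intro f hf g
    have := hrep _ (hL x⁻¹ f hf) (x * g)
    rw [← Equiv.sum_comp (Equiv.mulLeft x)] at this
    simpa using this
  have h2 := hrep _ (hL x _ (hmem (x * g))) h
  have h3 := h1 _ (hmem h) g
  rw [← h2, ps g h, ← h3]
  exact Finset.sum_congr rfl fun u _ => mul_comm _ _

lemma que_W {D : ℕ} (W : Set (G → ℝ)) (b : Fin D → G → ℝ)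
    (ho : ∀ i k, ∑ g, b i g * b k g = if i = k then 1 else 0)
    (hspan : ∀ f ∈ W, ∃ c : Fin D → ℝ, ∀ g, f g = ∑ i, c i * b i g)
    (hmem : ∀ c : Fin D → ℝ, (fun g => ∑ i, c i * b i g) ∈ W)
    (hL : ∀ x : G, ∀ f ∈ W, (fun g => f (x * g)) ∈ W) (f : G → ℝ) (hf : ∑ g, f g = 0) :
    ∑ i, ∑ g, f g * (b i g)^2 = 0 ∧
    ∑ i, (∑ g, f g * (b i g)^2)^2 ≤ (∑ g, (f g)^2) * (D / Fintype.card G) := by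
  set p : G → G → ℝ := fun g h => ∑ i, b i g * b i h with hp
  have ps : ∀ g h, p g h = p h g := fun g h => Finset.sum_congr rfl fun u _ => mul_comm _ _
  have hpm : ∀ g, p g ∈ W := fun g => hmem (fun i => b i g)
  have hrep : ∀ f ∈ W, ∀ g, ∑ h, p g h * f h = f g := by
    intro f hf g
    obtain ⟨c, hc⟩ := hspan f hf
    simp_rw [hc, hp, Finset.sum_mul_sum]
    rw [Finset.sum_comm]
    refine Finset.sum_congr rfl fun i _ => ?_
    rw [Finset.sum_comm]
    calc ∑ k, ∑ h, b i g * b i h * (c k * b k h) = ∑ k, b i g * c k * ∑ h, b i h * b k h := by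
          refine Finset.sum_congr rfl fun k _ => ?_
          rw [Finset.mul_sum]
          exact Finset.sum_congr rfl fun h _ => by ring
      _ = _ := by simp [ho, mul_comm]
  have hinv := que_ker W p ps hpm hrep hL
  have hdiag : ∀ g, p g g = p 1 1 := by
    intro g
    simpa using hinv g 1 1
  have htr : ∑ g, p g g = D := by
    simp only [hp]
    rw [Finset.sum_comm]
    simp [ho]
  have hN : (0:ℝ) < Fintype.card G := by exact_mod_cast Fintype.card_pos
  have hpd : ∀ g, p g g = D / Fintype.card G := by
    intro g
    rw [eq_div_iff hN.ne', ← htr]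
    simp_rw [hdiag]
    simp [mul_comm]
  have hsq : ∀ g, ∑ h, (p g h)^2 = D / Fintype.card G := by
    intro g
    rw [← hpd g, ← hrep _ (hpm g) g]
    exact Finset.sum_congr rfl fun h _ => by ring
  constructor
  · rw [Finset.sum_comm]
    have : ∀ g, ∑ i, f g * (b i g)^2 = f g * (D / Fintype.card G) := by
      intro g
      rw [← hpd g, hp, Finset.mul_sum]
      exact Finset.sum_congr rfl fun h _ => by ring
    simp_rw [this]
    rw [← Finset.sum_mul, hf, zero_mul]
  · calc ∑ i, (∑ g, f g * (b i g)^2)^2 ≤ ∑ i, ∑ k, (∑ g, f g * (b i g * b k g))^2 := by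
          refine Finset.sum_le_sum fun i _ => ?_
          refine le_trans (le_of_eq ?_) (Finset.single_le_sum (f := fun k => (∑ g, f g * (b i g * b k g))^2) (fun k _ => sq_nonneg _) (Finset.mem_univ i))
          simp only [pow_two]
      _ = ∑ g, ∑ h, f g * f h * (p g h)^2 := by
          simp_rw [hp, pow_two, Finset.sum_mul_sum, Finset.mul_sum]
          rw [Finset.sum_congr rfl (fun i _ => Finset.sum_comm)]
          rw [Finset.sum_comm]
          refine Finset.sum_congr rfl fun g _ => ?_
          rw [Finset.sum_congr rfl (fun i _ => Finset.sum_comm)]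
          rw [Finset.sum_comm]
          refine Finset.sum_congr rfl fun h _ => ?_
          refine Finset.sum_congr rfl fun i _ => ?_
          refine Finset.sum_congr rfl fun k _ => ?_
          ring
      _ ≤ ∑ g, ∑ h, ((f g)^2 * (p g h)^2 / 2 + (f h)^2 * (p h g)^2 / 2) := by
          refine Finset.sum_le_sum fun g _ => Finset.sum_le_sum fun h _ => ?_
          rw [ps h g]
          nlinarith [mul_nonneg (sq_nonneg (f g - f h)) (sq_nonneg (p g h))]
      _ = (∑ g, (f g)^2) * (D / Fintype.card G) := by
          simp_rw [Finset.sum_add_distrib]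
          rw [Finset.sum_comm (f := fun g h => (f h)^2 * (p h g)^2 / 2)]
          simp_rw [← Finset.sum_div, ← Finset.mul_sum, hsq]
          rw [← Finset.sum_mul]
          ring
end
section
variable {G : Type} [Group G] [Fintype G]

/-- left translation on complex functions -/
def queL (G : Type) [Group G] : Representation ℂ G (G → ℂ) where
  toFun x := LinearMap.funLeft ℂ ℂ (fun g => x⁻¹ * g)
  map_one' := by ext; simp [LinearMap.funLeft_apply]
  map_mul' x y := by ext; simp [LinearMap.funLeft_apply, mul_assoc]

lemma queL_apply (x : G) (f : G → ℂ) (g : G) : queL G x f g = f (x⁻¹ * g) := rfl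

/-- restriction to an invariant subspace -/
def queRes {W : Type} [AddCommGroup W] [Module ℂ W] (ρ : Representation ℂ G W) (U : Submodule ℂ W)
    (hU : ∀ g : G, ∀ x ∈ U, ρ g x ∈ U) : Representation ℂ G U where
  toFun g := (ρ g).restrict (hU g)
  map_one' := by ext; simp
  map_mul' x y := by ext; simp

lemma que_rep {ι : Type} (V : ι → Type)
    [∀ i, AddCommGroup (V i)] [∀ i, Module ℂ (V i)]
    (π : ∀ i, Representation ℂ G (V i))
    (hcomplete : ∀ (W : Type) [AddCommGroup W] [Module ℂ W],
      ∀ _ : FiniteDimensional ℂ W, ∀ ρ : Representation ℂ G W,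
        RepIrreducible ρ → RepNontrivial ρ → ∃ i, RepIso ρ (π i))
    {D : ℕ} (b : Fin D → G → ℝ) (k0 : Fin D) (hk0 : b k0 ≠ 0)
    (h0 : ∀ i, ∑ g, b i g = 0)
    (hL : ∀ x i, ∃ c : Fin D → ℝ, ∀ g, b i (x * g) = ∑ k, c k * b k g) :
    ∃ i, 0 < Module.finrank ℂ (V i) ∧ Module.finrank ℂ (V i) ≤ D := by
  let bc : Fin D → G → ℂ := fun i g => (b i g : ℂ)
  let C : Submodule ℂ (G → ℂ) := Submodule.span ℂ (Set.range bc)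
  have hC0 : ∀ f ∈ C, ∑ g, f g = 0 := by
    intro f hf
    induction hf using Submodule.span_induction with
    | mem f hf =>
      obtain ⟨i, rfl⟩ := hf
      have := h0 i
      simp only [bc]
      exact_mod_cast this
    | zero => simp
    | add x y _ _ hx hy => simp [Finset.sum_add_distrib, hx, hy]
    | smul a x _ hx => simp [← Finset.mul_sum, hx]
  have hCinv : ∀ x : G, ∀ f ∈ C, queL G x f ∈ C := by
    intro x f hf
    induction hf using Submodule.span_induction with
    | mem f hf =>
      obtain ⟨i, rfl⟩ := hf
      obtain ⟨c, hc⟩ := hL x⁻¹ i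
      have : queL G x (bc i) = ∑ k, (c k : ℂ) • bc k := by
        ext g
        rw [queL_apply]
        simp only [bc, hc, Finset.sum_apply, Pi.smul_apply, smul_eq_mul]
        push_cast
        rfl
      rw [this]
      exact Submodule.sum_mem _ fun k _ => Submodule.smul_mem _ _ (Submodule.subset_span ⟨k, rfl⟩)
    | zero => simp
    | add x y _ _ hx hy => rw [map_add]; exact Submodule.add_mem _ hx hy
    | smul a x _ hx => rw [map_smul]; exact Submodule.smul_mem _ _ hx
  have hCne : C ≠ ⊥ := by
    intro h
    have : bc k0 ∈ C := Submodule.subset_span ⟨k0, rfl⟩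
    rw [h, Submodule.mem_bot] at this
    apply hk0
    ext g
    have := congrFun this g
    simpa [bc] using this
  let s : Set (Submodule ℂ (G → ℂ)) := {U | U ≠ ⊥ ∧ U ≤ C ∧ ∀ x : G, ∀ f ∈ U, queL G x f ∈ U}
  obtain ⟨U, ⟨hUne, hUC, hUinv⟩, hmin⟩ :=
    (wellFounded_lt (α := Submodule ℂ (G → ℂ))).has_min s ⟨C, hCne, le_rfl, hCinv⟩
  let ρ := queRes (queL G) U hUinv
  have hρ : ∀ x (u : U), ((ρ x u : U) : G → ℂ) = queL G x u := fun x u => rfl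
  have hirr : RepIrreducible ρ := by
    intro U' hU'
    by_cases hb : U' = ⊥
    · exact Or.inl hb
    right
    have hm : Submodule.map U.subtype U' ∈ s := by
      refine ⟨?_, ?_, ?_⟩
      · intro h
        apply hb
        exact Submodule.map_injective_of_injective U.injective_subtype (by rw [h, Submodule.map_bot])
      · exact (Submodule.map_subtype_le _ _).trans hUC
      · rintro x f ⟨u, hu, rfl⟩
        exact ⟨ρ x u, hU' x u hu, rfl⟩
    have h1 := hmin _ hm
    have h2 := Submodule.map_subtype_le U U'
    have h3 : Submodule.map U.subtype U' = U := by
      by_contra hne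
      exact h1 (lt_of_le_of_ne h2 hne)
    rw [eq_top_iff]
    intro u _
    have : (u : G → ℂ) ∈ Submodule.map U.subtype U' := by rw [h3]; exact u.2
    obtain ⟨u', hu', he⟩ := this
    have : u' = u := Subtype.ext he
    rwa [← this]
  have hnt : RepNontrivial ρ := by
    by_contra hc
    unfold RepNontrivial at hc
    push Not at hc
    apply hUne
    rw [Submodule.eq_bot_iff]
    intro f hf
    have hconst : ∀ g, f g = f 1 := by
      intro g
      have h1 := hρ g⁻¹ ⟨f, hf⟩
      rw [hc] at h1
      have := congrFun h1 1
      rw [queL_apply] at this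
      simpa using this.symm
    have hs := hC0 f (hUC hf)
    simp_rw [hconst] at hs
    have h10 : f 1 = 0 := by simpa using hs
    ext g
    rw [hconst, h10]; rfl
  obtain ⟨i, e, -⟩ := hcomplete U inferInstance ρ hirr hnt
  refine ⟨i, ?_, ?_⟩
  · rw [← e.finrank_eq]
    have : Nontrivial U := Submodule.nontrivial_iff_ne_bot.2 hUne
    exact Module.finrank_pos
  · rw [← e.finrank_eq]
    refine (Submodule.finrank_mono hUC).trans ?_
    have := finrank_range_le_card (R := ℂ) bc
    rw [Fintype.card_fin] at this
    exact this
end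
lemma que_num {d D M : ℕ} {t : ℝ} (hd : 0 < d) (hdD : d ≤ D) (hM : 0 < M) (ht : 0 < t)
    (h : 2 * (M:ℝ) * ((d:ℝ)^2 * (6 * Real.exp (-(t * √d / 64)))) < 1) :
    4 * (Real.log ((2 * M : ℝ) * D) + 1/8) ≤ t * √D := by
  have hd' : (1:ℝ) ≤ d := by exact_mod_cast hd
  have hM' : (1:ℝ) ≤ M := by exact_mod_cast hM
  have hD' : (d:ℝ) ≤ D := by exact_mod_cast hdD
  have hsd : 0 < √(d:ℝ) := Real.sqrt_pos.2 (by linarith)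
  set L := Real.log (12 * M * (d:ℝ)^2) with hL
  set y := t * √d / 64 with hy
  have h1 : L < y := by
    rw [hL, Real.log_lt_iff_lt_exp (by positivity)]
    have := Real.exp_pos y
    rw [Real.exp_neg] at h
    have h2 : 12 * M * (d:ℝ)^2 * (Real.exp y)⁻¹ < 1 := by linarith
    rwa [← div_eq_mul_inv, div_lt_one this] at h2
  have hp : (1:ℝ) ≤ M * d^2 := by nlinarith
  have hL1 : 1 ≤ L := by
    rw [hL, Real.le_log_iff_exp_le (by positivity)]
    have := Real.exp_one_lt_d9
    nlinarith
  set r := √(D:ℝ) / √(d:ℝ) with hr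
  have hr1 : 1 ≤ r := by
    rw [hr, one_le_div hsd]; exact Real.sqrt_le_sqrt hD'
  have hrD : √(D:ℝ) = r * √d := by rw [hr]; field_simp
  have hDr : (D:ℝ) = r^2 * d := by
    have h3 : √(D:ℝ)^2 = D := Real.sq_sqrt (by positivity)
    have h4 : √(d:ℝ)^2 = d := Real.sq_sqrt (by positivity)
    rw [← h3, hrD, mul_pow, h4]
  have hlog : Real.log ((2 * M : ℝ) * D) ≤ L + 2 * (r - 1) := by
    have : (2 * M : ℝ) * D = (2 * M * d) * r^2 := by rw [hDr]; ring
    rw [this, Real.log_mul (by positivity) (by positivity), Real.log_pow]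
    have h5 : Real.log (2 * M * d) ≤ L := by
      rw [hL]
      apply Real.log_le_log (by positivity)
      nlinarith
    have h6 := Real.log_le_sub_one_of_pos (by linarith : 0 < r)
    push_cast
    linarith
  have hT : t * √D = 64 * y * r := by rw [hrD, hy]; ring
  rw [hT]
  nlinarith [mul_le_mul_of_nonneg_right h1.le (by linarith : 0 ≤ r), mul_le_mul hL1 hr1 (by linarith) (by linarith),
    mul_nonneg (by linarith : 0 ≤ L - 1) (by linarith : 0 ≤ r), mul_nonneg (by linarith : 0 ≤ L) (by linarith : 0 ≤ r - 1)]

section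
variable {G : Type} [Group G] [Fintype G]

/-- multiplication operator compressed to a subspace -/
noncomputable def queA (W : Submodule ℝ (EuclideanSpace ℝ G)) (f : G → ℝ) : W →L[ℝ] W :=
  W.orthogonalProjectionOnto ∘L ((LinearMap.toContinuousLinearMap
    ({ toFun := fun x => WithLp.toLp 2 (fun g => f g * x g)
       map_add' := by intro x y; ext g; simp [mul_add]
       map_smul' := by intro c x; ext g; simp; ring } : EuclideanSpace ℝ G →ₗ[ℝ] EuclideanSpace ℝ G)) ∘L W.subtypeL)

lemma queA_inner (W : Submodule ℝ (EuclideanSpace ℝ G)) (f : G → ℝ) (x y : W) :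
    inner ℝ x (queA W f y) = ∑ g, f g * ((x : EuclideanSpace ℝ G) g * (y : EuclideanSpace ℝ G) g) := by
  unfold queA
  simp only [ContinuousLinearMap.comp_apply]
  rw [Submodule.inner_orthogonalProjectionOnto_eq_of_mem_left]
  simp [PiLp.inner_apply]
  exact Finset.sum_congr rfl fun g _ => by ring

lemma que_center (f : G → ℝ) : ∑ g, (f g - (∑ g, f g) / Fintype.card G) = 0 ∧
    ∑ g, (f g - (∑ g, f g) / Fintype.card G)^2 ≤ ∑ g, (f g)^2 := by
  have hN : (0:ℝ) < Fintype.card G := by exact_mod_cast Fintype.card_pos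
  set m := (∑ g, f g) / Fintype.card G with hm
  have hs : ∑ g, f g = m * Fintype.card G := by rw [hm]; field_simp
  constructor
  · rw [Finset.sum_sub_distrib, hs]; simp [mul_comm]
  · have : ∑ g, (f g - m)^2 = ∑ g, (f g)^2 - Fintype.card G * m^2 := by
      have : ∀ g, (f g - m)^2 = (f g)^2 - 2 * m * f g + m^2 := fun g => by ring
      simp_rw [this]
      rw [Finset.sum_add_distrib, Finset.sum_sub_distrib, ← Finset.mul_sum, hs]
      simp; ring
    rw [this]
    nlinarith [mul_nonneg hN.le (sq_nonneg m)]

lemma que_sub {M D : ℕ} (W : Submodule ℝ (EuclideanSpace ℝ G)) (hD : Module.finrank ℝ W = D)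
    (hL : ∀ x : G, ∀ w ∈ W, (WithLp.toLp 2 (fun g => w (x * g)) : EuclideanSpace ℝ G) ∈ W)
    (t : ℝ) (ht : 0 < t)
    (hnum : 0 < D → 4 * (Real.log ((2 * M : ℝ) * D) + 1/8) ≤ t * √D)
    (f : Fin M → G → ℝ) :
    ∃ b : OrthonormalBasis (Fin D) ℝ W, ∀ k j,
      |(∑ g : G, f j g * ((b k : EuclideanSpace ℝ G) g) ^ 2) - (∑ g : G, f j g) / (Fintype.card G : ℝ)| ≤
          t * Real.sqrt (∑ g : G, f j g ^ 2) / Real.sqrt (Fintype.card G) := by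
  have hN : (0:ℝ) < Fintype.card G := by exact_mod_cast Fintype.card_pos
  set N : ℝ := (Fintype.card G : ℝ) with hNdef
  let F : Fin M → ℝ := fun j => ∑ g, (f j g)^2
  have hF : ∀ j, 0 ≤ F j := fun j => Finset.sum_nonneg fun g _ => sq_nonneg _
  let h : Fin M → ℝ := fun j => √(F j * (D / N))
  let ft : Fin M → G → ℝ := fun j g => f j g - (∑ g, f j g) / N
  let sg : Bool → ℝ := fun s => if s then 1 else -1
  let A : Fin M × Bool → (W →L[ℝ] W) := fun js => (sg js.2 * (1 / (4 * h js.1))) • queA W (ft js.1)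
  have hAin : ∀ js x y, inner ℝ x (A js y) = (sg js.2 * (1 / (4 * h js.1))) *
      ∑ g, ft js.1 g * ((x : EuclideanSpace ℝ G) g * (y : EuclideanSpace ℝ G) g) := by
    intro js x y
    have h1 := real_inner_smul_right x (queA W (ft js.1) y) (sg js.2 * (1 / (4 * h js.1)))
    rw [queA_inner] at h1
    exact h1
  have hAq : ∀ js x, queQ (A js) x = (sg js.2 * (1 / (4 * h js.1))) *
      ∑ g, ft js.1 g * ((x : EuclideanSpace ℝ G) g)^2 := by
    intro js x
    unfold queQ
    rw [hAin]
    simp only [pow_two]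
  have hbasis : ∀ (a : OrthonormalBasis (Fin D) ℝ W) (j : Fin M),
      ∑ i, ∑ g, ft j g * ((a i : EuclideanSpace ℝ G) g)^2 = 0 ∧
      ∑ i, (∑ g, ft j g * ((a i : EuclideanSpace ℝ G) g)^2)^2 ≤ F j * (D / N) := by
    intro a j
    have := que_W {w : G → ℝ | (WithLp.toLp 2 w : EuclideanSpace ℝ G) ∈ W} (fun i g => (a i : EuclideanSpace ℝ G) g)
      ?_ ?_ ?_ ?_ (ft j) (que_center (f j)).1
    · refine ⟨this.1, this.2.trans ?_⟩
      exact mul_le_mul_of_nonneg_right (que_center (f j)).2 (by positivity)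
    · intro i k
      have := a.inner_eq_ite i k
      rw [← this, Submodule.coe_inner, PiLp.inner_apply]
      simp [mul_comm]
    · intro w hw
      refine ⟨fun i => inner ℝ (a i) ⟨_, hw⟩, fun g => ?_⟩
      have := a.sum_repr' ⟨_, hw⟩
      have := congrArg (fun z : W => (z : EuclideanSpace ℝ G) g) this
      simpa using this.symm
    · intro c
      have : (∑ i, c i • a i : W).1 ∈ W := (∑ i, c i • a i : W).2
      change (WithLp.toLp 2 (fun g => ∑ i, c i * (a i : EuclideanSpace ℝ G) g) : EuclideanSpace ℝ G) ∈ W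
      convert this using 1
      ext g
      simp
    · intro x w hw
      exact hL x _ hw
  have hsg : ∀ s, sg s ^ 2 = 1 := by intro s; cases s <;> simp [sg]
  have K1 : ∀ j x y, inner ℝ (A j x) y = inner ℝ x (A j y) := by
    intro js x y
    rw [real_inner_comm, hAin, hAin]
    congr 1
    exact Finset.sum_congr rfl fun g _ => by ring
  have K2 : ∀ j, ∀ a : OrthonormalBasis (Fin D) ℝ W, ∑ i, queQ (A j) (a i) = 0 := by
    intro js a
    simp_rw [hAq]
    rw [← Finset.mul_sum, (hbasis a js.1).1, mul_zero]
  have K3 : ∀ j, ∀ a : OrthonormalBasis (Fin D) ℝ W, ∑ i, (queQ (A j) (a i))^2 ≤ 1/16 := by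
    intro js a
    simp_rw [hAq, mul_pow, hsg]
    rw [← Finset.mul_sum]
    have h1 := (hbasis a js.1).2
    have hh : h js.1 ^ 2 = F js.1 * (D / N) := Real.sq_sqrt (mul_nonneg (hF _) (by positivity))
    rw [← hh] at h1
    rcases eq_or_ne (h js.1) 0 with hz | hz
    · rw [hz]; norm_num
    · calc _ ≤ 1 * (1 / (4 * h js.1))^2 * (h js.1)^2 := by
            apply mul_le_mul_of_nonneg_left h1 (by positivity)
        _ = 1/16 := by field_simp; norm_num
  obtain ⟨b, hb⟩ := que_key hD A K1 K2 K3
  refine ⟨b, fun k j => ?_⟩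
  have hDpos : 0 < D := k.pos
  have hDr : (0:ℝ) < D := by exact_mod_cast hDpos
  have hunit : ∑ g, ((b k : EuclideanSpace ℝ G) g)^2 = 1 := by
    have h1 := b.orthonormal.1 k
    rw [Submodule.coe_norm] at h1
    rw [← EuclideanSpace.real_norm_sq_eq, h1]; norm_num
  have hdev : (∑ g : G, f j g * ((b k : EuclideanSpace ℝ G) g) ^ 2) - (∑ g : G, f j g) / N
      = ∑ g, ft j g * ((b k : EuclideanSpace ℝ G) g)^2 := by
    simp only [ft, sub_mul]
    rw [Finset.sum_sub_distrib, ← Finset.mul_sum, hunit, mul_one]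
  rw [hdev]
  set q := ∑ g, ft j g * ((b k : EuclideanSpace ℝ G) g)^2
  rcases (hF j).eq_or_lt with h0 | hpos
  · have hz : ∀ g, f j g = 0 := by
      intro g
      have := (Finset.sum_eq_zero_iff_of_nonneg (fun g _ => sq_nonneg (f j g))).1 h0.symm g (Finset.mem_univ g)
      exact pow_eq_zero_iff (two_ne_zero) |>.1 this
    have hq0 : q = 0 := Finset.sum_eq_zero fun g _ => by simp [ft, hz]
    rw [hq0, abs_zero]
    positivity
  · have hhpos : 0 < h j := Real.sqrt_pos.2 (by positivity)
    have e1 := hb k (j, true)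
    have e2 := hb k (j, false)
    rw [hAq] at e1 e2
    have hcard : ((Fintype.card (Fin M × Bool) : ℕ) : ℝ) * D = (2 * M : ℝ) * D := by
      rw [Fintype.card_prod, Fintype.card_fin, Fintype.card_bool]; push_cast; ring
    rw [hcard] at e1 e2
    simp only [sg, if_true] at e1 e2
    have hn := hnum hDpos
    have hbound : ∀ z : ℝ, D * (1 / (4 * h j) * z) ≤ Real.log ((2 * M : ℝ) * D) + 1/8 →
        z ≤ t * √(F j) / √N := by
      intro z hz
      have h2 : D * (1 / (4 * h j) * z) ≤ t * √D / 4 := by linarith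
      have h3 : D * (1 / (4 * h j) * z) = D * z / (4 * h j) := by ring
      rw [h3, div_le_iff₀ (by positivity)] at h2
      have h4 : h j = √(F j) * √D / √N := by
        simp only [h]
        rw [Real.sqrt_mul (hF j), Real.sqrt_div hDr.le]; ring
      have h5 : √(D:ℝ) * √D = D := Real.mul_self_sqrt hDr.le
      have h6 : t * √D / 4 * (4 * h j) = D * (t * √(F j) / √N) := by
        rw [h4]
        calc _ = (√(D:ℝ) * √D) * (t * √(F j) / √N) := by ring
          _ = _ := by rw [h5]
      rw [h6] at h2
      exact le_of_mul_le_mul_left h2 hDr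
    rw [abs_le]
    constructor
    · have := hbound (-q) (by refine le_trans (le_of_eq ?_) e2; simp [q])
      linarith
    · exact hbound q (by refine le_trans (le_of_eq ?_) e1; simp [q])
end
section
variable {G : Type} [Group G] [Fintype G]

/-- the adjacency operator plus the all-ones operator -/
noncomputable def queT (S : Finset G) : EuclideanSpace ℝ G →ₗ[ℝ] EuclideanSpace ℝ G where
  toFun x := WithLp.toLp 2 (fun g => ∑ s ∈ S, x (g * s) + ∑ h, x h)
  map_add' x y := by ext g; simp [Finset.sum_add_distrib]; ring
  map_smul' c x := by ext g; simp [← Finset.mul_sum]; ring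

lemma queT_apply (S : Finset G) (x : EuclideanSpace ℝ G) (g : G) :
    queT S x g = ∑ s ∈ S, x (g * s) + ∑ h, x h := rfl

lemma queT_symm (S : Finset G) (hS : ∀ s ∈ S, s⁻¹ ∈ S) : (queT S).IsSymmetric := by
  intro x y
  simp only [PiLp.inner_apply, queT_apply, RCLike.inner_apply, conj_trivial]
  simp_rw [mul_add, add_mul, Finset.sum_add_distrib]
  congr 1
  · simp_rw [Finset.mul_sum, Finset.sum_mul]
    rw [Finset.sum_comm, Finset.sum_comm (s := Finset.univ) (t := S)]
    refine Finset.sum_bij' (fun s _ => s⁻¹) (fun s _ => s⁻¹) hS hS (by simp) (by simp) ?_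
    intro s _
    rw [← Equiv.sum_comp (Equiv.mulRight s⁻¹)]
    simp
  · rw [← Finset.sum_mul, ← Finset.mul_sum]

lemma que_const (S : Finset G) (w : G → ℝ)
    (hw : ∀ g, ∑ s ∈ S, w (g * s) + ∑ h, w h = ((S.card : ℝ) + Fintype.card G) * w g) :
    ∀ g h, w g = w h := by
  obtain ⟨g0, -, hg0⟩ := Finset.exists_max_image Finset.univ w ⟨1, Finset.mem_univ _⟩
  have h0 : ∑ s ∈ S, (w g0 - w (g0 * s)) + ∑ h, (w g0 - w h) = 0 := by
    have := hw g0
    rw [Finset.sum_sub_distrib, Finset.sum_sub_distrib]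
    simp
    linarith
  have h1 : 0 ≤ ∑ s ∈ S, (w g0 - w (g0 * s)) :=
    Finset.sum_nonneg fun s _ => sub_nonneg.2 (hg0 _ (Finset.mem_univ _))
  have h2 : ∀ h ∈ Finset.univ, 0 ≤ w g0 - w h := fun h _ => sub_nonneg.2 (hg0 _ (Finset.mem_univ _))
  have h3 : ∑ h, (w g0 - w h) = 0 := le_antisymm (by linarith) (Finset.sum_nonneg h2)
  have h4 := (Finset.sum_eq_zero_iff_of_nonneg h2).1 h3
  intro g h
  have := h4 g (Finset.mem_univ _)
  have := h4 h (Finset.mem_univ _)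
  linarith

lemma que_sumzero (S : Finset G) (w : G → ℝ) (μ : ℝ)
    (hw : ∀ g, ∑ s ∈ S, w (g * s) + ∑ h, w h = μ * w g) (hμ : μ ≠ (S.card : ℝ) + Fintype.card G) :
    ∑ g, w g = 0 := by
  have h1 : ∑ g, (∑ s ∈ S, w (g * s) + ∑ h, w h) = μ * ∑ g, w g := by
    rw [Finset.mul_sum]; exact Finset.sum_congr rfl fun g _ => hw g
  rw [Finset.sum_add_distrib, Finset.sum_comm] at h1
  have h2 : ∀ s ∈ S, ∑ g, w (g * s) = ∑ g, w g := fun s _ => Equiv.sum_comp (Equiv.mulRight s) w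
  rw [Finset.sum_congr rfl h2] at h1
  simp only [Finset.sum_const, nsmul_eq_mul, Finset.card_univ] at h1
  have h3 : (μ - ((S.card : ℝ) + Fintype.card G)) * ∑ g, w g = 0 := by linarith
  exact (mul_eq_zero.1 h3).resolve_left (sub_ne_zero.2 hμ)

lemma que_eigen (S : Finset G)
    (t : ℝ) (ht : 0 < t) (M : ℕ) (hM : 0 < M)
    {ι : Type} [Fintype ι] (V : ι → Type)
    [∀ i, AddCommGroup (V i)] [∀ i, Module ℂ (V i)]
    (π : ∀ i, Representation ℂ G (V i))
    (hcomplete : ∀ (W : Type) [AddCommGroup W] [Module ℂ W],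
      ∀ _ : FiniteDimensional ℂ W, ∀ ρ : Representation ℂ G W,
        RepIrreducible ρ → RepNontrivial ρ → ∃ i, RepIso ρ (π i))
    (hsum : 2 * (M : ℝ) * ∑ i, (Module.finrank ℂ (V i) : ℝ) ^ 2 *
        (6 * Real.exp (-(t * Real.sqrt (Module.finrank ℂ (V i)) / 64)) +
          2 * Real.exp (-((Module.finrank ℂ (V i) : ℝ) / 12))) < 1)
    (f : Fin M → G → ℝ) (μ : ℝ) :
    ∃ b : OrthonormalBasis (Fin (Module.finrank ℝ (Module.End.eigenspace (queT S) μ))) ℝ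
        (Module.End.eigenspace (queT S) μ), ∀ k,
      (∃ ν : ℝ, ∀ g, ∑ s ∈ S, (b k : EuclideanSpace ℝ G) (g * s) = ν * (b k : EuclideanSpace ℝ G) g) ∧
      ∀ j, |(∑ g : G, f j g * ((b k : EuclideanSpace ℝ G) g) ^ 2) - (∑ g : G, f j g) / (Fintype.card G : ℝ)| ≤
          t * Real.sqrt (∑ g : G, f j g ^ 2) / Real.sqrt (Fintype.card G) := by
  have hN : (0:ℝ) < Fintype.card G := by exact_mod_cast Fintype.card_pos
  set W := Module.End.eigenspace (queT S) μ with hW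
  have hmem : ∀ w : EuclideanSpace ℝ G, w ∈ W ↔ ∀ g, ∑ s ∈ S, w (g * s) + ∑ h, w h = μ * w g := by
    intro w
    rw [hW, Module.End.mem_eigenspace_iff]
    constructor
    · intro h g
      have := congrArg (fun z : EuclideanSpace ℝ G => z g) h
      simpa [queT_apply] using this
    · intro h
      ext g
      rw [queT_apply, h]
      simp
  by_cases hμ : μ = (S.card : ℝ) + Fintype.card G
  · refine ⟨stdOrthonormalBasis ℝ W, fun k => ?_⟩
    set b := stdOrthonormalBasis ℝ W
    have hb := (hmem _).1 (b k).2
    rw [hμ] at hb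
    have hc := que_const S _ hb
    refine ⟨⟨S.card, fun g => ?_⟩, fun j => ?_⟩
    · rw [Finset.sum_congr rfl (fun s _ => hc (g * s) g)]
      simp
    · have hunit : ∑ g, ((b k : EuclideanSpace ℝ G) g)^2 = 1 := by
        have h1 := b.orthonormal.1 k
        rw [Submodule.coe_norm] at h1
        rw [← EuclideanSpace.real_norm_sq_eq, h1]; norm_num
      have hcs : ∑ g, ((b k : EuclideanSpace ℝ G) g)^2 = ∑ _g : G, ((b k : EuclideanSpace ℝ G) 1)^2 :=
        Finset.sum_congr rfl (fun g _ => by rw [hc g 1])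
      rw [hcs] at hunit
      simp only [Finset.sum_const, nsmul_eq_mul, Finset.card_univ] at hunit
      have h2 : ((b k : EuclideanSpace ℝ G) 1)^2 = 1 / Fintype.card G := by
        rw [eq_div_iff hN.ne', mul_comm]; exact hunit
      have h3 : ∑ g : G, f j g * ((b k : EuclideanSpace ℝ G) g) ^ 2 =
          ∑ g : G, f j g * (1 / (Fintype.card G : ℝ)) :=
        Finset.sum_congr rfl (fun g _ => by rw [hc g 1, h2])
      rw [h3, ← Finset.sum_mul, mul_one_div, sub_self, abs_zero]
      positivity
  · have hz : ∀ w ∈ W, ∑ g, w g = 0 := fun w hw => que_sumzero S _ μ ((hmem w).1 hw) hμ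
    have hL : ∀ x : G, ∀ w ∈ W, (WithLp.toLp 2 (fun g => w (x * g)) : EuclideanSpace ℝ G) ∈ W := by
      intro x w hw
      rw [hmem] at hw ⊢
      intro g
      have h1 := hw (x * g)
      have h2 : ∑ h, w (x * h) = ∑ h, w h := Equiv.sum_comp (Equiv.mulLeft x) (fun h => w h)
      simp only [h2, ← mul_assoc]
      exact h1
    have hnum : 0 < Module.finrank ℝ W →
        4 * (Real.log ((2 * M : ℝ) * (Module.finrank ℝ W : ℕ)) + 1/8) ≤ t * √((Module.finrank ℝ W : ℕ) : ℝ) := by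
      intro hpos
      let a := stdOrthonormalBasis ℝ W
      obtain ⟨i, hi1, hi2⟩ := que_rep V π hcomplete (fun i g => (a i : EuclideanSpace ℝ G) g) ⟨0, hpos⟩
        (by
          intro h
          have h1 := a.orthonormal.1 ⟨0, hpos⟩
          have h2 : a ⟨0, hpos⟩ = 0 := by
            ext g
            exact congrFun h g
          rw [h2] at h1
          simp at h1)
        (fun i => hz _ (a i).2)
        (by
          intro x i
          refine ⟨fun k => inner ℝ (a k) ⟨_, hL x _ (a i).2⟩, fun g => ?_⟩
          have := a.sum_repr' ⟨_, hL x _ (a i).2⟩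
          have := congrArg (fun z : W => (z : EuclideanSpace ℝ G) g) this
          simpa using this.symm)
      refine que_num hi1 hi2 hM ht (lt_of_le_of_lt ?_ hsum)
      refine mul_le_mul_of_nonneg_left ?_ (by positivity)
      refine le_trans ?_ (Finset.single_le_sum (f := fun i => (Module.finrank ℂ (V i) : ℝ) ^ 2 *
        (6 * Real.exp (-(t * Real.sqrt (Module.finrank ℂ (V i)) / 64)) +
          2 * Real.exp (-((Module.finrank ℂ (V i) : ℝ) / 12)))) (fun i _ => by positivity) (Finset.mem_univ i))
      refine mul_le_mul_of_nonneg_left ?_ (by positivity)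
      have := Real.exp_nonneg (-((Module.finrank ℂ (V i) : ℝ) / 12))
      linarith
    obtain ⟨b, hb⟩ := que_sub W rfl hL t ht hnum f
    refine ⟨b, fun k => ⟨⟨μ, fun g => ?_⟩, hb k⟩⟩
    have h1 := (hmem _).1 (b k).2 g
    rw [hz _ (b k).2, add_zero] at h1
    exact h1

lemma que_complexify (b : OrthonormalBasis G ℝ (EuclideanSpace ℝ G)) :
    ∃ B : OrthonormalBasis G ℂ (EuclideanSpace ℂ G), ∀ φ g, B φ g = (b φ g : ℂ) := by
  classical
  let v : G → EuclideanSpace ℂ G := fun φ => WithLp.toLp 2 (fun g => (b φ g : ℂ))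
  have hv : Orthonormal ℂ v := by
    rw [orthonormal_iff_ite]
    intro i k
    have := b.inner_eq_ite i k
    rw [PiLp.inner_apply] at this ⊢
    simp only [v, RCLike.inner_apply, conj_trivial, Complex.conj_ofReal] at this ⊢
    rw [← Complex.ofReal_one, ← Complex.ofReal_zero, ← apply_ite, ← this]
    push_cast
    rfl
  have hcard : Fintype.card G = Module.finrank ℂ (EuclideanSpace ℂ G) := by simp
  let B0 := basisOfOrthonormalOfCardEqFinrank hv hcard
  refine ⟨B0.toOrthonormalBasis (by rw [coe_basisOfOrthonormalOfCardEqFinrank]; exact hv), fun φ g => ?_⟩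
  simp [B0, v]
end


end

/-- **QUE for Cayley graphs of quasirandom groups** (Theorem 1, functional form).
The family `(V i, π i)` is a set of representatives of the isomorphism classes of non-trivial
irreducible complex representations of the finite group `G`. -/
theorem stmt_0 {G : Type} [Group G] [Fintype G]
    (S : Finset G) (hS : ∀ s ∈ S, s⁻¹ ∈ S)
    (t : ℝ) (ht : 0 < t) (M : ℕ) (hM : 0 < M)
    {ι : Type} [Fintype ι] (V : ι → Type)
    [∀ i, AddCommGroup (V i)] [∀ i, Module ℂ (V i)] [∀ i, FiniteDimensional ℂ (V i)]
    (π : ∀ i, Representation ℂ G (V i))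
    (hirr : ∀ i, RepIrreducible (π i))
    (hnt : ∀ i, RepNontrivial (π i))
    (hpairwise : ∀ i j, i ≠ j → ¬ RepIso (π i) (π j))
    (hcomplete : ∀ (W : Type) [AddCommGroup W] [Module ℂ W],
      ∀ _ : FiniteDimensional ℂ W, ∀ ρ : Representation ℂ G W,
        RepIrreducible ρ → RepNontrivial ρ → ∃ i, RepIso ρ (π i))
    (hsum : 2 * (M : ℝ) * ∑ i, (Module.finrank ℂ (V i) : ℝ) ^ 2 *
        (6 * Real.exp (-(t * Real.sqrt (Module.finrank ℂ (V i)) / 64)) +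
          2 * Real.exp (-((Module.finrank ℂ (V i) : ℝ) / 12))) < 1)
    (f : Fin M → G → ℝ) :
    ∃ B : OrthonormalBasis G ℂ (EuclideanSpace ℂ G),
      (∀ φ : G, (∀ g : G, (B φ g).im = 0) ∧
        ∃ μ : ℂ, ∀ g : G, ∑ s ∈ S, B φ (g * s) = μ * B φ g) ∧
      (∀ (φ : G) (j : Fin M),
        |(∑ g : G, f j g * ‖B φ g‖ ^ 2) - (∑ g : G, f j g) / (Fintype.card G : ℝ)| ≤
          t * Real.sqrt (∑ g : G, f j g ^ 2) / Real.sqrt (Fintype.card G)) := by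
  classical
  have hT := queT_symm S hS
  choose b hb using que_eigen S t ht M hM V π hcomplete hsum f
  let B0 := hT.direct_sum_isInternal.collectedOrthonormalBasis hT.orthogonalFamily_eigenspaces'
    (fun μ : Module.End.Eigenvalues (queT S) => b μ)
  have hB0 : ∀ a, B0 a = (b a.1 a.2 : EuclideanSpace ℝ G) := by
    intro a
    simp [B0, DirectSum.IsInternal.collectedOrthonormalBasis]
  have hcard : Fintype.card (Σ μ : Module.End.Eigenvalues (queT S),
      Fin (Module.finrank ℝ (Module.End.eigenspace (queT S) (μ : ℝ)))) = Fintype.card G := by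
    rw [← Module.finrank_eq_card_basis B0.toBasis]
    simp
  let e := Fintype.equivOfCardEq hcard
  obtain ⟨B, hB⟩ := que_complexify (B0.reindex e)
  have hB' : ∀ φ g, B φ g = (((b (e.symm φ).1 (e.symm φ).2 : EuclideanSpace ℝ G) g : ℝ) : ℂ) := by
    intro φ g
    rw [hB, OrthonormalBasis.reindex_apply, hB0]
  refine ⟨B, fun φ => ⟨fun g => by rw [hB', Complex.ofReal_im], ?_⟩, fun φ j => ?_⟩
  · obtain ⟨ν, hν⟩ := (hb (e.symm φ).1 (e.symm φ).2).1
    refine ⟨ν, fun g => ?_⟩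
    simp_rw [hB']
    exact_mod_cast hν g
  · have h1 := (hb (e.symm φ).1 (e.symm φ).2).2 j
    simp_rw [hB', Complex.norm_real, Real.norm_eq_abs, sq_abs]
    exact h1
end

section
/- Let G be a finite group, S ⊆ G a symmetric subset (S = S⁻¹), t > 0 and M a positive integer such that 2M · Σ_{(π,V)} (dim V)² · (6·exp(−t·√(dim V)/64) + 2·exp(−(dim V)/12)) < 1, where the sum ranges over a set of representatives of the isomorphism classes of non-trivial irreducible complex representations (π, V) of G. Then for any subsets A_1, …, A_M ⊆ G there exists an orthonormal basis B of ℓ²(G) consisting of real-valued eigenfunctions of the adjacency operator of Cay(G, S) such that for every φ ∈ B and every j = 1, …, M one has |Σ_{g∈A_j} |φ(g)|² − |A_j|/|G|| ≤ t·√|A_j|/√|G|. -/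
open scoped BigOperators

noncomputable section

/-- The sign attached to a Boolean. -/
def sg (b : Bool) : ℝ := if b then 1 else -1

lemma sg_sq (b : Bool) : sg b * sg b = 1 := by cases b <;> simp [sg]

/-- Sub-Gaussian bound for Rademacher sums. -/
lemma rad_mgf {n : ℕ} (a : Fin n → ℝ) :
    ∑ ε : Fin n → Bool, Real.exp (∑ j, a j * sg (ε j)) ≤
      2 ^ n * Real.exp ((∑ j, a j ^ 2) / 2) := by
  have h1 : ∑ ε : Fin n → Bool, Real.exp (∑ j, a j * sg (ε j)) =
      ∏ j, ∑ b : Bool, Real.exp (a j * sg b) := by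
    rw [Finset.prod_univ_sum]
    simp only [Fintype.piFinset_univ, Real.exp_sum]
  rw [h1]
  have h2 : ∀ j, ∑ b : Bool, Real.exp (a j * sg b) ≤ 2 * Real.exp (a j ^ 2 / 2) := by
    intro j
    have := Real.cosh_le_exp_half_sq (a j)
    rw [Real.cosh_eq] at this
    simp [sg]
    linarith
  calc _ ≤ ∏ j, (2 * Real.exp (a j ^ 2 / 2)) :=
        Finset.prod_le_prod (fun j _ => Finset.sum_nonneg fun b _ => (Real.exp_pos _).le)
          (fun j _ => h2 j)
    _ = _ := by
      rw [Finset.prod_mul_distrib, ← Real.exp_sum, Finset.sum_div]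
      simp

lemma rad_moment {n : ℕ} (a : Fin n → ℝ) (k : ℕ) (V : ℝ) (hV : 0 < V)
    (hVa : ∑ j, a j ^ 2 ≤ V) :
    ∑ ε : Fin n → Bool, (∑ j, a j * sg (ε j)) ^ (2 * k) ≤
      2 ^ n * ((k.factorial : ℝ) * (Real.exp 1 * V) ^ k) := by
  rcases Nat.eq_zero_or_pos k with rfl | hk
  · simp
  have hk' : (0 : ℝ) < k := by exact_mod_cast hk
  set θ : ℝ := Real.sqrt (2 * k / V) with hθ
  have hθ2 : θ ^ 2 = 2 * k / V := Real.sq_sqrt (by positivity)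
  have hθp : 0 < θ := Real.sqrt_pos.2 (by positivity)
  have key : ∀ x : ℝ, x ^ (2 * k) ≤ (2 * k).factorial / θ ^ (2 * k) *
      ((Real.exp (θ * x) + Real.exp (-(θ * x))) / 2) := by
    intro x
    rw [← Real.cosh_eq]
    have h1 : (θ * x) ^ (2 * k) / (2 * k).factorial ≤ Real.cosh (θ * x) := by
      have := (Real.hasSum_cosh (θ * x)).summable.le_tsum k (fun j _ => by
        rw [pow_mul]; positivity)
      rwa [(Real.hasSum_cosh (θ * x)).tsum_eq] at this
    rw [div_mul_eq_mul_div, le_div_iff₀ (by positivity)]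
    rw [div_le_iff₀ (by positivity), mul_pow] at h1
    linarith
  have hm : ∀ c : ℝ, c ^ 2 = θ ^ 2 → ∑ ε : Fin n → Bool, Real.exp (c * ∑ j, a j * sg (ε j)) ≤
      2 ^ n * Real.exp k := by
    intro c hc
    have := rad_mgf (fun j => c * a j)
    simp only [mul_assoc, ← Finset.mul_sum] at this
    refine this.trans ?_
    gcongr
    simp only [mul_pow, ← Finset.mul_sum, hc, hθ2]
    calc 2 * (k : ℝ) / V * (∑ j, a j ^ 2) / 2 ≤ 2 * (k : ℝ) / V * V / 2 := by gcongr
      _ = k := by field_simp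
  have hp := hm θ rfl
  have hn := hm (-θ) (by ring)
  have hfac : ((2 * k).factorial : ℝ) ≤ k.factorial * (2 * k) ^ k := by
    have := Nat.factorial_mul_pow_le_factorial (m := k) (n := k)
    have h2 : (2 * k).factorial ≤ k.factorial * (2 * k) ^ k := by
      rw [two_mul]
      rw [← Nat.factorial_mul_ascFactorial]
      gcongr
      rw [Nat.ascFactorial_eq_prod_range]
      calc _ ≤ ∏ i ∈ Finset.range k, (k + k) :=
            Finset.prod_le_prod' (fun i hi => by have := Finset.mem_range.1 hi; omega)
        _ = _ := by simp
    exact_mod_cast h2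
  calc ∑ ε : Fin n → Bool, (∑ j, a j * sg (ε j)) ^ (2 * k)
      ≤ ∑ ε : Fin n → Bool, (2 * k).factorial / θ ^ (2 * k) *
      ((Real.exp (θ * ∑ j, a j * sg (ε j)) + Real.exp (-(θ * ∑ j, a j * sg (ε j)))) / 2) :=
        Finset.sum_le_sum fun ε _ => key _
    _ = (2 * k).factorial / θ ^ (2 * k) *
      ((∑ ε : Fin n → Bool, Real.exp (θ * ∑ j, a j * sg (ε j)) +
        ∑ ε : Fin n → Bool, Real.exp (-θ * ∑ j, a j * sg (ε j))) / 2) := by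
        rw [← Finset.mul_sum, ← Finset.sum_div, Finset.sum_add_distrib]
        simp
    _ ≤ (2 * k).factorial / θ ^ (2 * k) * ((2 ^ n * Real.exp k + 2 ^ n * Real.exp k) / 2) := by
        gcongr
    _ ≤ (k.factorial * (2 * k) ^ k) / θ ^ (2 * k) *
        ((2 ^ n * Real.exp k + 2 ^ n * Real.exp k) / 2) := by
        gcongr
    _ = _ := by
        rw [pow_mul, hθ2, div_pow, mul_pow (Real.exp 1), ← Real.exp_nat_mul]
        field_simp
        ring

lemma rad_exp_sq {n : ℕ} (a : Fin n → ℝ) (c V : ℝ) (hc : 0 ≤ c)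
    (hVa : ∑ j, a j ^ 2 ≤ V) (hcV : c * V ≤ 1 / 6) :
    ∑ ε : Fin n → Bool, Real.exp (c * (∑ j, a j * sg (ε j)) ^ 2) ≤ 2 ^ n * 2 := by
  have hV0 : 0 ≤ V := (Finset.sum_nonneg fun j _ => sq_nonneg _).trans hVa
  rcases hV0.eq_or_lt with hV | hV
  · have : ∀ j, a j = 0 := by
      intro j
      have := (Finset.sum_eq_zero_iff_of_nonneg (fun j _ => sq_nonneg (a j))).1
        (le_antisymm (hVa.trans hV.symm.le) (Finset.sum_nonneg fun j _ => sq_nonneg _)) j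
        (Finset.mem_univ j)
      simpa using this
    simp [this]
  have h1 : ∀ ε : Fin n → Bool, HasSum
      (fun k : ℕ => c ^ k / k.factorial * (∑ j, a j * sg (ε j)) ^ (2 * k))
      (Real.exp (c * (∑ j, a j * sg (ε j)) ^ 2)) := by
    intro ε
    have := NormedSpace.expSeries_div_hasSum_exp (c * (∑ j, a j * sg (ε j)) ^ 2)
    rw [← Real.exp_eq_exp_ℝ] at this
    have e : (fun k : ℕ => c ^ k / k.factorial * (∑ j, a j * sg (ε j)) ^ (2 * k)) =
        fun k : ℕ => (c * (∑ j, a j * sg (ε j)) ^ 2) ^ k / (k.factorial : ℝ) := by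
      funext k
      rw [mul_pow, pow_mul]; ring
    rw [e]
    exact this
  have h2 := hasSum_sum (fun ε (_ : ε ∈ (Finset.univ : Finset (Fin n → Bool))) => h1 ε)
  have h3 : HasSum (fun k : ℕ => (2 : ℝ) ^ n * (1 / 2) ^ k) (2 ^ n * 2) :=
    hasSum_geometric_two.mul_left _
  refine hasSum_le (fun k => ?_) h2 h3
  rw [← Finset.mul_sum]
  have := rad_moment a k V hV hVa
  have he : c * (Real.exp 1 * V) ≤ 1 / 2 := by
    have := Real.exp_one_lt_d9
    nlinarith [Real.exp_pos 1]
  calc _ ≤ c ^ k / k.factorial * (2 ^ n * ((k.factorial : ℝ) * (Real.exp 1 * V) ^ k)) := by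
        gcongr
    _ = 2 ^ n * (c * (Real.exp 1 * V)) ^ k := by
        rw [mul_pow c]; field_simp
    _ ≤ _ := by gcongr

/-- The predictable coefficients. -/
def predY {n : ℕ} (a : Fin n → Fin n → ℝ) (ε : Fin n → Bool) (l : Fin n) : ℝ :=
  ∑ j, (if l < j then a l j else 0) * sg (ε j)

lemma mart : ∀ (n : ℕ) (a : Fin n → Fin n → ℝ),
    ∑ ε : Fin n → Bool, Real.exp (∑ l, (sg (ε l) * predY a ε l - predY a ε l ^ 2 / 2)) ≤
      2 ^ n := by
  intro n
  induction n with
  | zero => intro a; simp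
  | succ n ih =>
    intro a
    rw [← (Fin.consEquiv (fun _ : Fin (n+1) => Bool)).sum_comp, Fintype.sum_prod_type_right]
    have hY0 : ∀ (b : Bool) (ε : Fin n → Bool),
        predY a (Fin.cons b ε : Fin (n+1) → Bool) 0 = ∑ j, a 0 j.succ * sg (ε j) := by
      intro b ε
      simp [predY, Fin.sum_univ_succ]
    have hYs : ∀ (b : Bool) (ε : Fin n → Bool) (l : Fin n),
        predY a (Fin.cons b ε : Fin (n+1) → Bool) l.succ =
          predY (fun i j => a i.succ j.succ) ε l := by
      intro b ε l
      simp [predY, Fin.sum_univ_succ]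
    have hce : ∀ (b : Bool) (ε : Fin n → Bool),
        (Fin.consEquiv (fun _ : Fin (n+1) => Bool)) (b, ε) =
          (Fin.cons b ε : Fin (n+1) → Bool) := fun _ _ => rfl
    simp only [hce, Fin.sum_univ_succ, hY0, hYs, Fin.cons_zero, Fin.cons_succ,
      Real.exp_add]
    calc _ ≤ ∑ ε : Fin n → Bool, 2 * Real.exp (∑ l, (sg (ε l) *
          predY (fun i j => a i.succ j.succ) ε l -
          predY (fun i j => a i.succ j.succ) ε l ^ 2 / 2)) := by
          refine Finset.sum_le_sum fun ε _ => ?_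
          rw [← Finset.sum_mul]
          gcongr
          set y := ∑ j, a 0 j.succ * sg (ε j)
          have := Real.cosh_le_exp_half_sq y
          rw [Real.cosh_eq] at this
          simp only [Fintype.sum_bool, sg, Real.exp_sub]
          simp only [if_true, Bool.false_eq_true, if_false, one_mul, neg_mul]
          rw [← add_div, div_le_iff₀ (Real.exp_pos _)]
          linarith
      _ ≤ 2 * 2 ^ n := by
          rw [← Finset.mul_sum]
          gcongr
          exact ih _
      _ = _ := by ring

/-- Exponential moments of a Rademacher chaos of order two. -/
lemma chaos_mgf {n : ℕ} (a : Fin n → Fin n → ℝ) (lam T : ℝ)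
    (hT : ∑ l, ∑ j, (if l < j then a l j else 0) ^ 2 ≤ T) (hl : 2 * lam ^ 2 * T ≤ 1 / 6) :
    ∑ ε : Fin n → Bool, Real.exp (lam * ∑ l, sg (ε l) * predY a ε l) ≤ 2 ^ n * (3 / 2) := by
  set t : Fin n → ℝ := fun l => ∑ j, (if l < j then a l j else 0) ^ 2 with ht
  have ht0 : ∀ l, 0 ≤ t l := fun l => Finset.sum_nonneg fun j _ => sq_nonneg _
  set T' := ∑ l, t l with hT'
  have hT'0 : 0 ≤ T' := Finset.sum_nonneg fun l _ => ht0 l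
  -- the quadratic variation
  have hQ : ∑ ε : Fin n → Bool, Real.exp (2 * lam ^ 2 * ∑ l, predY a ε l ^ 2) ≤ 2 ^ n * 2 := by
    rcases hT'0.eq_or_lt with h0 | hpos
    · have hz : ∀ l, t l = 0 := fun l =>
        (Finset.sum_eq_zero_iff_of_nonneg (fun l _ => ht0 l)).1 h0.symm l (Finset.mem_univ l)
      have hy : ∀ ε l, predY a ε l = 0 := by
        intro ε l
        refine Finset.sum_eq_zero fun j _ => ?_
        have := (Finset.sum_eq_zero_iff_of_nonneg (fun j _ => sq_nonneg _)).1 (hz l) j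
          (Finset.mem_univ j)
        rw [pow_eq_zero_iff two_ne_zero] at this
        rw [this, zero_mul]
      simp [hy]
    have hw1 : ∑ l, t l / T' = 1 := by rw [← Finset.sum_div, ← hT', div_self hpos.ne']
    have hJ : ∀ ε : Fin n → Bool, Real.exp (2 * lam ^ 2 * ∑ l, predY a ε l ^ 2) ≤
        ∑ l, t l / T' * Real.exp ((2 * lam ^ 2 * T' / t l) * predY a ε l ^ 2) := by
      intro ε
      have := convexOn_exp.map_sum_le (t := Finset.univ) (w := fun l => t l / T')
        (p := fun l => (2 * lam ^ 2 * T' / t l) * predY a ε l ^ 2)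
        (fun l _ => div_nonneg (ht0 l) hT'0) hw1 (fun _ _ => Set.mem_univ _)
      simp only [smul_eq_mul] at this
      refine le_trans (le_of_eq ?_) this
      congr 1
      rw [Finset.mul_sum]
      refine Finset.sum_congr rfl fun l _ => ?_
      rcases (ht0 l).eq_or_lt with hl0 | hlp
      · have hy : predY a ε l = 0 := by
          refine Finset.sum_eq_zero fun j _ => ?_
          have := (Finset.sum_eq_zero_iff_of_nonneg (fun j _ => sq_nonneg _)).1 hl0.symm j
            (Finset.mem_univ j)
          rw [pow_eq_zero_iff two_ne_zero] at this
          rw [this, zero_mul]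
        simp [hy]
      · field_simp
    calc _ ≤ ∑ ε : Fin n → Bool,
        ∑ l, t l / T' * Real.exp ((2 * lam ^ 2 * T' / t l) * predY a ε l ^ 2) :=
          Finset.sum_le_sum fun ε _ => hJ ε
      _ = ∑ l, t l / T' * ∑ ε : Fin n → Bool,
          Real.exp ((2 * lam ^ 2 * T' / t l) * predY a ε l ^ 2) := by
          rw [Finset.sum_comm]; simp only [Finset.mul_sum]
      _ ≤ ∑ l, t l / T' * (2 ^ n * 2) := by
          refine Finset.sum_le_sum fun l _ => ?_
          refine mul_le_mul_of_nonneg_left ?_ (div_nonneg (ht0 l) hT'0)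
          refine rad_exp_sq (fun j => if l < j then a l j else 0) _ (t l)
            (div_nonneg (by positivity) (ht0 l)) le_rfl ?_
          calc 2 * lam ^ 2 * T' / t l * t l ≤ 2 * lam ^ 2 * T' := by
                rcases (ht0 l).eq_or_lt with hl0 | hlp
                · rw [← hl0]; simp; positivity
                · rw [div_mul_cancel₀ _ hlp.ne']
            _ ≤ 2 * lam ^ 2 * T := by gcongr
            _ ≤ _ := hl
      _ = _ := by rw [← Finset.sum_mul, hw1, one_mul]
  have hM := mart n (fun i j => 2 * lam * a i j)
  have hpred : ∀ ε l, predY (fun i j => 2 * lam * a i j) ε l = 2 * lam * predY a ε l := by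
    intro ε l
    simp only [predY, Finset.mul_sum]
    refine Finset.sum_congr rfl fun j _ => ?_
    split_ifs <;> ring
  simp only [hpred] at hM
  have hpt : ∀ ε : Fin n → Bool, Real.exp (lam * ∑ l, sg (ε l) * predY a ε l) ≤
      (Real.exp (∑ l, (sg (ε l) * (2 * lam * predY a ε l) - (2 * lam * predY a ε l) ^ 2 / 2)) +
        Real.exp (2 * lam ^ 2 * ∑ l, predY a ε l ^ 2)) / 2 := by
    intro ε
    set u := Real.exp ((∑ l, (sg (ε l) * (2 * lam * predY a ε l) -
      (2 * lam * predY a ε l) ^ 2 / 2)) / 2) with hu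
    set v := Real.exp ((2 * lam ^ 2 * ∑ l, predY a ε l ^ 2) / 2) with hv
    have e1 : Real.exp (lam * ∑ l, sg (ε l) * predY a ε l) = u * v := by
      rw [hu, hv, ← Real.exp_add]
      congr 1
      rw [Finset.mul_sum, Finset.mul_sum, Finset.sum_div, Finset.sum_div, ← Finset.sum_add_distrib]
      refine Finset.sum_congr rfl fun l _ => ?_
      ring
    have e2 : ∀ x : ℝ, Real.exp x = Real.exp (x / 2) ^ 2 := by
      intro x; rw [← Real.exp_nat_mul]; congr 1; push_cast; ring
    rw [e1, e2 (∑ l, _), e2 (2 * lam ^ 2 * _), ← hu, ← hv]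
    nlinarith [sq_nonneg (u - v)]
  calc _ ≤ _ := Finset.sum_le_sum fun ε _ => hpt ε
    _ ≤ (2 ^ n + 2 ^ n * 2) / 2 := by
      rw [← Finset.sum_div, Finset.sum_add_distrib]
      gcongr
    _ = _ := by ring

lemma exists_signs_fin {n : ℕ} {K : Type*} [Fintype K] (Q : K → Fin n → Fin n → ℝ)
    (hd : ∀ k i, Q k i i = 0) (q : K → ℝ) (hq : ∀ k, 0 ≤ q k)
    (hQ : ∀ k, ∑ i, ∑ j, Q k i j ^ 2 ≤ q k ^ 2) (r : ℝ)
    (hr : (Fintype.card K : ℝ) * 3 < Real.exp (r / 5)) :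
    ∃ ε : Fin n → ℝ, (∀ i, ε i * ε i = 1) ∧
      ∀ k, |∑ i, ∑ j, Q k i j * (ε i * ε j)| ≤ r * q k := by
  set a : K → Fin n → Fin n → ℝ := fun k i j => Q k i j + Q k j i with ha
  set X : K → (Fin n → Bool) → ℝ := fun k ε => ∑ l, sg (ε l) * predY (a k) ε l with hX
  have hsplit : ∀ f : Fin n → Fin n → ℝ, (∀ i, f i i = 0) →
      ∑ i, ∑ j, f i j = ∑ i, ∑ j, if i < j then f i j + f j i else 0 := by
    intro f hf
    have h1 : ∀ i j, f i j = (if i < j then f i j else 0) + (if j < i then f i j else 0) := by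
      intro i j
      rcases lt_trichotomy i j with h | h | h
      · simp [h, h.not_gt]
      · subst h; simp [hf]
      · simp [h, h.not_gt]
    calc ∑ i, ∑ j, f i j = ∑ i, ∑ j, ((if i < j then f i j else 0) +
          (if j < i then f i j else 0)) := by
          refine Finset.sum_congr rfl fun i _ => Finset.sum_congr rfl fun j _ => h1 i j
      _ = ∑ i, ∑ j, (if i < j then f i j else 0) + ∑ j, ∑ i, (if j < i then f i j else 0) := by
          simp only [Finset.sum_add_distrib]
          congr 1
          rw [Finset.sum_comm]
      _ = _ := by
          rw [← Finset.sum_add_distrib]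
          refine Finset.sum_congr rfl fun i _ => ?_
          rw [← Finset.sum_add_distrib]
          refine Finset.sum_congr rfl fun j _ => ?_
          split_ifs <;> simp
  have hXeq : ∀ k ε, ∑ i, ∑ j, Q k i j * (sg (ε i) * sg (ε j)) = X k ε := by
    intro k ε
    rw [hsplit _ (fun i => by simp [hd])]
    simp only [hX, predY, Finset.mul_sum, ha]
    refine Finset.sum_congr rfl fun i _ => Finset.sum_congr rfl fun j _ => ?_
    split_ifs <;> ring
  have hT : ∀ k, ∑ l, ∑ j, (if l < j then a k l j else 0) ^ 2 ≤ 2 * q k ^ 2 := by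
    intro k
    calc ∑ l, ∑ j, (if l < j then a k l j else 0) ^ 2
        ≤ ∑ l, ∑ j, (if l < j then 2 * Q k l j ^ 2 + 2 * Q k j l ^ 2 else 0) := by
          refine Finset.sum_le_sum fun i _ => Finset.sum_le_sum fun j _ => ?_
          split_ifs
          · simp only [ha]; nlinarith [sq_nonneg (Q k i j - Q k j i)]
          · simp
      _ = 2 * ∑ i, ∑ j, Q k i j ^ 2 := by
          rw [← hsplit (fun i j => 2 * Q k i j ^ 2) (fun i => by simp [hd])]
          simp only [Finset.mul_sum]
      _ ≤ _ := by linarith [hQ k]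
  set lam : K → ℝ := fun k => 1 / (5 * q k) with hlam
  have hlam2 : ∀ k, 2 * (lam k) ^ 2 * (2 * q k ^ 2) ≤ 1 / 6 := by
    intro k
    rcases (hq k).eq_or_lt with h | h
    · rw [← h]; norm_num
    · simp only [hlam]
      field_simp
      norm_num
  have hsum : ∑ ε : Fin n → Bool, ∑ k, (Real.exp (lam k * X k ε) + Real.exp (-lam k * X k ε)) ≤
      ∑ ε : Fin n → Bool, (Fintype.card K : ℝ) * 3 := by
    rw [Finset.sum_comm]
    calc _ ≤ ∑ k : K, ((2 : ℝ) ^ n * (3 / 2) + 2 ^ n * (3 / 2)) := by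
          refine Finset.sum_le_sum fun k _ => ?_
          rw [Finset.sum_add_distrib]
          refine add_le_add ?_ ?_
          · exact chaos_mgf (a k) (lam k) _ (hT k) (hlam2 k)
          · exact chaos_mgf (a k) (-lam k) _ (hT k) (by simpa using hlam2 k)
      _ = _ := by
          simp
          ring
  obtain ⟨ε, -, hε⟩ := Finset.exists_le_of_sum_le Finset.univ_nonempty hsum
  refine ⟨fun i => sg (ε i), fun i => sg_sq _, fun k => ?_⟩
  rw [hXeq]
  have hk : Real.exp (lam k * X k ε) + Real.exp (-lam k * X k ε) < Real.exp (r / 5) := by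
    refine lt_of_le_of_lt ?_ (hε.trans_lt hr)
    exact Finset.single_le_sum (f := fun k => Real.exp (lam k * X k ε) +
      Real.exp (-lam k * X k ε)) (fun k _ => by positivity) (Finset.mem_univ k)
  have h1 : lam k * X k ε ≤ r / 5 :=
    Real.exp_le_exp.1 (by linarith [Real.exp_pos (-lam k * X k ε)])
  have h2 : -lam k * X k ε ≤ r / 5 :=
    Real.exp_le_exp.1 (by linarith [Real.exp_pos (lam k * X k ε)])
  rcases (hq k).eq_or_lt with h | h
  · have hz : ∀ i j, Q k i j = 0 := by
      intro i j
      have h0 : ∑ i, ∑ j, Q k i j ^ 2 ≤ 0 := by have := hQ k; rwa [← h, zero_pow two_ne_zero] at this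
      have h3 : Q k i j ^ 2 ≤ 0 :=
        ((Finset.single_le_sum (f := fun j => Q k i j ^ 2) (fun j _ => sq_nonneg _)
          (Finset.mem_univ j)).trans
          (Finset.single_le_sum (f := fun i => ∑ j, Q k i j ^ 2)
            (fun i _ => Finset.sum_nonneg fun j _ => sq_nonneg _) (Finset.mem_univ i))).trans h0
      nlinarith [sq_nonneg (Q k i j)]
    rw [← hXeq]
    simp [hz, ← h]
  · rw [abs_le]
    simp only [hlam] at h1 h2
    have e1 : X k ε = (1 / (5 * q k) * X k ε) * (5 * q k) := by field_simp
    constructor <;> nlinarith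

lemma exists_signs {ι : Type*} [Fintype ι] {K : Type*} [Fintype K] (Q : K → ι → ι → ℝ)
    (hd : ∀ k i, Q k i i = 0) (q : K → ℝ) (hq : ∀ k, 0 ≤ q k)
    (hQ : ∀ k, ∑ i, ∑ j, Q k i j ^ 2 ≤ q k ^ 2) (r : ℝ)
    (hr : (Fintype.card K : ℝ) * 3 < Real.exp (r / 5)) :
    ∃ ε : ι → ℝ, (∀ i, ε i * ε i = 1) ∧
      ∀ k, |∑ i, ∑ j, Q k i j * (ε i * ε j)| ≤ r * q k := by
  let e := Fintype.equivFin ι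
  have hre : ∀ f : ι → ι → ℝ, ∑ i, ∑ j, f (e.symm i) (e.symm j) = ∑ i, ∑ j, f i j := by
    intro f
    rw [← e.symm.sum_comp]
    refine Finset.sum_congr rfl fun i _ => ?_
    rw [← e.symm.sum_comp]
  obtain ⟨ε, h1, h2⟩ := exists_signs_fin (fun k i j => Q k (e.symm i) (e.symm j))
    (fun k i => hd _ _) q hq (fun k => by rw [hre (fun i j => Q k i j ^ 2)]; exact hQ k) r hr
  refine ⟨fun i => ε (e i), fun i => h1 _, fun k => ?_⟩
  have := h2 k
  rw [← hre (fun i j => Q k i j * (ε (e i) * ε (e j)))]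
  simpa using this

/-- Hartley's function `cos + sin` on `ZMod n`. -/
def cas {n : ℕ} [NeZero n] (x : ZMod n) : ℝ :=
  (ZMod.stdAddChar x : ℂ).re + (ZMod.stdAddChar x : ℂ).im

lemma std_neg {n : ℕ} [NeZero n] (x : ZMod n) :
    (ZMod.stdAddChar (-x) : ℂ) = (starRingEnd ℂ) (ZMod.stdAddChar x) :=
  AddChar.map_neg_eq_conj _ _

lemma cas_mul {n : ℕ} [NeZero n] (x y : ZMod n) :
    cas x * cas y = (ZMod.stdAddChar (x - y) : ℂ).re + (ZMod.stdAddChar (x + y) : ℂ).im := by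
  rw [sub_eq_add_neg, AddChar.map_add_eq_mul, AddChar.map_add_eq_mul, std_neg]
  simp [cas]
  ring

lemma cas_sq {n : ℕ} [NeZero n] (x : ZMod n) :
    cas x * cas x = 1 + (ZMod.stdAddChar (x + x) : ℂ).im := by
  rw [cas_mul]; simp

lemma cas_orth {n : ℕ} [NeZero n] (k l : ZMod n) :
    ∑ j : ZMod n, cas (j * k) * cas (j * l) = if k = l then (n : ℝ) else 0 := by
  have h1 : ∀ m : ZMod n, ∑ j : ZMod n, (ZMod.stdAddChar (j * m) : ℂ) =
      if m = 0 then (n : ℂ) else 0 := by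
    intro m
    rw [AddChar.sum_mulShift m (ZMod.isPrimitive_stdAddChar n)]
    simp [ZMod.card]
  simp only [cas_mul, ← mul_sub, ← mul_add]
  rw [Finset.sum_add_distrib, ← Complex.re_sum, ← Complex.im_sum, h1, h1]
  simp only [sub_eq_zero]
  split_ifs <;> simp

lemma im_std_le {n : ℕ} [NeZero n] (x : ZMod n) : |(ZMod.stdAddChar x : ℂ).im| ≤ 1 := by
  refine (Complex.abs_im_le_norm _).trans ?_
  simp

lemma exists_orth {n : ℕ} [NeZero n] {K : Type*} [Fintype K] (P : K → ZMod n → ZMod n → ℝ)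
    (σ : K → ℝ) (hσ : ∀ a, 0 ≤ σ a) (htr : ∀ a, ∑ j, P a j j = n * σ a ^ 2)
    (hHS : ∀ a, ∑ i, ∑ j, P a i j ^ 2 ≤ n * σ a ^ 2) (r : ℝ)
    (hr : (Fintype.card K : ℝ) * n * 3 < Real.exp (r / 5)) :
    ∃ R : ZMod n → ZMod n → ℝ,
      (∀ k l, ∑ j, R k j * R l j = if k = l then 1 else 0) ∧
      ∀ a k, |∑ i, ∑ j, R k i * R k j * P a i j - σ a ^ 2| ≤ 3 * r / Real.sqrt n * σ a := by
  have hn : (0 : ℝ) < n := by exact_mod_cast Nat.pos_of_ne_zero (NeZero.ne n)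
  have hsn : 0 < Real.sqrt n := Real.sqrt_pos.2 hn
  have hsn2 : Real.sqrt n * Real.sqrt n = n := Real.mul_self_sqrt hn.le
  have hcard : (Fintype.card (K × ZMod n) : ℝ) * 3 < Real.exp (r / 5) := by
    simpa [Fintype.card_prod, ZMod.card] using hr
  set s : ZMod n → ℝ := fun x => (ZMod.stdAddChar (x + x) : ℂ).im with hs
  have hs_neg : ∀ x, s (-x) = - s x := by
    intro x
    simp only [hs]
    rw [← neg_add, std_neg]; simp
  have hs1 : ∀ x, s x ^ 2 ≤ 1 := by
    intro x
    have := im_std_le (x + x)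
    rw [← sq_abs]
    exact pow_le_one₀ (abs_nonneg _) this
  -- first choice of signs
  obtain ⟨ζ, hζ1, hζ⟩ := exists_signs
    (fun (p : K × ZMod n) (i j : ZMod n) => if j = -i then s (i * p.2) * P p.1 i i / n else 0)
    (by
      intro p i
      split_ifs with h
      · have : s (i * p.2) = - s (i * p.2) := by
          rw [← hs_neg, ← neg_mul, ← h]
        have : s (i * p.2) = 0 := by linarith
        rw [this]; simp
      · rfl)
    (fun p => σ p.1 / Real.sqrt n) (fun p => div_nonneg (hσ _) hsn.le)
    (by
      intro p
      simp only [ite_pow, zero_pow two_ne_zero, Finset.sum_ite_eq', Finset.mem_univ, if_true]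
      calc _ ≤ ∑ i, P p.1 i i ^ 2 / n ^ 2 := by
            refine Finset.sum_le_sum fun i _ => ?_
            rw [div_pow, mul_pow]
            gcongr
            nlinarith [hs1 (i * p.2), sq_nonneg (P p.1 i i)]
        _ ≤ (∑ i, ∑ j, P p.1 i j ^ 2) / n ^ 2 := by
            rw [Finset.sum_div]
            refine Finset.sum_le_sum fun i _ => ?_
            gcongr
            exact Finset.single_le_sum (f := fun j => P p.1 i j ^ 2) (fun j _ => sq_nonneg _)
              (Finset.mem_univ i)
        _ ≤ (n * σ p.1 ^ 2) / n ^ 2 := by gcongr; exact hHS _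
        _ = _ := by
            rw [div_pow, Real.sq_sqrt hn.le]; field_simp)
    r hcard
  simp only [ite_mul, zero_mul, Finset.sum_ite_eq', Finset.mem_univ, if_true] at hζ
  -- the permutation
  set τ : ZMod n → ZMod n := fun j => if ζ j * ζ (-j) = 1 then j else -j with hτ
  have hη : ∀ j, ζ j * ζ (-j) = 1 ∨ ζ j * ζ (-j) = -1 := by
    intro j
    have h : (ζ j * ζ (-j)) * (ζ j * ζ (-j)) = 1 := by
      linear_combination (ζ (-j) * ζ (-j)) * hζ1 j + hζ1 (-j)
    exact mul_self_eq_one_iff.1 h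
  have hττ : Function.Involutive τ := by
    intro j
    simp only [hτ]
    split_ifs with h1 h2 <;> simp_all [mul_comm]
  have hsτ : ∀ j k, s (τ j * k) = ζ j * ζ (-j) * s (j * k) := by
    intro j k
    simp only [hτ]
    split_ifs with h
    · rw [h, one_mul]
    · rw [(hη j).resolve_left h, neg_mul, hs_neg]; ring
  -- second choice of signs
  set c : ZMod n → ZMod n → ℝ := fun k j => cas (τ j * k) / Real.sqrt n with hc
  have hc2 : ∀ k j, c k j * c k j = (1 + ζ j * ζ (-j) * s (j * k)) / n := by
    intro k j
    simp only [hc]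
    rw [div_mul_div_comm, hsn2, cas_sq]
    rw [← hsτ]
  have hc3 : ∀ k j, c k j ^ 2 ≤ 2 / n := by
    intro k j
    rw [sq, hc2, ← hsτ]
    gcongr
    nlinarith [hs1 (τ j * k)]
  obtain ⟨ε, hε1, hε⟩ := exists_signs
    (fun (p : K × ZMod n) (i j : ZMod n) => if i = j then 0 else c p.2 i * c p.2 j * P p.1 i j)
    (by intro p i; simp)
    (fun p => 2 * σ p.1 / Real.sqrt n) (fun p => div_nonneg (by linarith [hσ p.1]) hsn.le)
    (by
      intro p
      calc _ ≤ ∑ i, ∑ j, (2 / n) * (2 / n) * P p.1 i j ^ 2 := by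
            refine Finset.sum_le_sum fun i _ => Finset.sum_le_sum fun j _ => ?_
            split_ifs
            · rw [zero_pow two_ne_zero]; positivity
            · rw [mul_pow, mul_pow]
              gcongr
              · exact hc3 _ _
              · exact hc3 _ _
        _ = (2 / n) * (2 / n) * ∑ i, ∑ j, P p.1 i j ^ 2 := by simp only [Finset.mul_sum]
        _ ≤ (2 / n) * (2 / n) * (n * σ p.1 ^ 2) := by gcongr; exact hHS _
        _ = _ := by
            rw [div_pow, Real.sq_sqrt hn.le]; field_simp)
    r hcard
  refine ⟨fun k j => ε j * c k j, ?_, ?_⟩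
  · intro k l
    calc ∑ j, ε j * c k j * (ε j * c l j) = ∑ j, c k j * c l j := by
          refine Finset.sum_congr rfl fun j _ => ?_
          linear_combination (c k j * c l j) * hε1 j
      _ = (∑ j, cas (τ j * k) * cas (τ j * l)) / n := by
          rw [Finset.sum_div]
          refine Finset.sum_congr rfl fun j _ => ?_
          simp only [hc]
          rw [div_mul_div_comm, hsn2]
      _ = (∑ j, cas (j * k) * cas (j * l)) / n := by
          congr 1
          exact Equiv.sum_comp (hττ.toPerm τ) (fun j => cas (j * k) * cas (j * l))
      _ = _ := by
          rw [cas_orth]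
          split_ifs
          · field_simp
          · simp
  · intro a k
    have h1 := hζ (a, k)
    have h2 := hε (a, k)
    dsimp only at h1 h2
    have key : ∑ i, ∑ j, ε i * c k i * (ε j * c k j) * P a i j - σ a ^ 2 =
        (∑ i, s (i * k) * P a i i / n * (ζ i * ζ (-i))) +
        ∑ i, ∑ j, (if i = j then 0 else c k i * c k j * P a i j) * (ε i * ε j) := by
      have hsp : ∀ i, ∑ j, ε i * c k i * (ε j * c k j) * P a i j =
          c k i * c k i * P a i i +
          ∑ j, (if i = j then 0 else c k i * c k j * P a i j) * (ε i * ε j) := by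
        intro i
        have : c k i * c k i * P a i i = ∑ j, if i = j then c k i * c k i * P a i i else 0 := by
          simp
        rw [this, ← Finset.sum_add_distrib]
        refine Finset.sum_congr rfl fun j _ => ?_
        split_ifs with h
        · subst h
          linear_combination (c k i * c k i * P a i i) * hε1 i
        · ring
      rw [Finset.sum_congr rfl fun i _ => hsp i, Finset.sum_add_distrib]
      have hdiag : ∑ i, c k i * c k i * P a i i = σ a ^ 2 +
          ∑ i, s (i * k) * P a i i / n * (ζ i * ζ (-i)) := by
        have : σ a ^ 2 = (∑ i, P a i i) / n := by rw [htr]; field_simp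
        rw [this, Finset.sum_div, ← Finset.sum_add_distrib]
        refine Finset.sum_congr rfl fun i _ => ?_
        rw [hc2]; ring
      rw [hdiag]; ring
    rw [key]
    refine (abs_add_le _ _).trans ((add_le_add h1 h2).trans (le_of_eq ?_))
    ring

lemma numeric_aux (t : ℝ) (M d n : ℕ) (hM : 0 < M) (ht : 0 < t) (hd : 1 ≤ d) (hdn : d ≤ n)
    (h : 12 * (M : ℝ) * (d : ℝ) ^ 2 * Real.exp (-(t * Real.sqrt d / 64)) < 1) :
    (M : ℝ) * n * 3 < Real.exp (t * Real.sqrt n / 3 / 5) := by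
  have hM1 : (1 : ℝ) ≤ M := by exact_mod_cast hM
  have hd1 : (1 : ℝ) ≤ d := by exact_mod_cast hd
  have hdn' : (d : ℝ) ≤ n := by exact_mod_cast hdn
  set y0 := t * Real.sqrt d with hy0
  set y := t * Real.sqrt n with hy
  have hyy : y0 ≤ y := by rw [hy0, hy]; gcongr
  have hsd : 0 < Real.sqrt d := Real.sqrt_pos.2 (by linarith)
  have hy0p : 0 < y0 := by positivity
  have h1 : 12 * (M : ℝ) * (d : ℝ) ^ 2 < Real.exp (y0 / 64) := by
    rw [Real.exp_neg, ← div_eq_mul_inv, div_lt_one (Real.exp_pos _)] at h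
    exact h
  have hMd : 1 ≤ (M : ℝ) * (d : ℝ) ^ 2 := by
    have : (1 : ℝ) ≤ (d : ℝ) ^ 2 := one_le_pow₀ hd1
    nlinarith
  have h2 : Real.exp 2 < Real.exp (y0 / 64) := by
    have e1 := Real.exp_one_lt_d9
    have e2 : Real.exp 2 = Real.exp 1 * Real.exp 1 := by rw [← Real.exp_add]; norm_num
    have : Real.exp 2 < 12 := by rw [e2]; nlinarith [Real.exp_pos 1]
    nlinarith
  have h3 : 128 < y0 := by have := Real.exp_lt_exp.1 h2; linarith
  have h4 : y / y0 ≤ Real.exp ((y - y0) / 128) := by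
    have e1 : y / y0 = (y - y0) / y0 + 1 := by field_simp; ring
    rw [e1]
    refine (Real.add_one_le_exp _).trans (Real.exp_le_exp.2 ?_)
    have : 0 ≤ y - y0 := by linarith
    gcongr
  have h5 : (n : ℝ) = d * (y / y0) ^ 2 := by
    rw [hy, hy0, div_pow, mul_pow, mul_pow, Real.sq_sqrt (by linarith), Real.sq_sqrt (by linarith)]
    field_simp
  have h6 : (n : ℝ) ≤ d * (Real.exp (y / 64) / Real.exp (y0 / 64)) := by
    rw [h5, ← Real.exp_sub]
    gcongr
    calc (y / y0) ^ 2 ≤ Real.exp ((y - y0) / 128) ^ 2 := by gcongr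
      _ = _ := by rw [← Real.exp_nat_mul]; congr 1; push_cast; ring
  have hE := Real.exp_pos (y0 / 64)
  calc (M : ℝ) * n * 3 ≤ M * (d * (Real.exp (y / 64) / Real.exp (y0 / 64))) * 3 := by gcongr
    _ = (3 * M * d / Real.exp (y0 / 64)) * Real.exp (y / 64) := by ring
    _ < 1 * Real.exp (y / 64) := by
        gcongr
        rw [div_lt_one hE]
        nlinarith
    _ ≤ _ := by
        rw [one_mul]
        apply Real.exp_le_exp.2
        linarith

/-- Left translation of real functions. -/
def ltr {G : Type} [Group G] [Fintype G] (h : G) :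
    EuclideanSpace ℝ G ≃ₗᵢ[ℝ] EuclideanSpace ℝ G :=
  LinearIsometryEquiv.piLpCongrLeft 2 ℝ ℝ (Equiv.mulLeft h).symm

lemma ltr_apply {G : Type} [Group G] [Fintype G] (h : G) (f : EuclideanSpace ℝ G) (g : G) :
    ltr h f g = f (h * g) := by
  simp [ltr, LinearIsometryEquiv.piLpCongrLeft_apply, Equiv.piCongrLeft']

lemma kernel_indep {G : Type} [Fintype G] (W : Submodule ℝ (EuclideanSpace ℝ G))
    {ι : Type*} [Fintype ι] (b b' : OrthonormalBasis ι ℝ W) (g : G) :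
    ∑ k, (b k : EuclideanSpace ℝ G) g ^ 2 = ∑ k, (b' k : EuclideanSpace ℝ G) g ^ 2 := by
  classical
  have key : ∀ c : OrthonormalBasis ι ℝ W, ∑ k, (c k : EuclideanSpace ℝ G) g ^ 2 =
      ‖W.orthogonalProjectionOnto (EuclideanSpace.single g (1 : ℝ))‖ ^ 2 := by
    intro c
    rw [← c.sum_sq_norm_inner_right]
    refine Finset.sum_congr rfl fun k _ => ?_
    rw [Submodule.inner_orthogonalProjectionOnto_eq_of_mem_left]
    simp [EuclideanSpace.inner_single_right]
  rw [key b, key b']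

lemma kernel_const {G : Type} [Group G] [Fintype G] (W : Submodule ℝ (EuclideanSpace ℝ G))
    (hW : ∀ h : G, ∀ f ∈ W, ltr h f ∈ W)
    {ι : Type*} [Fintype ι] (b : OrthonormalBasis ι ℝ W) (g : G) :
    ∑ k, (b k : EuclideanSpace ℝ G) g ^ 2 = (Fintype.card ι : ℝ) / Fintype.card G := by
  classical
  have hcardι : Module.finrank ℝ W = Fintype.card ι := Module.finrank_eq_card_basis b.toBasis
  have hinv : ∀ h g : G, ∑ k, (b k : EuclideanSpace ℝ G) (h * g) ^ 2 =
      ∑ k, (b k : EuclideanSpace ℝ G) g ^ 2 := by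
    intro h g
    let v : ι → W := fun k => ⟨ltr h (b k), hW h _ (b k).2⟩
    have hv : Orthonormal ℝ v := by
      rw [orthonormal_iff_ite]
      intro i j
      have := orthonormal_iff_ite.1 b.orthonormal i j
      rw [Submodule.coe_inner] at this ⊢
      simp only [v]
      rw [LinearIsometryEquiv.inner_map_map, this]
    obtain ⟨b', hb'⟩ := Orthonormal.exists_orthonormalBasis_extension_of_card_eq (𝕜 := ℝ)
      (E := W) (ι := ι) hcardι (v := v) (s := Set.univ)
      (hv.comp _ Subtype.val_injective)
    rw [kernel_indep W b b' g]
    refine Finset.sum_congr rfl fun k _ => ?_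
    rw [hb' k (Set.mem_univ k)]
    simp [v, ltr_apply]
  have htot : ∑ g : G, ∑ k, (b k : EuclideanSpace ℝ G) g ^ 2 = Fintype.card ι := by
    rw [Finset.sum_comm]
    have : ∀ k, ∑ g : G, (b k : EuclideanSpace ℝ G) g ^ 2 = 1 := by
      intro k
      have h1 := b.orthonormal.1 k
      rw [Submodule.coe_norm] at h1
      have := EuclideanSpace.real_norm_sq_eq (b k : EuclideanSpace ℝ G)
      rw [h1] at this
      linarith
    simp [this]
  have hall : ∀ x : G, ∑ k, (b k : EuclideanSpace ℝ G) x ^ 2 =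
      ∑ k, (b k : EuclideanSpace ℝ G) g ^ 2 := by
    intro x
    have := hinv (x * g⁻¹) g
    rwa [inv_mul_cancel_right] at this
  rw [Finset.sum_congr rfl fun x _ => hall x] at htot
  simp only [Finset.sum_const, Finset.card_univ, nsmul_eq_mul] at htot
  have hN : (Fintype.card G : ℝ) ≠ 0 := by exact_mod_cast Fintype.card_ne_zero
  rw [← htot]; field_simp

lemma good_basis {G : Type} [Group G] [Fintype G] (W : Submodule ℝ (EuclideanSpace ℝ G))
    (hW : ∀ h : G, ∀ f ∈ W, ltr h f ∈ W) (n : ℕ) [NeZero n] (hn : Module.finrank ℝ W = n)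
    {M : ℕ} (A : Fin M → Finset G) (t : ℝ)
    (hr : (M : ℝ) * n * 3 < Real.exp (t * Real.sqrt n / 3 / 5)) :
    ∃ b : OrthonormalBasis (Fin n) ℝ W, ∀ (k : Fin n) (j : Fin M),
      |(∑ g ∈ A j, (b k : EuclideanSpace ℝ G) g ^ 2) - ((A j).card : ℝ) / (Fintype.card G : ℝ)| ≤
          t * Real.sqrt ((A j).card) / Real.sqrt (Fintype.card G) := by
  classical
  have hnp : (0 : ℝ) < n := by exact_mod_cast Nat.pos_of_ne_zero (NeZero.ne n)
  have eZ : Fin n ≃ ZMod n := Fintype.equivOfCardEq (by simp [ZMod.card])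
  let e : OrthonormalBasis (ZMod n) ℝ W :=
    ((stdOrthonormalBasis ℝ W).reindex (finCongr hn)).reindex eZ
  set P : Fin M → ZMod n → ZMod n → ℝ := fun a i j =>
    ∑ g ∈ A a, (e i : EuclideanSpace ℝ G) g * (e j : EuclideanSpace ℝ G) g with hP
  set σ : Fin M → ℝ := fun a => Real.sqrt (((A a).card : ℝ) / Fintype.card G) with hσ
  have hσ2 : ∀ a, σ a ^ 2 = ((A a).card : ℝ) / Fintype.card G := fun a =>
    Real.sq_sqrt (by positivity)
  have hker := fun g => kernel_const W hW e g
  have htr : ∀ a, ∑ j, P a j j = n * σ a ^ 2 := by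
    intro a
    simp only [hP]
    rw [Finset.sum_comm]
    simp only [← sq]
    rw [Finset.sum_congr rfl fun g _ => hker g, hσ2]
    simp [ZMod.card]
    ring
  have hHS : ∀ a, ∑ i, ∑ j, P a i j ^ 2 ≤ n * σ a ^ 2 := by
    intro a
    rw [← htr]
    refine Finset.sum_le_sum fun i _ => ?_
    have horth : Orthonormal ℝ (fun j => (e j : EuclideanSpace ℝ G)) :=
      e.orthonormal.comp_linearIsometry W.subtypeₗᵢ
    let x : EuclideanSpace ℝ G :=
      WithLp.toLp 2 (fun g => if g ∈ A a then (e i : EuclideanSpace ℝ G) g else 0)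
    have hb := horth.sum_inner_products_le x (s := Finset.univ)
    have h1 : ∀ j, inner ℝ (e j : EuclideanSpace ℝ G) x = P a i j := by
      intro j
      simp [PiLp.inner_apply, x, hP, Finset.sum_ite_mem]
    have h2 : ‖x‖ ^ 2 = P a i i := by
      rw [EuclideanSpace.real_norm_sq_eq]
      simp [x, hP, sq, Finset.sum_ite_mem]
    rw [h2] at hb
    simpa [h1] using hb
  obtain ⟨R, hR1, hR2⟩ := exists_orth P σ (fun a => Real.sqrt_nonneg _) htr hHS
    (t * Real.sqrt n / 3) (by simpa using hr)
  let v : ZMod n → W := fun k => ∑ j, R k j • e j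
  have hv : Orthonormal ℝ v := by
    rw [orthonormal_iff_ite]
    intro k l
    rw [← hR1 k l]
    simp only [v]
    rw [e.orthonormal.inner_sum]
    simp
  obtain ⟨b', hb'⟩ := Orthonormal.exists_orthonormalBasis_extension_of_card_eq (𝕜 := ℝ)
      (E := W) (ι := ZMod n) (by rw [hn, ZMod.card]) (v := v) (s := Set.univ)
      (hv.comp _ Subtype.val_injective)
  refine ⟨b'.reindex eZ.symm, fun k j => ?_⟩
  have h := hR2 j (eZ k)
  have e1 : 3 * (t * Real.sqrt n / 3) / Real.sqrt n * σ j =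
      t * Real.sqrt ((A j).card) / Real.sqrt (Fintype.card G) := by
    simp only [hσ]
    rw [Real.sqrt_div (by positivity)]
    have := (Real.sqrt_pos.2 hnp).ne'
    field_simp
  rw [e1, hσ2] at h
  convert h using 3
  have hbk : ((b'.reindex eZ.symm) k) = v (eZ k) := by
    rw [OrthonormalBasis.reindex_apply, Equiv.symm_symm]
    exact hb' _ (Set.mem_univ _)
  rw [hbk]
  have hvg : ∀ g, ((v (eZ k) : W) : EuclideanSpace ℝ G) g =
      ∑ i, R (eZ k) i * (e i : EuclideanSpace ℝ G) g := by
    intro g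
    simp [v]
  simp only [hvg, hP, Finset.mul_sum]
  have hx : ∀ g : G, (∑ i, R (eZ k) i * (e i : EuclideanSpace ℝ G) g) ^ 2 =
      ∑ i, ∑ l, R (eZ k) i * R (eZ k) l *
        ((e i : EuclideanSpace ℝ G) g * (e l : EuclideanSpace ℝ G) g) := by
    intro g
    rw [sq, Finset.sum_mul_sum]
    refine Finset.sum_congr rfl fun i _ => Finset.sum_congr rfl fun l _ => ?_
    ring
  rw [Finset.sum_congr rfl fun g _ => hx g, Finset.sum_comm]
  refine Finset.sum_congr rfl fun i _ => ?_
  rw [Finset.sum_comm]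

/-- Left translation on complex functions, as a representation. -/
def lrep (G : Type) [Group G] : Representation ℂ G (G → ℂ) where
  toFun h :=
    { toFun := fun f g => f (h⁻¹ * g)
      map_add' := fun _ _ => rfl
      map_smul' := fun _ _ => rfl }
  map_one' := by ext; simp
  map_mul' := by intro a b; ext; simp [mul_assoc]

lemma lrep_apply {G : Type} [Group G] (h : G) (f : G → ℂ) (g : G) :
    lrep G h f g = f (h⁻¹ * g) := rfl

/-- The restriction of left translation to an invariant subspace. -/
def subrep {G : Type} [Group G] (U : Submodule ℂ (G → ℂ))
    (hU : ∀ h : G, ∀ f ∈ U, lrep G h f ∈ U) : Representation ℂ G U where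
  toFun h := (lrep G h).restrict (hU h)
  map_one' := by ext; simp
  map_mul' := by intro a b; ext; simp

/-- Complexification of a space of real functions. -/
def cplx {G : Type} [Fintype G] (W : Submodule ℝ (EuclideanSpace ℝ G)) :
    Submodule ℂ (G → ℂ) where
  carrier := {f | (WithLp.toLp 2 (fun g => (f g).re) : EuclideanSpace ℝ G) ∈ W ∧
    (WithLp.toLp 2 (fun g => (f g).im) : EuclideanSpace ℝ G) ∈ W}
  add_mem' := by
    rintro a b ⟨h1, h2⟩ ⟨h3, h4⟩
    exact ⟨W.add_mem h1 h3, W.add_mem h2 h4⟩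
  zero_mem' := ⟨W.zero_mem, W.zero_mem⟩
  smul_mem' := by
    rintro z f ⟨h1, h2⟩
    constructor
    · convert W.sub_mem (W.smul_mem z.re h1) (W.smul_mem z.im h2) using 1
      ext g; simp
    · convert W.add_mem (W.smul_mem z.re h2) (W.smul_mem z.im h1) using 1
      ext g; simp

lemma exists_irred {G : Type} [Group G] [Fintype G] (W : Submodule ℝ (EuclideanSpace ℝ G))
    (hW : ∀ h : G, ∀ f ∈ W, ltr h f ∈ W) (hne : W ≠ ⊥)
    (hsum0 : ∀ f ∈ W, ∑ g, f g = 0) :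
    ∃ (U : Submodule ℂ (G → ℂ)) (hU : ∀ h : G, ∀ f ∈ U, lrep G h f ∈ U),
      RepIrreducible (subrep U hU) ∧ RepNontrivial (subrep U hU) ∧
      1 ≤ Module.finrank ℂ U ∧ Module.finrank ℂ U ≤ Module.finrank ℝ W := by
  classical
  have hCinv : ∀ h : G, ∀ f ∈ cplx W, lrep G h f ∈ cplx W := by
    rintro h f ⟨h1, h2⟩
    constructor
    · convert hW h⁻¹ _ h1 using 1
      ext g; simp [ltr_apply, lrep_apply]
    · convert hW h⁻¹ _ h2 using 1
      ext g; simp [ltr_apply, lrep_apply]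
  have hCne : cplx W ≠ ⊥ := by
    obtain ⟨f, hf, hf0⟩ := W.ne_bot_iff.1 hne
    rw [Submodule.ne_bot_iff]
    refine ⟨fun g => (f g : ℂ), ⟨by simpa using hf, ?_⟩, ?_⟩
    · simp only [Complex.ofReal_im]
      exact W.zero_mem
    · intro h
      apply hf0
      ext g
      have := congrFun h g
      simpa using this
  let 𝒮 : Set (Submodule ℂ (G → ℂ)) :=
    {U | U ≠ ⊥ ∧ U ≤ cplx W ∧ ∀ h : G, ∀ f ∈ U, lrep G h f ∈ U}
  obtain ⟨U, ⟨hU0, hUC, hU⟩, hmin⟩ :=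
    (wellFounded_lt : WellFounded ((· < ·) : Submodule ℂ (G → ℂ) → _ → Prop)).has_min 𝒮
      ⟨cplx W, hCne, le_rfl, hCinv⟩
  refine ⟨U, hU, ?_, ?_, ?_, ?_⟩
  · intro V hV
    by_cases hV0 : V = ⊥
    · exact Or.inl hV0
    right
    have hmem : V.map U.subtype ∈ 𝒮 := by
      refine ⟨?_, ?_, ?_⟩
      · intro h
        exact hV0 (Submodule.map_injective_of_injective U.subtype_injective
          (by rw [h, Submodule.map_bot]))
      · exact (Submodule.map_subtype_le U V).trans hUC
      · rintro h _ ⟨x, hx, rfl⟩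
        exact ⟨_, hV h x hx, rfl⟩
    have hnot := hmin _ hmem
    have heq : V.map U.subtype = U := by
      by_contra hne'
      exact hnot (lt_of_le_of_ne (Submodule.map_subtype_le U V) hne')
    rw [eq_top_iff]
    rintro ⟨x, hx⟩ -
    rw [← heq] at hx
    obtain ⟨y, hy, hyx⟩ := hx
    have : y = ⟨x, by rw [← hyx]; exact y.2⟩ := Subtype.ext hyx
    exact this ▸ hy
  · by_contra hcon
    simp only [RepNontrivial, not_exists, not_not] at hcon
    apply hU0
    rw [Submodule.eq_bot_iff]
    intro f hf
    have hconst : ∀ g, f g = f 1 := by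
      intro g
      have h1 := congrArg (fun T => ((T ⟨f, hf⟩ : U) : G → ℂ) 1) (hcon g⁻¹)
      have h2 : f (g⁻¹⁻¹ * 1) = f 1 := h1
      simpa using h2
    obtain ⟨h1, h2⟩ := hUC hf
    have s1 := hsum0 _ h1
    have s2 := hsum0 _ h2
    simp [hconst] at s1 s2
    funext g
    rw [hconst]
    exact Complex.ext s1 s2
  · rw [Nat.one_le_iff_ne_zero]
    intro h
    exact hU0 (Submodule.finrank_eq_zero.1 h)
  · let b := stdOrthonormalBasis ℝ W
    have hle : U ≤ Submodule.span ℂ (Set.range (fun k (g : G) =>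
        (((b k : EuclideanSpace ℝ G) g : ℝ) : ℂ))) := by
      refine hUC.trans ?_
      have hreal : ∀ w ∈ W, (fun g => ((w g : ℝ) : ℂ)) ∈ Submodule.span ℂ
          (Set.range (fun k (g : G) => (((b k : EuclideanSpace ℝ G) g : ℝ) : ℂ))) := by
        intro w hw
        have hs := b.sum_repr ⟨w, hw⟩
        have : (fun g => ((w g : ℝ) : ℂ)) = ∑ k, ((b.repr ⟨w, hw⟩ k : ℝ) : ℂ) •
            (fun g : G => (((b k : EuclideanSpace ℝ G) g : ℝ) : ℂ)) := by
          funext g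
          have h1 := congrArg (fun x : W => (x : EuclideanSpace ℝ G) g) hs
          simp at h1
          simp only [Finset.sum_apply, Pi.smul_apply, smul_eq_mul]
          rw [← h1]
          push_cast
          rfl
        rw [this]
        exact Submodule.sum_mem _ fun k _ => Submodule.smul_mem _ _
          (Submodule.subset_span ⟨k, rfl⟩)
      rintro f ⟨h1, h2⟩
      have : f = (fun g => (((f g).re : ℝ) : ℂ)) + Complex.I • (fun g => (((f g).im : ℝ) : ℂ)) := by
        funext g
        simp only [Pi.add_apply, Pi.smul_apply, smul_eq_mul]
        rw [mul_comm, Complex.re_add_im]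
      rw [this]
      exact Submodule.add_mem _ (hreal _ h1) (Submodule.smul_mem _ _ (hreal _ h2))
    refine (Submodule.finrank_mono hle).trans ?_
    refine (finrank_range_le_card _).trans ?_
    simp

/-- The (real) adjacency operator plus the all-ones operator. -/
def adjT {G : Type} [Group G] [Fintype G] (S : Finset G) :
    EuclideanSpace ℝ G →ₗ[ℝ] EuclideanSpace ℝ G where
  toFun f := WithLp.toLp 2 (fun g => ∑ s ∈ S, f (g * s) + ∑ x, f x)
  map_add' f h := by
    ext g
    simp [Finset.sum_add_distrib]
    ring
  map_smul' c f := by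
    ext g
    simp [Finset.mul_sum, mul_add]

lemma adjT_apply {G : Type} [Group G] [Fintype G] (S : Finset G) (f : EuclideanSpace ℝ G)
    (g : G) : adjT S f g = ∑ s ∈ S, f (g * s) + ∑ x, f x := rfl

lemma adjT_symm {G : Type} [Group G] [Fintype G] (S : Finset G) (hS : ∀ s ∈ S, s⁻¹ ∈ S) :
    (adjT S).IsSymmetric := by
  intro f h
  simp only [PiLp.inner_apply, adjT_apply, RCLike.inner_apply, conj_trivial, mul_add, add_mul,
    Finset.sum_add_distrib, Finset.mul_sum, Finset.sum_mul]
  congr 1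
  · rw [Finset.sum_comm, Finset.sum_comm (s := Finset.univ) (t := S)]
    refine Finset.sum_nbij' (fun s => s⁻¹) (fun s => s⁻¹) (fun s hs => hS s hs)
      (fun s hs => hS s hs) (fun s _ => inv_inv s) (fun s _ => inv_inv s) ?_
    intro s _
    rw [← Equiv.sum_comp (Equiv.mulRight s⁻¹)]
    refine Finset.sum_congr rfl fun g _ => ?_
    simp
  · rw [Finset.sum_comm]

lemma adj_small {G : Type} [Group G] [Fintype G] (S : Finset G) (f : G → ℝ) (μ : ℝ)
    (hμ : (S.card : ℝ) < μ) (hf : ∀ g, ∑ s ∈ S, f (g * s) = μ * f g) : ∀ g, f g = 0 := by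
  obtain ⟨m, hm⟩ := Finite.exists_max (fun g => |f g|)
  have h1 : μ * |f m| ≤ S.card * |f m| := by
    calc μ * |f m| = |μ * f m| := by
          rw [abs_mul, abs_of_pos (lt_of_le_of_lt (Nat.cast_nonneg _) hμ)]
      _ = |∑ s ∈ S, f (m * s)| := by rw [hf]
      _ ≤ ∑ s ∈ S, |f (m * s)| := Finset.abs_sum_le_sum_abs _ _
      _ ≤ ∑ s ∈ S, |f m| := Finset.sum_le_sum fun s _ => hm _
      _ = _ := by simp
  have h2 : |f m| ≤ 0 := by
    by_contra h
    push Not at h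
    nlinarith
  intro g
  exact abs_eq_zero.1 (le_antisymm ((hm g).trans h2) (abs_nonneg _))

lemma adjT_eig {G : Type} [Group G] [Fintype G] (S : Finset G) (μ : ℝ)
    (f : EuclideanSpace ℝ G) (hf : adjT S f = μ • f) :
    (μ = S.card + Fintype.card G ∧ ∀ g, f g = f 1) ∨
    (μ ≠ S.card + Fintype.card G ∧ ∑ g, f g = 0 ∧ ∀ g, ∑ s ∈ S, f (g * s) = μ * f g) := by
  have h1 : ∀ g, ∑ s ∈ S, f (g * s) + ∑ x, f x = μ * f g := by
    intro g
    have := congrArg (fun F : EuclideanSpace ℝ G => F g) hf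
    simpa [adjT_apply] using this
  have hN : (0 : ℝ) < Fintype.card G := by exact_mod_cast Fintype.card_pos
  by_cases hμ : μ = S.card + Fintype.card G
  · left
    refine ⟨hμ, ?_⟩
    set m : ℝ := (∑ x, f x) / Fintype.card G with hm
    have hm' : ∑ x, f x = m * Fintype.card G := by rw [hm]; field_simp
    have := adj_small S (fun g => f g - m) μ (by rw [hμ]; linarith) (by
      intro g
      have := h1 g
      rw [hm'] at this
      rw [Finset.sum_sub_distrib]
      simp only [Finset.sum_const, nsmul_eq_mul]
      rw [hμ] at this ⊢
      linarith)
    intro g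
    linarith [this g, this 1]
  · right
    have h2 : ∑ g, f g = 0 := by
      have h3 : ∑ g, (∑ s ∈ S, f (g * s) + ∑ x, f x) = ∑ g, μ * f g :=
        Finset.sum_congr rfl fun g _ => h1 g
      rw [Finset.sum_add_distrib, Finset.sum_comm, ← Finset.mul_sum] at h3
      have h4 : ∀ s : G, ∑ g, f (g * s) = ∑ g, f g := fun s =>
        Equiv.sum_comp (Equiv.mulRight s) (fun g => f g)
      simp only [h4, Finset.sum_const, nsmul_eq_mul, Finset.card_univ] at h3
      have h5 : (S.card + Fintype.card G - μ) * ∑ g, f g = 0 := by linarith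
      rcases mul_eq_zero.1 h5 with h | h
      · exact absurd (by linarith) hμ
      · exact h
    refine ⟨hμ, h2, fun g => ?_⟩
    have := h1 g
    rw [h2] at this
    linarith

lemma adjT_ltr {G : Type} [Group G] [Fintype G] (S : Finset G) (h : G)
    (f : EuclideanSpace ℝ G) : adjT S (ltr h f) = ltr h (adjT S f) := by
  ext g
  simp only [adjT_apply, ltr_apply, mul_assoc]
  congr 1
  exact Equiv.sum_comp (Equiv.mulLeft h) (fun x => f x)

end

/-- **QUE for Cayley graphs of quasirandom groups** (Theorem 1, form for subsets).
The family `(V i, π i)` is a set of representatives of the isomorphism classes of non-trivial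
irreducible complex representations of the finite group `G`. -/
theorem stmt_1 {G : Type} [Group G] [Fintype G]
    (S : Finset G) (hS : ∀ s ∈ S, s⁻¹ ∈ S)
    (t : ℝ) (ht : 0 < t) (M : ℕ) (hM : 0 < M)
    {ι : Type} [Fintype ι] (V : ι → Type)
    [∀ i, AddCommGroup (V i)] [∀ i, Module ℂ (V i)] [∀ i, FiniteDimensional ℂ (V i)]
    (π : ∀ i, Representation ℂ G (V i))
    (hirr : ∀ i, RepIrreducible (π i))
    (hnt : ∀ i, RepNontrivial (π i))
    (hpairwise : ∀ i j, i ≠ j → ¬ RepIso (π i) (π j))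
    (hcomplete : ∀ (W : Type) [AddCommGroup W] [Module ℂ W],
      ∀ _ : FiniteDimensional ℂ W, ∀ ρ : Representation ℂ G W,
        RepIrreducible ρ → RepNontrivial ρ → ∃ i, RepIso ρ (π i))
    (hsum : 2 * (M : ℝ) * ∑ i, (Module.finrank ℂ (V i) : ℝ) ^ 2 *
        (6 * Real.exp (-(t * Real.sqrt (Module.finrank ℂ (V i)) / 64)) +
          2 * Real.exp (-((Module.finrank ℂ (V i) : ℝ) / 12))) < 1)
    (A : Fin M → Finset G) :
    ∃ B : OrthonormalBasis G ℂ (EuclideanSpace ℂ G),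
      (∀ φ : G, (∀ g : G, (B φ g).im = 0) ∧
        ∃ μ : ℂ, ∀ g : G, ∑ s ∈ S, B φ (g * s) = μ * B φ g) ∧
      (∀ (φ : G) (j : Fin M),
        |(∑ g ∈ A j, ‖B φ g‖ ^ 2) - ((A j).card : ℝ) / (Fintype.card G : ℝ)| ≤
          t * Real.sqrt ((A j).card) / Real.sqrt (Fintype.card G)) := by
  classical
  let T := adjT S
  have hT : T.IsSymmetric := adjT_symm S hS
  let E : Module.End.Eigenvalues T → Submodule ℝ (EuclideanSpace ℝ G) :=
    fun μ => Module.End.eigenspace T μ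
  have hEinv : ∀ μ, ∀ h : G, ∀ f ∈ E μ, ltr h f ∈ E μ := by
    intro μ h f hf
    rw [Module.End.mem_eigenspace_iff] at hf ⊢
    rw [adjT_ltr, hf, map_smul]
  have hgood : ∀ μ : Module.End.Eigenvalues T,
      ∃ b : OrthonormalBasis (Fin (Module.finrank ℝ (E μ))) ℝ (E μ), ∀ k (j : Fin M),
      |(∑ g ∈ A j, (b k : EuclideanSpace ℝ G) g ^ 2) - ((A j).card : ℝ) / (Fintype.card G : ℝ)| ≤
          t * Real.sqrt ((A j).card) / Real.sqrt (Fintype.card G) := by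
    intro μ
    by_cases hμ : (μ : ℝ) = S.card + Fintype.card G
    · refine ⟨stdOrthonormalBasis ℝ (E μ), fun k j => ?_⟩
      set f : EuclideanSpace ℝ G := (stdOrthonormalBasis ℝ (E μ) k : EuclideanSpace ℝ G) with hf
      have hfm : f ∈ E μ := (stdOrthonormalBasis ℝ (E μ) k).2
      have hfe := Module.End.mem_eigenspace_iff.1 hfm
      have hc : ∀ g, f g = f 1 := by
        rcases adjT_eig S μ f hfe with h | h
        · exact h.2
        · exact absurd hμ h.1
      have hnorm : ‖f‖ = 1 := (stdOrthonormalBasis ℝ (E μ)).orthonormal.1 k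
      have hsq := EuclideanSpace.real_norm_sq_eq f
      have hN : (0 : ℝ) < Fintype.card G := by exact_mod_cast Fintype.card_pos
      rw [hnorm] at hsq
      simp only [hc, Finset.sum_const, nsmul_eq_mul, Finset.card_univ] at hsq ⊢
      have h1 : f 1 ^ 2 = 1 / Fintype.card G := by
        field_simp
        linarith
      rw [h1]
      have : ((A j).card : ℝ) * (1 / (Fintype.card G : ℝ)) -
          ((A j).card : ℝ) / (Fintype.card G : ℝ) = 0 := by ring
      rw [this, abs_zero]
      positivity
    · have hne : E μ ≠ ⊥ := μ.2
      obtain ⟨U, hU, hUi, hUn, hU1, hU2⟩ := exists_irred (E μ) (hEinv μ) hne (by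
        intro f hf
        rcases adjT_eig S μ f (Module.End.mem_eigenspace_iff.1 hf) with h | h
        · exact absurd h.1 hμ
        · exact h.2.1)
      obtain ⟨i, e, -⟩ := hcomplete U inferInstance (subrep U hU) hUi hUn
      have hd : Module.finrank ℂ U = Module.finrank ℂ (V i) := e.finrank_eq
      rw [hd] at hU1 hU2
      have hi : 12 * (M : ℝ) * (Module.finrank ℂ (V i) : ℝ) ^ 2 *
          Real.exp (-(t * Real.sqrt (Module.finrank ℂ (V i)) / 64)) < 1 := by
        refine lt_of_le_of_lt ?_ hsum
        have h1 := Finset.single_le_sum (f := fun i => (Module.finrank ℂ (V i) : ℝ) ^ 2 *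
          (6 * Real.exp (-(t * Real.sqrt (Module.finrank ℂ (V i)) / 64)) +
          2 * Real.exp (-((Module.finrank ℂ (V i) : ℝ) / 12))))
          (fun i _ => by positivity) (Finset.mem_univ i)
        refine le_trans ?_ (mul_le_mul_of_nonneg_left h1 (by positivity))
        have h2 : 0 ≤ 2 * (M : ℝ) * ((Module.finrank ℂ (V i) : ℝ) ^ 2 *
          (2 * Real.exp (-((Module.finrank ℂ (V i) : ℝ) / 12)))) := by positivity
        linarith
      have hnum := numeric_aux t M _ _ hM ht hU1 hU2 hi
      have : NeZero (Module.finrank ℝ (E μ)) := ⟨by omega⟩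
      exact good_basis (E μ) (hEinv μ) _ rfl A t hnum
  choose b hb using hgood
  let Bs := hT.direct_sum_isInternal.collectedOrthonormalBasis hT.orthogonalFamily_eigenspaces' b
  have hBs : ∀ a, Bs a = (b a.1 a.2 : EuclideanSpace ℝ G) := by
    intro a
    simp [Bs, DirectSum.IsInternal.collectedOrthonormalBasis]
  have hcardG : Fintype.card (Σ μ, Fin (Module.finrank ℝ (E μ))) = Fintype.card G := by
    rw [← Module.finrank_eq_card_basis Bs.toBasis, finrank_euclideanSpace]
  let eq : (Σ μ, Fin (Module.finrank ℝ (E μ))) ≃ G := Fintype.equivOfCardEq hcardG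
  let w : G → EuclideanSpace ℝ G := fun φ => Bs (eq.symm φ)
  have hw : Orthonormal ℝ w := Bs.orthonormal.comp _ eq.symm.injective
  let v : G → EuclideanSpace ℂ G := fun φ => WithLp.toLp 2 (fun g => ((w φ g : ℝ) : ℂ))
  have hv : Orthonormal ℂ v := by
    rw [orthonormal_iff_ite]
    intro i j
    have h := orthonormal_iff_ite.1 hw i j
    simp only [PiLp.inner_apply, RCLike.inner_apply, conj_trivial] at h
    simp only [PiLp.inner_apply, RCLike.inner_apply, v, Complex.conj_ofReal]
    have h' := congrArg (fun x : ℝ => (x : ℂ)) h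
    push_cast at h'
    rw [h']
    split_ifs <;> simp
  obtain ⟨B, hB⟩ := Orthonormal.exists_orthonormalBasis_extension_of_card_eq (𝕜 := ℂ)
    (E := EuclideanSpace ℂ G) (ι := G) (finrank_euclideanSpace) (v := v) (s := Set.univ)
    (hv.comp _ Subtype.val_injective)
  have hBg : ∀ φ g, B φ g = ((w φ g : ℝ) : ℂ) := by
    intro φ g
    rw [hB φ (Set.mem_univ φ)]
  refine ⟨B, fun φ => ⟨fun g => ?_, ?_⟩, fun φ j => ?_⟩
  · rw [hBg, Complex.ofReal_im]
  · have hmem : w φ ∈ E (eq.symm φ).1 := by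
      simp only [w, hBs]
      exact (b _ _).2
    have hex : ∃ μ : ℝ, ∀ g, ∑ s ∈ S, w φ (g * s) = μ * w φ g := by
      rcases adjT_eig S _ _ (Module.End.mem_eigenspace_iff.1 hmem) with h | h
      · refine ⟨S.card, fun g => ?_⟩
        rw [h.2 g, Finset.sum_congr rfl fun s _ => h.2 (g * s)]
        simp
      · exact ⟨_, h.2.2⟩
    obtain ⟨μ, hμ⟩ := hex
    refine ⟨μ, fun g => ?_⟩
    simp only [hBg]
    rw [← Complex.ofReal_sum, hμ, Complex.ofReal_mul]
  · have h := hb (eq.symm φ).1 (eq.symm φ).2 j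
    rw [← hBs] at h
    have e1 : ∑ g ∈ A j, ‖B φ g‖ ^ 2 = ∑ g ∈ A j, (w φ g) ^ 2 := by
      refine Finset.sum_congr rfl fun g _ => ?_
      rw [hBg, Complex.norm_real, Real.norm_eq_abs, sq_abs]
    rw [e1]
    exact h
end

section
/- Let ε > 0 and let G be a finite group with 𝔇(G) ≥ (log|G|)², where 𝔇(G) is the minimum of dim V over all non-trivial irreducible complex representations (π, V) of G. Let S ⊆ G be a symmetric subset. Then for any positive integer M with M ≤ min((1/24)·|G|^ε, (1/8)·|G|⁻¹·exp(𝔇(G)/12)) and any functions f_1, …, f_M : G → ℝ, there exists an orthonormal basis B of ℓ²(G) consisting of real-valued eigenfunctions of the adjacency operator of Cay(G, S) such that for every φ ∈ B and every i = 1, …, M one has |Σ_{g∈G} f_i(g)|φ(g)|² − (1/|G|)·Σ_{g∈G} f_i(g)| ≤ 64·(ε+1)·log(|G|)/√(𝔇(G)) · ‖f_i‖_{ℓ²}/√|G|. -/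
open scoped BigOperators

/-- A bundled non-trivial irreducible finite-dimensional complex representation of `G`:
a finite-dimensional complex vector space `W` together with an action `ρ` of `G` whose only
invariant subspaces are `⊥` and `⊤`, and such that some group element acts non-trivially. -/
structure NontrivIrrep (G : Type) [Group G] : Type 1 where
  W : Type
  [acg : AddCommGroup W]
  [mod : Module ℂ W]
  [fd : FiniteDimensional ℂ W]
  ρ : Representation ℂ G W
  irr : ∀ U : Submodule ℂ W, (∀ g : G, ∀ x ∈ U, ρ g x ∈ U) → U = ⊥ ∨ U = ⊤
  nontriv : ∃ g : G, ρ g ≠ 1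

attribute [instance] NontrivIrrep.acg NontrivIrrep.mod NontrivIrrep.fd

namespace QUE
open MeasureTheory

abbrev OG (d : ℕ) := Matrix.orthogonalGroup (Fin d) ℝ

/-- quadratic form -/
noncomputable def qf {d : ℕ} (A : Matrix (Fin d) (Fin d) ℝ) (x : Fin d → ℝ) : ℝ :=
  ∑ j, ∑ k, A j k * x j * x k

/-- squared norm -/
noncomputable def nsq {d : ℕ} (x : Fin d → ℝ) : ℝ := ∑ j, x j ^ 2

lemma qf_eq {d : ℕ} (A : Matrix (Fin d) (Fin d) ℝ) (x : Fin d → ℝ) :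
    qf A x = x ⬝ᵥ (A.mulVec x) := by
  simp only [qf, dotProduct, Matrix.mulVec, Finset.mul_sum]
  refine Finset.sum_congr rfl fun j _ => Finset.sum_congr rfl fun k _ => by ring

lemma nsq_eq {d : ℕ} (x : Fin d → ℝ) : nsq x = x ⬝ᵥ x := by
  simp only [nsq, dotProduct]
  refine Finset.sum_congr rfl fun j _ => by ring

lemma nsq_orth {d : ℕ} (U : OG d) (x : Fin d → ℝ) : nsq (U.1.mulVec x) = nsq x := by
  have h : U.1.transpose * U.1 = 1 := by
    exact (Matrix.mem_orthogonalGroup_iff' _ _).1 U.2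
  rw [nsq_eq, nsq_eq, Matrix.dotProduct_mulVec, ← Matrix.mulVec_transpose, Matrix.mulVec_mulVec, h,
    Matrix.one_mulVec]

lemma qf_smul {d : ℕ} (A : Matrix (Fin d) (Fin d) ℝ) (r : ℝ) (x : Fin d → ℝ) :
    qf A (r • x) = r ^ 2 * qf A x := by
  simp only [qf, Finset.mul_sum, Pi.smul_apply, smul_eq_mul]
  refine Finset.sum_congr rfl fun j _ => Finset.sum_congr rfl fun k _ => by ring

lemma qf_abs_le {d : ℕ} (A : Matrix (Fin d) (Fin d) ℝ) (hA : ∑ j, ∑ k, A j k ^ 2 ≤ 1)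
    (x : Fin d → ℝ) : |qf A x| ≤ nsq x := by
  have h0 : 0 ≤ nsq x := Finset.sum_nonneg fun j _ => sq_nonneg _
  apply abs_le_of_sq_le_sq _ h0
  have h1 : qf A x = ∑ p : Fin d × Fin d, A p.1 p.2 * (x p.1 * x p.2) := by
    rw [Fintype.sum_prod_type]
    simp only [qf, mul_assoc]
  rw [h1]
  refine (Finset.sum_mul_sq_le_sq_mul_sq _ _ _).trans ?_
  have h2 : ∑ p : Fin d × Fin d, (x p.1 * x p.2) ^ 2 = nsq x ^ 2 := by
    rw [Fintype.sum_prod_type, nsq, sq (∑ j, x j ^ 2), Finset.sum_mul_sum]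
    refine Finset.sum_congr rfl fun j _ => Finset.sum_congr rfl fun k _ => by ring
  rw [h2, Fintype.sum_prod_type]
  nlinarith [sq_nonneg (nsq x)]

lemma continuous_qf {d : ℕ} (A : Matrix (Fin d) (Fin d) ℝ) : Continuous (qf A) := by
  unfold qf; fun_prop
lemma continuous_nsq {d : ℕ} : Continuous (nsq (d := d)) := by
  unfold nsq; fun_prop

instance (d : ℕ) : SecondCountableTopology (OG d) := by
  have : SecondCountableTopology (Matrix (Fin d) (Fin d) ℝ) :=
    inferInstanceAs (SecondCountableTopology (Fin d → Fin d → ℝ))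
  exact TopologicalSpace.Subtype.secondCountableTopology _

instance (d : ℕ) : CompactSpace (OG d) := by
  apply isCompact_iff_compactSpace.1
  have hK : IsCompact (Set.pi Set.univ (fun _ : Fin d => Set.pi Set.univ
      (fun _ : Fin d => Set.Icc (-1 : ℝ) 1))) :=
    isCompact_univ_pi fun _ => isCompact_univ_pi fun _ => isCompact_Icc
  refine IsCompact.of_isClosed_subset (X := Matrix (Fin d) (Fin d) ℝ) hK ?_ ?_
  · have : ((OG d : Submonoid _) : Set (Matrix (Fin d) (Fin d) ℝ)) = {A | A * A.transpose = 1} := by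
      ext A
      exact Matrix.mem_orthogonalGroup_iff _ _
    rw [this]
    exact isClosed_eq (by fun_prop) continuous_const
  · intro A hA i _ j _
    have := entry_norm_bound_of_unitary hA i j
    rw [Real.norm_eq_abs, abs_le] at this
    exact this

instance (d : ℕ) : MeasurableSpace (OG d) := borel _
instance (d : ℕ) : BorelSpace (OG d) := ⟨rfl⟩

noncomputable def haarO (d : ℕ) : Measure (OG d) := Measure.haarMeasure ⊤

instance (d : ℕ) : IsProbabilityMeasure (haarO d) := by
  constructor
  have := Measure.haarMeasure_self (K₀ := (⊤ : TopologicalSpace.PositiveCompacts (OG d)))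
  simpa [haarO] using this

instance (d : ℕ) : (haarO d).IsMulLeftInvariant := by
  unfold haarO; infer_instance

/-- rotation invariance of Lebesgue -/
lemma lintegral_rot {d : ℕ} (U : OG d) (F : (Fin d → ℝ) → ENNReal) (hF : Measurable F) :
    ∫⁻ x, F (U.1.mulVec x) = ∫⁻ x, F x := by
  have hdet : |U.1.det| = 1 := by
    have h := congrArg Matrix.det ((Matrix.mem_orthogonalGroup_iff _ _).1 U.2)
    rw [Matrix.det_mul, Matrix.det_transpose, Matrix.det_one] at h

    rcases mul_self_eq_one_iff.1 h with h | h <;> rw [h] <;> simp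
  have h0 : U.1.det ≠ 0 := by
    intro h; rw [h] at hdet; simp at hdet
  have h := Real.map_matrix_volume_pi_eq_smul_volume_pi h0
  rw [abs_inv, hdet] at h
  simp at h
  conv_rhs => rw [← h]
  rw [lintegral_map hF]
  · rfl
  · exact (LinearMap.continuous_of_finiteDimensional _).measurable

/-- Householder -/
lemma exists_rot {d : ℕ} (u v : Fin d → ℝ) (h : nsq u = nsq v) :
    ∃ W : OG d, W.1.mulVec u = v := by
  by_cases huv : u = v
  · exact ⟨1, by simp [huv]⟩
  set w := u - v with hw
  have hw0 : w ⬝ᵥ w ≠ 0 := by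
    rw [Ne, dotProduct_self_eq_zero]
    exact sub_ne_zero.2 huv
  let W : Matrix (Fin d) (Fin d) ℝ := 1 - (2 / (w ⬝ᵥ w)) • Matrix.vecMulVec w w
  have hT : W.transpose = W := by
    ext i j
    simp [W, Matrix.vecMulVec, Matrix.one_apply, eq_comm, mul_comm]
  have hWv : ∀ x, W.mulVec x = x - (2 * (w ⬝ᵥ x) / (w ⬝ᵥ w)) • w := by
    intro x
    simp only [W, Matrix.sub_mulVec, Matrix.one_mulVec, Matrix.smul_mulVec, Matrix.vecMulVec_mulVec]
    ext i
    simp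
    ring
  have hWW : W * W.transpose = 1 := by
    rw [hT]
    apply Matrix.toLin'.injective
    apply LinearMap.ext
    intro x
    rw [Matrix.toLin'_mul, LinearMap.comp_apply, Matrix.toLin'_apply, Matrix.toLin'_apply,
      Matrix.toLin'_apply, Matrix.one_mulVec, hWv, hWv]
    ext i
    simp only [dotProduct_sub, dotProduct_smul, Pi.sub_apply, Pi.smul_apply, smul_eq_mul]
    field_simp
    ring
  refine ⟨⟨W, (Matrix.mem_orthogonalGroup_iff _ _).2 hWW⟩, ?_⟩
  show W.mulVec u = v
  rw [hWv]
  have : 2 * (w ⬝ᵥ u) / (w ⬝ᵥ w) = 1 := by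
    rw [div_eq_one_iff_eq hw0]
    rw [nsq_eq, nsq_eq] at h
    simp only [hw, sub_dotProduct, dotProduct_sub]
    rw [dotProduct_comm v u]
    linarith
  rw [this, hw]
  simp

lemma prod_gauss {d : ℕ} (b : Fin d → ℝ) (hb : ∀ k, 0 < b k) :
    ∫⁻ x : Fin d → ℝ, ENNReal.ofReal (Real.exp (-∑ k, b k * x k ^ 2)) =
      ENNReal.ofReal (∏ k, √(Real.pi / b k)) := by
  have h1 : ∀ x : Fin d → ℝ, Real.exp (-∑ k, b k * x k ^ 2) =
      ∏ k, Real.exp (- b k * x k ^ 2) := by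
    intro x
    rw [← Real.exp_sum, ← Finset.sum_neg_distrib]
    simp
  simp_rw [h1]
  rw [← ofReal_integral_eq_lintegral_ofReal]
  · congr 1
    rw [integral_fintype_prod_volume_eq_prod (fun k (y : ℝ) => Real.exp (- b k * y ^ 2))]
    simp_rw [integral_gaussian]
  · exact Integrable.fintype_prod (f := fun k (y : ℝ) => Real.exp (- b k * y ^ 2))
      fun k => integrable_exp_neg_mul_sq (hb k)
  · exact Filter.Eventually.of_forall fun x => Finset.prod_nonneg fun k _ => (Real.exp_pos _).le

noncomputable def ZZ (d : ℕ) : ℝ := ∏ _k : Fin d, √(Real.pi / (1 / 2))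

lemma ZZ_pos (d : ℕ) : 0 < ZZ d := Finset.prod_pos fun _ _ => by positivity

lemma exp_aux {t : ℝ} (h1 : |t| ≤ 1 / 2) : Real.exp (-t - 2 * t ^ 2) ≤ 1 - t := by
  rw [abs_le] at h1
  have h2 : 0 < 1 - t := by linarith [h1.2]
  rw [← Real.le_log_iff_exp_le h2]
  have h := Real.abs_log_sub_add_sum_range_le (x := t) (by rw [abs_lt]; constructor <;> linarith [h1.1, h1.2]) 1
  simp at h
  have h4 := (abs_le.1 h).1
  have h5 : t ^ 2 / (1 - |t|) ≤ 2 * t ^ 2 := by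
    have : |t| ≤ 1/2 := abs_le.2 h1
    rw [div_le_iff₀ (by linarith)]
    nlinarith [sq_nonneg t]
  linarith

lemma gauss_upper {d : ℕ} (a : Fin d → ℝ) (h0 : ∑ k, a k = 0) (h2 : ∑ k, a k ^ 2 ≤ 1) :
    ∏ k, √(Real.pi / (1 / 2 - 1 / 4 * a k)) ≤ Real.exp (1 / 4) * ZZ d := by
  have hk : ∀ k, |a k| ≤ 1 := fun k => by
    apply abs_le_one_iff_mul_self_le_one.2
    have := Finset.single_le_sum (f := fun k => a k ^ 2) (fun i _ => sq_nonneg _) (Finset.mem_univ k)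
    nlinarith
  have h : ∀ k, √(Real.pi / (1 / 2 - 1 / 4 * a k)) ≤
      Real.exp (a k / 4 + a k ^ 2 / 4) * √(Real.pi / (1 / 2)) := by
    intro k
    have hh := abs_le.1 (hk k)
    apply Real.sqrt_le_iff.2
    refine ⟨by positivity, ?_⟩
    rw [mul_pow, Real.sq_sqrt (by positivity), ← Real.exp_nat_mul]
    have := exp_aux (t := a k / 2) (by rw [abs_le]; constructor <;> linarith [hh.1, hh.2])
    have e : Real.exp (-(a k / 2) - 2 * (a k / 2) ^ 2) * Real.exp ((2 : ℕ) * (a k / 4 + a k ^ 2 / 4)) = 1 := by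
      rw [← Real.exp_add, Real.exp_eq_one_iff]
      push_cast; ring
    rw [div_le_iff₀ (by linarith)]
    have hp := Real.exp_pos ((2 : ℕ) * (a k / 4 + a k ^ 2 / 4))
    have h6 : 1 ≤ Real.exp ((2 : ℕ) * (a k / 4 + a k ^ 2 / 4)) * (1 - a k / 2) := by
      rw [mul_comm]; exact e.symm.le.trans (mul_le_mul_of_nonneg_right this hp.le)
    calc Real.pi = 1 * Real.pi := by ring
      _ ≤ (Real.exp ((2 : ℕ) * (a k / 4 + a k ^ 2 / 4)) * (1 - a k / 2)) * Real.pi := by gcongr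
      _ = _ := by ring
  calc _ ≤ ∏ k, Real.exp (a k / 4 + a k ^ 2 / 4) * √(Real.pi / (1 / 2)) :=
        Finset.prod_le_prod (fun _ _ => by positivity) fun k _ => h k
    _ = Real.exp (∑ k, (a k / 4 + a k ^ 2 / 4)) * ZZ d := by
        rw [Finset.prod_mul_distrib, ← Real.exp_sum, ZZ]
    _ ≤ _ := by
        gcongr
        · exact (ZZ_pos d).le
        · rw [Finset.sum_add_distrib, ← Finset.sum_div, ← Finset.sum_div, h0]
          linarith

lemma gauss_lower {d : ℕ} (a : ℝ) (ha : |a| ≤ 1) :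
    Real.exp (d / 4 * a) * ZZ d ≤ ∏ _k : Fin d, √(Real.pi / (1 / 2 - 1 / 4 * a)) := by
  have hh := abs_le.1 ha
  have : Real.exp (d / 4 * a) = ∏ _k : Fin d, Real.exp (a / 4) := by
    rw [← Real.exp_sum]; simp; ring
  rw [this, ZZ, ← Finset.prod_mul_distrib]
  refine Finset.prod_le_prod (fun _ _ => by positivity) fun k _ => ?_
  apply Real.le_sqrt_of_sq_le
  rw [mul_pow, Real.sq_sqrt (by positivity), ← Real.exp_nat_mul, le_div_iff₀ (by linarith)]
  have h := Real.add_one_le_exp (-(a / 2))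
  have e : Real.exp (-(a / 2)) * Real.exp ((2 : ℕ) * (a / 4)) = 1 := by
    rw [← Real.exp_add, Real.exp_eq_one_iff]
    push_cast; ring
  have hp := Real.exp_pos ((2 : ℕ) * (a / 4))
  calc _ = (Real.exp ((2 : ℕ) * (a / 4)) * (-(a/2) + 1)) * Real.pi := by ring
    _ ≤ (Real.exp ((2 : ℕ) * (a / 4)) * Real.exp (-(a / 2))) * Real.pi := by gcongr
    _ = _ := by rw [mul_comm (Real.exp ((2 : ℕ) * (a / 4))), e]; ring


lemma diag_gauss {d : ℕ} (A : Matrix (Fin d) (Fin d) ℝ) (hA : A.IsHermitian) (h0 : A.trace = 0)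
    (h2 : ∑ j, ∑ k, A j k ^ 2 ≤ 1) :
    ∫⁻ x : Fin d → ℝ, ENNReal.ofReal (Real.exp (- (1 / 2) * nsq x + 1 / 4 * qf A x)) ≤
      ENNReal.ofReal (Real.exp (1 / 4) * ZZ d) := by
  set V : OG d := hA.eigenvectorUnitary with hV
  set a := hA.eigenvalues with ha
  have hsp : A = V.1 * Matrix.diagonal a * V.1.transpose := by
    conv_lhs => rw [hA.spectral_theorem]
    rw [Unitary.conjStarAlgAut_apply]
    rfl
  have hVV : V.1.transpose * V.1 = 1 := (Matrix.mem_orthogonalGroup_iff' _ _).1 V.2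
  have htr : ∑ k, a k = 0 := by
    have := hA.trace_eq_sum_eigenvalues
    rw [h0] at this
    simpa using this.symm
  have hAA : ∑ k, a k ^ 2 = ∑ j, ∑ k, A j k ^ 2 := by
    have h3 : (A * A).trace = ∑ j, ∑ k, A j k ^ 2 := by
      simp only [Matrix.trace, Matrix.diag, Matrix.mul_apply]
      refine Finset.sum_congr rfl fun j _ => Finset.sum_congr rfl fun k _ => ?_
      have := hA.apply j k
      simp only [star_trivial] at this
      rw [this]; ring
    rw [← h3]
    conv_rhs => rw [hsp]
    have : V.1 * Matrix.diagonal a * V.1.transpose * (V.1 * Matrix.diagonal a * V.1.transpose)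
        = V.1 * (Matrix.diagonal a * Matrix.diagonal a) * V.1.transpose := by
      calc _ = V.1 * Matrix.diagonal a * (V.1.transpose * V.1) * Matrix.diagonal a * V.1.transpose := by
            simp only [Matrix.mul_assoc]
        _ = _ := by rw [hVV]; simp only [Matrix.mul_assoc, Matrix.mul_one]
    rw [this, Matrix.trace_mul_comm, ← Matrix.mul_assoc, hVV, Matrix.one_mul,
      Matrix.diagonal_mul_diagonal, Matrix.trace_diagonal]
    refine Finset.sum_congr rfl fun j _ => by ring
  rw [← hAA] at h2
  have hmeas : Measurable fun x : Fin d → ℝ =>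
      ENNReal.ofReal (Real.exp (- (1 / 2) * nsq x + 1 / 4 * qf A x)) := by
    have := continuous_qf A
    have := continuous_nsq (d := d)
    apply ENNReal.measurable_ofReal.comp
    apply Continuous.measurable
    fun_prop
  rw [← lintegral_rot V _ hmeas]
  have hq : ∀ x, qf A (V.1.mulVec x) = ∑ k, a k * x k ^ 2 := by
    intro x
    rw [qf_eq, hsp, ← Matrix.mulVec_mulVec, ← Matrix.mulVec_mulVec, Matrix.mulVec_mulVec x, hVV,
      Matrix.one_mulVec, Matrix.dotProduct_mulVec, ← Matrix.mulVec_transpose, Matrix.mulVec_mulVec,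
      hVV, Matrix.one_mulVec]
    simp only [dotProduct, Matrix.mulVec_diagonal]
    refine Finset.sum_congr rfl fun j _ => by ring
  have hb : ∀ k, |a k| ≤ 1 := fun k => by
    apply abs_le_one_iff_mul_self_le_one.2
    have := Finset.single_le_sum (f := fun k => a k ^ 2) (fun i _ => sq_nonneg _) (Finset.mem_univ k)
    nlinarith
  have he : ∀ x, Real.exp (- (1 / 2) * nsq (V.1.mulVec x) + 1 / 4 * qf A (V.1.mulVec x)) =
      Real.exp (- ∑ k, (1 / 2 - 1 / 4 * a k) * x k ^ 2) := by
    intro x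
    rw [nsq_orth, hq, nsq]
    congr 1
    simp only [sub_mul, Finset.sum_sub_distrib, Finset.mul_sum, mul_assoc, Finset.sum_neg_distrib,
      neg_mul]
    ring
  simp_rw [he]
  rw [prod_gauss _ (fun k => by linarith [(abs_le.1 (hb k)).2])]
  exact ENNReal.ofReal_le_ofReal (gauss_upper a htr h2)

lemma continuous_mulVecT {d : ℕ} :
    Continuous fun p : OG d × (Fin d → ℝ) => p.1.1.transpose.mulVec p.2 := by
  have h1 : Continuous fun p : OG d × (Fin d → ℝ) => p.1.1.transpose :=
    (continuous_subtype_val.comp continuous_fst).matrix_transpose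
  exact h1.matrix_mulVec continuous_snd

lemma key {d : ℕ} (A : Matrix (Fin d) (Fin d) ℝ) (hA : A.IsHermitian) (h0 : A.trace = 0)
    (h2 : ∑ j, ∑ k, A j k ^ 2 ≤ 1) (e : Fin d → ℝ) (he : nsq e = 1) :
    ∫⁻ U : OG d, ENNReal.ofReal (Real.exp (d / 4 * qf A (U.1.transpose.mulVec e))) ∂(haarO d) ≤
      ENNReal.ofReal (Real.exp (1 / 4)) := by
  have cA := continuous_qf A
  have cn := continuous_nsq (d := d)
  have cU := continuous_mulVecT (d := d)
  have hT : ∀ U : OG d, (U⁻¹ : OG d).1 = U.1.transpose := fun U => rfl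
  have hnT : ∀ (U : OG d) (x : Fin d → ℝ), nsq (U.1.transpose.mulVec x) = nsq x :=
    fun U x => nsq_orth U⁻¹ x
  set I : ENNReal := ∫⁻ x : Fin d → ℝ, ∫⁻ U : OG d,
    ENNReal.ofReal (Real.exp (-(1/2) * nsq x + 1 / 4 * qf A (U.1.transpose.mulVec x))) ∂(haarO d) with hI
  have hup : I ≤ ENNReal.ofReal (Real.exp (1 / 4) * ZZ d) := by
    rw [hI, lintegral_lintegral_swap]
    · calc _ ≤ ∫⁻ _U : OG d, ENNReal.ofReal (Real.exp (1 / 4) * ZZ d) ∂(haarO d) := by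
            apply lintegral_mono
            intro U
            refine le_trans (le_of_eq ?_) (diag_gauss A hA h0 h2)
            have hm : Measurable fun x : Fin d → ℝ =>
                ENNReal.ofReal (Real.exp (- (1 / 2) * nsq x + 1 / 4 * qf A x)) := by
              apply ENNReal.measurable_ofReal.comp
              apply Continuous.measurable
              fun_prop
            rw [← lintegral_rot U⁻¹ _ hm]
            simp only [hT, hnT]
        _ = _ := by simp
    · apply Measurable.aemeasurable
      apply ENNReal.measurable_ofReal.comp
      apply Continuous.measurable
      have : Continuous fun p : (Fin d → ℝ) × OG d => p.2.1.transpose.mulVec p.1 :=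
        cU.comp (continuous_snd.prodMk continuous_fst)
      fun_prop
  have hlow : ENNReal.ofReal (ZZ d) * ∫⁻ U : OG d,
      ENNReal.ofReal (Real.exp (d / 4 * qf A (U.1.transpose.mulVec e))) ∂(haarO d) ≤ I := by
    have hx : ∀ x : Fin d → ℝ, ∫⁻ U : OG d,
        ENNReal.ofReal (Real.exp (-(1/2) * nsq x + 1 / 4 * qf A (U.1.transpose.mulVec x))) ∂(haarO d) =
        ∫⁻ U : OG d, ENNReal.ofReal
          (Real.exp (-(1/2) * nsq x + 1 / 4 * (nsq x * qf A (U.1.transpose.mulVec e)))) ∂(haarO d) := by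
      intro x
      have hn : 0 ≤ nsq x := Finset.sum_nonneg fun j _ => sq_nonneg _
      obtain ⟨W, hW⟩ := exists_rot (√(nsq x) • e) x (by
        rw [nsq_eq, smul_dotProduct, dotProduct_smul, ← nsq_eq, he]
        simp [Real.mul_self_sqrt hn])
      rw [← lintegral_mul_left_eq_self _ W]
      apply lintegral_congr
      intro U
      have : (W * U).1.transpose.mulVec x = √(nsq x) • U.1.transpose.mulVec e := by
        rw [← Matrix.mulVec_smul]
        conv_lhs => rw [← hW]
        rw [Matrix.mulVec_mulVec]
        congr 1
        have hWW : W.1.transpose * W.1 = 1 := (Matrix.mem_orthogonalGroup_iff' _ _).1 W.2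
        change (W.1 * U.1).transpose * W.1 = _
        rw [Matrix.transpose_mul, Matrix.mul_assoc, hWW, Matrix.mul_one]
      rw [this, qf_smul, Real.sq_sqrt hn]
    rw [hI]
    simp_rw [hx]
    rw [lintegral_lintegral_swap]
    · rw [← lintegral_const_mul' _ _ ENNReal.ofReal_ne_top]
      apply lintegral_mono
      intro U
      have hb : |qf A (U.1.transpose.mulVec e)| ≤ 1 := by
        refine (qf_abs_le A h2 _).trans ?_
        rw [← hT, nsq_orth, he]
      set a := qf A (U.1.transpose.mulVec e)
      have he : ∀ x : Fin d → ℝ, Real.exp (-(1/2) * nsq x + 1 / 4 * (nsq x * a)) =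
          Real.exp (- ∑ k, (1 / 2 - 1 / 4 * a) * x k ^ 2) := by
        intro x
        rw [← Finset.mul_sum, nsq]
        congr 1; ring
      change _ * ENNReal.ofReal (Real.exp (d / 4 * a)) ≤ ∫⁻ x : Fin d → ℝ,
        ENNReal.ofReal (Real.exp (-(1/2) * nsq x + 1 / 4 * (nsq x * a)))
      simp only [he]
      rw [prod_gauss (fun _ => 1 / 2 - 1 / 4 * a) (fun k => by linarith [(abs_le.1 hb).2]),
        ← ENNReal.ofReal_mul (ZZ_pos d).le, mul_comm]
      exact ENNReal.ofReal_le_ofReal (gauss_lower a hb)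
    · apply Measurable.aemeasurable
      apply ENNReal.measurable_ofReal.comp
      apply Continuous.measurable
      have : Continuous fun p : (Fin d → ℝ) × OG d => p.2.1.transpose.mulVec e :=
        cU.comp (continuous_snd.prodMk continuous_const)
      fun_prop
  have hZ := ZZ_pos d
  have h := hlow.trans hup
  rw [mul_comm (Real.exp _), ENNReal.ofReal_mul hZ.le] at h
  exact (ENNReal.mul_le_mul_iff_right (by simpa using hZ) ENNReal.ofReal_ne_top).1 h

lemma core {d M : ℕ} (hd : 0 < d) (hM : 0 < M) (A : Fin M → Matrix (Fin d) (Fin d) ℝ)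
    (hA : ∀ i, (A i).IsHermitian) (h0 : ∀ i, (A i).trace = 0)
    (h2 : ∀ i, ∑ j, ∑ k, A i j k ^ 2 ≤ 1) :
    ∃ U : OG d, ∀ i j, d / 4 * |qf (A i) (U.1 j)| ≤ Real.log (4 * M * d) := by
  have cU := continuous_mulVecT (d := d)
  let B : Fin M × Bool → Matrix (Fin d) (Fin d) ℝ := fun p => if p.2 then A p.1 else - A p.1
  let F : (Fin M × Bool) × Fin d → OG d → ENNReal := fun p U =>
    ENNReal.ofReal (Real.exp (d / 4 * qf (B p.1) (U.1.transpose.mulVec (Pi.single p.2 1))))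
  have hF : ∀ p, ∫⁻ U, F p U ∂(haarO d) ≤ ENNReal.ofReal 2 := by
    rintro ⟨⟨i, b⟩, j⟩
    refine (key _ ?_ ?_ ?_ _ ?_).trans (ENNReal.ofReal_le_ofReal ?_)
    · cases b
      · simpa [B] using (hA i).neg
      · simpa [B] using hA i
    · cases b <;> simp [B, h0]
    · cases b <;> simpa [B] using h2 i
    · rw [nsq_eq]; simp
    · have := Real.exp_one_lt_d9
      have h3 : Real.exp (1 / 4) ≤ Real.exp (Real.log 2) := by
        apply Real.exp_le_exp.2
        linarith [Real.log_two_gt_d9]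
      rwa [Real.exp_log (by norm_num)] at h3
  have hmeas : ∀ p, Measurable (F p) := by
    intro p
    apply ENNReal.measurable_ofReal.comp
    apply Continuous.measurable
    have h1 : Continuous fun U : OG d => U.1.transpose.mulVec (Pi.single p.2 1) :=
      cU.comp (continuous_id.prodMk continuous_const)
    have h2 := continuous_qf (B p.1)
    fun_prop
  have hsum : ∫⁻ U, ∑ p, F p U ∂(haarO d) ≤ ENNReal.ofReal (4 * M * d) := by
    rw [lintegral_finsetSum _ (fun p _ => hmeas p)]
    refine (Finset.sum_le_sum fun p _ => hF p).trans (le_of_eq ?_)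
    rw [Finset.sum_const, Finset.card_univ, nsmul_eq_mul]
    simp only [Fintype.card_prod, Fintype.card_fin, Fintype.card_bool]
    rw [← ENNReal.ofReal_natCast, ← ENNReal.ofReal_mul (by positivity)]
    congr 1
    push_cast; ring
  obtain ⟨U, hU⟩ : ∃ U, ∑ p, F p U ≤ ENNReal.ofReal (4 * M * d) := by
    obtain ⟨U, hU⟩ := exists_le_lintegral (μ := haarO d) (f := fun U => ∑ p, F p U)
      (Finset.measurable_sum _ fun p _ => hmeas p).aemeasurable
    exact ⟨U, hU.trans hsum⟩
  refine ⟨U, fun i j => ?_⟩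
  have hrow : ∀ j, U.1.transpose.mulVec (Pi.single j 1) = U.1 j := by
    intro j; ext k; simp
  have hpos : (0 : ℝ) < 4 * M * d := by positivity
  have hp : ∀ b, d / 4 * qf (B (i, b)) (U.1 j) ≤ Real.log (4 * M * d) := by
    intro b
    rw [Real.le_log_iff_exp_le hpos]
    have := (Finset.single_le_sum (f := fun p => F p U) (fun _ _ => bot_le)
      (Finset.mem_univ ((i, b), j))).trans hU
    simp only [F, hrow] at this
    exact (ENNReal.ofReal_le_ofReal_iff hpos.le).1 this
  have h1 := hp true
  have h3 := hp false
  have hneg : qf (-A i) (U.1 j) = - qf (A i) (U.1 j) := by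
    simp [qf]
  simp only [B, if_true] at h1
  simp only [B, Bool.false_eq_true, if_false, hneg] at h3
  rcases abs_cases (qf (A i) (U.1 j)) with ⟨h, _⟩ | ⟨h, _⟩ <;> rw [h]
  · exact h1
  · exact h3

end QUE

lemma QUE.exists_onb {𝕜 E ι : Type*} [RCLike 𝕜] [NormedAddCommGroup E] [InnerProductSpace 𝕜 E]
    [Fintype ι] [FiniteDimensional 𝕜 E] (v : ι → E) (hv : Orthonormal 𝕜 v)
    (hc : Fintype.card ι = Module.finrank 𝕜 E) :
    ∃ b : OrthonormalBasis ι 𝕜 E, ∀ i, b i = v i := by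
  refine ⟨OrthonormalBasis.mk hv ?_, fun i => by rw [OrthonormalBasis.coe_mk]⟩
  rw [hv.linearIndependent.span_eq_top_of_card_eq_finrank' hc]

namespace QUE

variable {G : Type} [Group G] [Fintype G]

/-- left translate -/
noncomputable def tr (h : G) (x : EuclideanSpace ℝ G) : EuclideanSpace ℝ G :=
  WithLp.toLp 2 fun g => x (h * g)

lemma inner_eq (x y : EuclideanSpace ℝ G) : inner ℝ x y = ∑ g, x g * y g := by
  rw [PiLp.inner_apply]
  refine Finset.sum_congr rfl fun g _ => ?_
  simp [mul_comm]

lemma inner_tr (h : G) (x y : EuclideanSpace ℝ G) : inner ℝ (tr h x) (tr h y) = inner ℝ x y := by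
  rw [inner_eq, inner_eq]
  exact Fintype.sum_equiv (Equiv.mulLeft h) _ _ fun g => rfl

/-- The diagonal of the reproducing kernel is constant. -/
lemma kernel_const {d : ℕ} (V : Submodule ℝ (EuclideanSpace ℝ G))
    (hV : ∀ h, ∀ x ∈ V, tr h x ∈ V) (b : OrthonormalBasis (Fin d) ℝ V) (g : G) :
    (Fintype.card G : ℝ) * ∑ j, ((b j : EuclideanSpace ℝ G) g) ^ 2 = d := by
  have hle : ∀ h g, ∑ j, ((b j : EuclideanSpace ℝ G) (h * g)) ^ 2 ≤
      ∑ j, ((b j : EuclideanSpace ℝ G) g) ^ 2 := by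
    intro h g
    let v : V := ∑ j, ((b j : EuclideanSpace ℝ G) g) • b j
    have hv : ∀ j, inner ℝ (b j) v = (b j : EuclideanSpace ℝ G) g := by
      intro j
      exact b.orthonormal.inner_right_fintype _ j
    have hrep : ∀ x : V, inner ℝ x v = (x : EuclideanSpace ℝ G) g := by
      intro x
      have h1 : (x : EuclideanSpace ℝ G) = ∑ j, inner ℝ (b j) x • (b j : EuclideanSpace ℝ G) := by
        conv_lhs => rw [← b.sum_repr' x]
        simp
      have h2 : (x : EuclideanSpace ℝ G) g =
          ∑ j, inner ℝ (b j) x * (b j : EuclideanSpace ℝ G) g := by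
        conv_lhs => rw [h1]
        simp
      rw [h2, ← b.sum_inner_mul_inner x v]
      refine Finset.sum_congr rfl fun j _ => ?_
      rw [hv, real_inner_comm]
    have hn : ‖v‖ ^ 2 = ∑ j, ((b j : EuclideanSpace ℝ G) g) ^ 2 := by
      rw [← b.sum_sq_norm_inner_right v]
      refine Finset.sum_congr rfl fun j _ => ?_
      rw [hv, Real.norm_eq_abs, sq_abs]
    let w : Fin d → V := fun j => ⟨tr h (b j), hV h _ (b j).2⟩
    have hw : Orthonormal ℝ w := by
      rw [orthonormal_iff_ite]
      intro i j
      rw [← orthonormal_iff_ite.1 b.orthonormal i j]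
      exact inner_tr h _ _
    rw [← hn]
    refine le_trans (le_of_eq ?_) (hw.sum_inner_products_le v (s := Finset.univ))
    refine Finset.sum_congr rfl fun j _ => ?_
    rw [hrep, Real.norm_eq_abs, sq_abs]
    rfl
  have hc : ∀ g', ∑ j, ((b j : EuclideanSpace ℝ G) g') ^ 2 =
      ∑ j, ((b j : EuclideanSpace ℝ G) g) ^ 2 := by
    intro g'
    apply le_antisymm
    · simpa using hle (g' * g⁻¹) g
    · simpa using hle (g * g'⁻¹) g'
  have hs : ∑ g', ∑ j, ((b j : EuclideanSpace ℝ G) g') ^ 2 = d := by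
    rw [Finset.sum_comm]
    have : ∀ j, ∑ g', ((b j : EuclideanSpace ℝ G) g') ^ 2 = 1 := by
      intro j
      have h1 := orthonormal_iff_ite.1 b.orthonormal j j
      rw [if_pos rfl] at h1
      rw [← h1]
      change _ = inner ℝ (b j : EuclideanSpace ℝ G) (b j)
      rw [inner_eq]
      refine Finset.sum_congr rfl fun j _ => by ring
    simp [this]
  rw [← hs, Finset.sum_congr rfl fun g' _ => hc g']
  simp

lemma space {d M : ℕ} (hd : 0 < d) (hM : 0 < M) (V : Submodule ℝ (EuclideanSpace ℝ G))
    (hV : ∀ h, ∀ x ∈ V, tr h x ∈ V) (hfin : Module.finrank ℝ V = d) (f : Fin M → G → ℝ) :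
    ∃ b : OrthonormalBasis (Fin d) ℝ V, ∀ j i,
      d / 4 * |(∑ g, f i g * ((b j : EuclideanSpace ℝ G) g) ^ 2) - (∑ g, f i g) / (Fintype.card G : ℝ)|
        ≤ Real.log (4 * M * d) * √(d / Fintype.card G * ∑ g, f i g ^ 2) := by
  let b0 : OrthonormalBasis (Fin d) ℝ V := (stdOrthonormalBasis ℝ V).reindex (finCongr hfin)
  let β : Fin d → G → ℝ := fun j g => (b0 j : EuclideanSpace ℝ G) g
  have hn : (0 : ℝ) < Fintype.card G := by exact_mod_cast Fintype.card_pos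
  have hd' : (0 : ℝ) < d := by exact_mod_cast hd
  have hK : ∀ g, ∑ j, β j g ^ 2 = d / Fintype.card G := by
    intro g
    rw [eq_div_iff hn.ne', mul_comm]
    exact kernel_const V hV b0 g
  let Q : Fin M → Matrix (Fin d) (Fin d) ℝ := fun i j k => ∑ g, f i g * β j g * β k g
  let m : Fin M → ℝ := fun i => (∑ g, f i g) / (Fintype.card G : ℝ)
  let h : Fin M → ℝ := fun i => √(d / Fintype.card G * ∑ g, f i g ^ 2)
  have hh2 : ∀ i, h i ^ 2 = d / Fintype.card G * ∑ g, f i g ^ 2 := by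
    intro i
    exact Real.sq_sqrt (by positivity)
  have htrQ : ∀ i, ∑ j, Q i j j = d * m i := by
    intro i
    simp only [Q, m]
    rw [Finset.sum_comm]
    have : ∀ g, ∑ j, f i g * β j g * β j g = f i g * (d / Fintype.card G) := by
      intro g
      rw [← hK g, Finset.mul_sum]
      refine Finset.sum_congr rfl fun j _ => by ring
    simp only [this, ← Finset.sum_mul]
    ring
  have hQ2 : ∀ i, ∑ j, ∑ k, Q i j k ^ 2 ≤ h i ^ 2 := by
    intro i
    have hj : ∀ j, ∑ k, Q i j k ^ 2 ≤ ∑ g, (f i g * β j g) ^ 2 := by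
      intro j
      have hon : Orthonormal ℝ (fun k => (b0 k : EuclideanSpace ℝ G)) := by
        rw [orthonormal_iff_ite]
        exact fun i j => orthonormal_iff_ite.1 b0.orthonormal i j
      have := hon.sum_inner_products_le (WithLp.toLp 2 fun g => f i g * β j g) (s := Finset.univ)
      refine le_trans (le_of_eq ?_) (this.trans (le_of_eq ?_))
      · refine Finset.sum_congr rfl fun k _ => ?_
        rw [Real.norm_eq_abs, sq_abs, inner_eq]
        congr 1
        refine Finset.sum_congr rfl fun g _ => ?_
        simp only [β]
        ring
      · rw [← real_inner_self_eq_norm_sq, inner_eq]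
        refine Finset.sum_congr rfl fun g _ => ?_
        ring
    refine (Finset.sum_le_sum fun j _ => hj j).trans (le_of_eq ?_)
    rw [Finset.sum_comm, hh2, Finset.mul_sum]
    refine Finset.sum_congr rfl fun g _ => ?_
    rw [← hK g, Finset.sum_mul]
    refine Finset.sum_congr rfl fun j _ => by ring
  let A : Fin M → Matrix (Fin d) (Fin d) ℝ := fun i => (h i)⁻¹ • (Q i - m i • (1 : Matrix _ _ ℝ))
  have hqQ : ∀ i (u : Fin d → ℝ), qf (A i) u = (h i)⁻¹ * (qf (Q i) u - m i * nsq u) := by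
    intro i u
    rw [qf_eq, qf_eq, nsq_eq]
    simp only [A, Matrix.smul_mulVec, Matrix.sub_mulVec, Matrix.one_mulVec, dotProduct_smul,
      dotProduct_sub, smul_eq_mul]
  obtain ⟨U, hU⟩ := core hd hM A (by
      intro i
      ext j k
      have hQs : Q i k j = Q i j k := Finset.sum_congr rfl fun g _ => by ring
      simp only [A, Matrix.conjTranspose_apply, Matrix.smul_apply, Matrix.sub_apply, star_trivial,
        hQs, Matrix.one_apply, eq_comm (a := j)]) (by
      intro i
      simp only [A, Matrix.trace_smul, Matrix.trace_sub, Matrix.trace_one, Fintype.card_fin]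
      have : (Q i).trace = d * m i := htrQ i
      rw [this]; simp [mul_comm]) (by
      intro i
      have h1 : ∑ j, ∑ k, A i j k ^ 2 = (h i)⁻¹ ^ 2 * (∑ j, ∑ k, Q i j k ^ 2 - d * m i ^ 2) := by
        have : ∀ j, ∑ k, A i j k ^ 2 = (h i)⁻¹ ^ 2 * (∑ k, Q i j k ^ 2 - 2 * m i * Q i j j + m i ^ 2) := by
          intro j
          have e : ∀ k, A i j k ^ 2 = (h i)⁻¹ ^ 2 * (Q i j k ^ 2 +
            (if j = k then (- 2 * m i * Q i j k + m i ^ 2) else 0)) := by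
            intro k
            simp only [A, Matrix.smul_apply, Matrix.sub_apply, Matrix.one_apply, smul_eq_mul]
            split_ifs <;> ring
          simp only [e]
          rw [← Finset.mul_sum, Finset.sum_add_distrib, Finset.sum_ite_eq, if_pos (Finset.mem_univ _)]
          ring
        simp only [this]
        rw [← Finset.mul_sum, Finset.sum_add_distrib, Finset.sum_sub_distrib, ← Finset.mul_sum,
          htrQ, Finset.sum_const, Finset.card_univ, Fintype.card_fin, nsmul_eq_mul]
        ring
      rw [h1]
      have h2 : ∑ j, ∑ k, Q i j k ^ 2 - d * m i ^ 2 ≤ h i ^ 2 := by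
        have := hQ2 i
        have : 0 ≤ d * m i ^ 2 := by positivity
        linarith
      calc _ ≤ (h i)⁻¹ ^ 2 * h i ^ 2 := by gcongr
        _ ≤ 1 := by
          rw [← mul_pow]
          by_cases h0 : h i = 0
          · simp [h0]
          · rw [inv_mul_cancel₀ h0]; simp)
  have hUU : U.1 * U.1.transpose = 1 := (Matrix.mem_orthogonalGroup_iff _ _).1 U.2
  let v : Fin d → V := fun j => ∑ k, U.1 j k • b0 k
  have hv : Orthonormal ℝ v := by
    rw [orthonormal_iff_ite]
    intro i j
    simp only [v]
    rw [b0.orthonormal.inner_sum]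
    have := congrFun (congrFun hUU i) j
    rw [Matrix.mul_apply, Matrix.one_apply] at this
    simpa using this
  obtain ⟨b, hb⟩ := exists_onb v hv (by simp [hfin])
  refine ⟨b, fun j i => ?_⟩
  have hval : ∀ g, (b j : EuclideanSpace ℝ G) g = ∑ k, U.1 j k * β k g := by
    intro g
    rw [hb]
    simp [v, β]
  have hq : ∑ g, f i g * ((b j : EuclideanSpace ℝ G) g) ^ 2 = qf (Q i) (U.1 j) := by
    simp only [qf, Q, Finset.sum_mul]
    rw [Finset.sum_congr rfl fun k _ => Finset.sum_comm, Finset.sum_comm]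
    refine Finset.sum_congr rfl fun g _ => ?_
    rw [hval, sq, Finset.sum_mul_sum, Finset.mul_sum]
    refine Finset.sum_congr rfl fun k _ => ?_
    rw [Finset.mul_sum]
    refine Finset.sum_congr rfl fun l _ => by ring
  have hn1 : nsq (U.1 j) = 1 := by
    have := congrFun (congrFun hUU j) j
    rw [Matrix.mul_apply, Matrix.one_apply, if_pos rfl] at this
    rw [nsq, ← this]
    refine Finset.sum_congr rfl fun k _ => by rw [Matrix.transpose_apply]; ring
  have := hU i j
  rw [hqQ, hn1, mul_one] at this
  rw [hq]
  change d / 4 * |qf (Q i) (U.1 j) - m i| ≤ Real.log (4 * M * d) * h i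
  have hh0 : 0 ≤ h i := Real.sqrt_nonneg _
  rcases hh0.eq_or_lt with h0 | h0
  · have hz : ∀ g, f i g = 0 := by
      have h3 := hh2 i
      rw [← h0] at h3
      have h4 : ∑ g, f i g ^ 2 = 0 := by
        have : (d / Fintype.card G : ℝ) ≠ 0 := by positivity
        have h5 : (d / Fintype.card G : ℝ) * ∑ g, f i g ^ 2 = 0 := by rw [← h3]; ring
        exact (mul_eq_zero.1 h5).resolve_left this
      intro g
      have := (Finset.sum_eq_zero_iff_of_nonneg (fun g _ => sq_nonneg (f i g))).1 h4 g (Finset.mem_univ g)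
      exact pow_eq_zero_iff (two_ne_zero) |>.1 this
    rw [← hq, ← h0]
    simp [m, hz]
  · rw [abs_mul, abs_of_pos (inv_pos.2 h0)] at this
    rw [← div_le_iff₀ h0]
    refine le_trans (le_of_eq ?_) this
    field_simp

end QUE

namespace QUE

variable {G : Type} [Group G] [Fintype G]

/-- left regular representation on functions -/
def regRep (G : Type) [Group G] : Representation ℂ G (G → ℂ) where
  toFun h := LinearMap.funLeft ℂ ℂ (fun g => h⁻¹ * g)
  map_one' := by
    ext F g
    simp [LinearMap.funLeft_apply]
  map_mul' h k := by
    ext F g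
    simp [LinearMap.funLeft_apply, mul_assoc]

lemma regRep_apply (h : G) (F : G → ℂ) (g : G) : regRep G h F g = F (h⁻¹ * g) := rfl

/-- complexification of a real subspace of functions -/
def cplx (V : Submodule ℝ (EuclideanSpace ℝ G)) : Submodule ℂ (G → ℂ) where
  carrier := {F | WithLp.toLp 2 (fun g => (F g).re) ∈ V ∧ WithLp.toLp 2 (fun g => (F g).im) ∈ V}
  add_mem' {a b} ha hb := by
    refine ⟨?_, ?_⟩
    · convert V.add_mem ha.1 hb.1 using 1
      ext g; simp
    · convert V.add_mem ha.2 hb.2 using 1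
      ext g; simp
  zero_mem' := by
    refine ⟨?_, ?_⟩ <;> exact V.zero_mem
  smul_mem' c F hF := by
    refine ⟨?_, ?_⟩
    · convert V.sub_mem (V.smul_mem c.re hF.1) (V.smul_mem c.im hF.2) using 1
      ext g; simp
    · convert V.add_mem (V.smul_mem c.re hF.2) (V.smul_mem c.im hF.1) using 1
      ext g; simp

lemma finrank_cplx_le (V : Submodule ℝ (EuclideanSpace ℝ G)) :
    Module.finrank ℂ (cplx V) ≤ Module.finrank ℝ V := by
  let b := Module.finBasis ℝ V
  let w : Fin (Module.finrank ℝ V) → (G → ℂ) := fun j g => ((b j : EuclideanSpace ℝ G) g : ℂ)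
  have key : ∀ x ∈ V, (fun g => ((x g : ℝ) : ℂ)) ∈ Submodule.span ℂ (Set.range w) := by
    intro x hx
    have h1 : x = ∑ j, b.repr ⟨x, hx⟩ j • (b j : EuclideanSpace ℝ G) := by
      have := congrArg (Subtype.val) (b.sum_repr ⟨x, hx⟩)
      rw [Submodule.coe_sum] at this
      exact this.symm
    have h2 : (fun g => ((x g : ℝ) : ℂ)) = ∑ j, ((b.repr ⟨x, hx⟩ j : ℝ) : ℂ) • w j := by
      ext g
      have h3 := congrArg (fun y : EuclideanSpace ℝ G => ((y g : ℝ) : ℂ)) h1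
      simp only at h3
      rw [h3]
      simp [w]
    rw [h2]
    exact Submodule.sum_mem _ fun j _ => Submodule.smul_mem _ _ (Submodule.subset_span ⟨j, rfl⟩)
  have hle : cplx V ≤ Submodule.span ℂ (Set.range w) := by
    intro F hF
    have h1 := key _ hF.1
    have h2 := key _ hF.2
    have : F = (fun g => (((F g).re : ℝ) : ℂ)) + Complex.I • (fun g => (((F g).im : ℝ) : ℂ)) := by
      ext g
      simp only [Pi.add_apply, Pi.smul_apply, smul_eq_mul]
      rw [mul_comm, Complex.re_add_im]
    rw [this]
    exact Submodule.add_mem _ h1 (Submodule.smul_mem _ _ h2)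
  refine (Submodule.finrank_mono hle).trans ?_
  refine (finrank_range_le_card w).trans ?_
  simp

lemma dim_ge (D : ℕ) (hDmin : ∀ R : NontrivIrrep G, D ≤ Module.finrank ℂ R.W)
    (V : Submodule ℝ (EuclideanSpace ℝ G))
    (hV : ∀ h, ∀ x ∈ V, tr h x ∈ V) (hne : V ≠ ⊥) (hsum : ∀ x ∈ V, ∑ g, x g = 0) :
    D ≤ Module.finrank ℝ V := by
  refine le_trans ?_ (finrank_cplx_le V)
  let P : Set (Submodule ℂ (G → ℂ)) :=
    {W | W ≤ cplx V ∧ W ≠ ⊥ ∧ ∀ g, ∀ F ∈ W, regRep G g F ∈ W}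
  have hP : P.Nonempty := by
    refine ⟨cplx V, le_rfl, ?_, ?_⟩
    · obtain ⟨x, hx, hx0⟩ := (Submodule.ne_bot_iff V).1 hne
      rw [Submodule.ne_bot_iff]
      refine ⟨fun g => ((x g : ℝ) : ℂ), ⟨?_, ?_⟩, ?_⟩
      · simpa using hx
      · simp only [Complex.ofReal_im]
        exact V.zero_mem
      · intro h
        apply hx0
        ext g
        have := congrFun h g
        simpa using this
    · intro g F hF
      exact ⟨hV g⁻¹ _ hF.1, hV g⁻¹ _ hF.2⟩
  obtain ⟨W, ⟨hWV, hW0, hWinv⟩, hmin⟩ := WellFounded.has_min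
    (wellFounded_lt (α := Submodule ℂ (G → ℂ))) P hP
  let ρ : Representation ℂ G W :=
    { toFun := fun g => (regRep G g).restrict (hWinv g)
      map_one' := by
        ext F g
        simp [LinearMap.restrict_apply]
      map_mul' := by
        intro h k
        ext F g
        simp [LinearMap.restrict_apply] }
  have hρ : ∀ g (x : W), ((ρ g x : W) : G → ℂ) = regRep G g x := fun g x => rfl
  let R : NontrivIrrep G :=
    { W := W
      ρ := ρ
      irr := by
        intro U hU
        by_cases hU0 : U = ⊥
        · exact Or.inl hU0
        right
        have h1 : U.map W.subtype ∈ P := by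
          refine ⟨(Submodule.map_subtype_le W U).trans hWV, ?_, ?_⟩
          · intro h
            exact hU0 (Submodule.map_injective_of_injective W.injective_subtype (by rw [h, Submodule.map_bot]))
          · rintro g _ ⟨x, hx, rfl⟩
            exact ⟨ρ g x, hU g x hx, rfl⟩
        have h2 := hmin _ h1
        have h3 : U.map W.subtype = W := by
          by_contra hc
          exact h2 (lt_of_le_of_ne (Submodule.map_subtype_le W U) hc)
        rw [eq_top_iff]
        intro x _
        have : (x : G → ℂ) ∈ U.map W.subtype := by rw [h3]; exact x.2
        obtain ⟨y, hy, hyx⟩ := this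
        have : y = x := Subtype.ext hyx
        rwa [← this]
      nontriv := by
        by_contra hc
        push Not at hc
        obtain ⟨F, hF, hF0⟩ := (Submodule.ne_bot_iff W).1 hW0
        have hconst : ∀ g, F g = F 1 := by
          intro g
          have h1 := congrArg (fun L : W →ₗ[ℂ] W => ((L ⟨F, hF⟩ : W) : G → ℂ) 1) (hc g⁻¹)
          simp only [hρ, regRep_apply] at h1
          simpa using h1
        have hn : (Fintype.card G : ℝ) ≠ 0 := by exact_mod_cast Fintype.card_ne_zero
        have h2 := hsum _ (hWV hF).1
        have h3 := hsum _ (hWV hF).2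
        simp only [hconst, Finset.sum_const, Finset.card_univ, nsmul_eq_mul, mul_eq_zero, hn,
          false_or] at h2 h3
        apply hF0
        ext g
        rw [hconst]
        exact Complex.ext h2 h3 }
  exact (hDmin R).trans (Submodule.finrank_mono hWV)

end QUE

namespace QUE

variable {G : Type} [Group G] [Fintype G]

/-- adjacency operator plus the all-ones operator -/
noncomputable def op (S : Finset G) : EuclideanSpace ℝ G →ₗ[ℝ] EuclideanSpace ℝ G where
  toFun x := WithLp.toLp 2 fun g => ∑ s ∈ S, x (g * s) + ∑ h, x h
  map_add' x y := by
    ext g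
    simp [Finset.sum_add_distrib]
    ring
  map_smul' c x := by
    ext g
    simp [Finset.mul_sum, mul_add]

lemma op_apply (S : Finset G) (x : EuclideanSpace ℝ G) (g : G) :
    op S x g = ∑ s ∈ S, x (g * s) + ∑ h, x h := rfl

lemma op_symm (S : Finset G) (hS : ∀ s ∈ S, s⁻¹ ∈ S) : (op S).IsSymmetric := by
  intro x y
  rw [inner_eq, inner_eq]
  simp only [op_apply, add_mul, mul_add, Finset.sum_add_distrib]
  congr 1
  · simp only [Finset.sum_mul, Finset.mul_sum]
    rw [Finset.sum_comm, Finset.sum_comm (s := Finset.univ)]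
    refine Finset.sum_nbij' (fun s => s⁻¹) (fun s => s⁻¹) hS hS (by simp) (by simp) ?_
    intro s _
    refine Fintype.sum_equiv (Equiv.mulRight s) _ _ fun g => ?_
    simp
  · rw [← Finset.mul_sum, ← Finset.sum_mul]

lemma eig_iff (S : Finset G) (μ : ℝ) (x : EuclideanSpace ℝ G) :
    x ∈ Module.End.eigenspace (op S) μ ↔ ∀ g, ∑ s ∈ S, x (g * s) + ∑ h, x h = μ * x g := by
  rw [Module.End.mem_eigenspace_iff]
  constructor
  · intro h g
    rw [← op_apply, h]; simp
  · intro h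
    ext g
    rw [op_apply, h]; simp

lemma eig_tr (S : Finset G) (μ : ℝ) (h : G) (x : EuclideanSpace ℝ G)
    (hx : x ∈ Module.End.eigenspace (op S) μ) : tr h x ∈ Module.End.eigenspace (op S) μ := by
  rw [eig_iff] at hx ⊢
  intro g
  have h1 : ∑ k, (tr h x) k = ∑ k, x k := Fintype.sum_equiv (Equiv.mulLeft h) _ _ fun g => rfl
  rw [h1]
  have := hx (h * g)
  simpa [tr, mul_assoc] using this

lemma eig_sum (S : Finset G) (μ : ℝ) (hμ : μ ≠ S.card + Fintype.card G) (x : EuclideanSpace ℝ G)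
    (hx : x ∈ Module.End.eigenspace (op S) μ) : ∑ g, x g = 0 := by
  rw [eig_iff] at hx
  have h : ∑ g, (∑ s ∈ S, x (g * s) + ∑ h, x h) = ∑ g, μ * x g :=
    Finset.sum_congr rfl fun g _ => hx g
  rw [Finset.sum_add_distrib, Finset.sum_comm, ← Finset.mul_sum] at h
  have h1 : ∀ s, ∑ g, x (g * s) = ∑ g, x g := fun s =>
    Fintype.sum_equiv (Equiv.mulRight s) _ _ fun g => rfl
  simp only [h1, Finset.sum_const, nsmul_eq_mul, Finset.card_univ] at h
  have h2 : (μ - (S.card + Fintype.card G)) * ∑ g, x g = 0 := by linarith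
  exact (mul_eq_zero.1 h2).resolve_left (sub_ne_zero.2 hμ)

lemma eig_top (S : Finset G) (x : EuclideanSpace ℝ G)
    (hx : x ∈ Module.End.eigenspace (op S) (S.card + Fintype.card G)) : ∃ c, ∀ g, x g = c := by
  rw [eig_iff] at hx
  obtain ⟨g0, hg0⟩ := Finite.exists_max (fun g => x g)
  refine ⟨x g0, fun g => ?_⟩
  have h := hx g0
  have h1 : ∑ s ∈ S, x (g0 * s) ≤ ∑ s ∈ S, x g0 := Finset.sum_le_sum fun s _ => hg0 _
  have h2 : ∑ h, (x g0 - x h) ≤ 0 := by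
    rw [Finset.sum_sub_distrib]
    simp only [Finset.sum_const, nsmul_eq_mul, Finset.card_univ] at h1 ⊢
    linarith
  have h3 := Finset.single_le_sum (f := fun h => x g0 - x h)
    (fun h _ => sub_nonneg.2 (hg0 h)) (Finset.mem_univ g)
  have h4 := hg0 g
  simp only at h3 h4
  linarith

/-- Being a good basis function. -/
def Good (S : Finset G) {M : ℕ} (f : Fin M → G → ℝ) (C : ℝ) (x : EuclideanSpace ℝ G) : Prop :=
  (∃ ν : ℝ, ∀ g, ∑ s ∈ S, x (g * s) = ν * x g) ∧
  ∀ i, |(∑ g, f i g * (x g) ^ 2) - (∑ g, f i g) / (Fintype.card G : ℝ)| ≤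
    C * (√(∑ g, f i g ^ 2) / √(Fintype.card G))

lemma eig_basis (S : Finset G) {M : ℕ} (hM : 0 < M) (f : Fin M → G → ℝ) (C : ℝ) (hC : 0 ≤ C)
    (hdim : ∀ V : Submodule ℝ (EuclideanSpace ℝ G), (∀ h, ∀ x ∈ V, tr h x ∈ V) → V ≠ ⊥ →
      (∀ x ∈ V, ∑ g, x g = 0) →
      4 * Real.log (4 * M * (Module.finrank ℝ V : ℝ)) / √(Module.finrank ℝ V) ≤ C)
    (μ : ℝ) (hμ : Module.End.eigenspace (op S) μ ≠ ⊥) :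
    ∃ b : OrthonormalBasis (Fin (Module.finrank ℝ (Module.End.eigenspace (op S) μ))) ℝ
      (Module.End.eigenspace (op S) μ), ∀ j, Good S f C (b j : EuclideanSpace ℝ G) := by
  have hn : (0 : ℝ) < Fintype.card G := by exact_mod_cast Fintype.card_pos
  by_cases hμt : μ = S.card + Fintype.card G
  · refine ⟨stdOrthonormalBasis ℝ _, fun j => ?_⟩
    set x := (stdOrthonormalBasis ℝ (Module.End.eigenspace (op S) μ) j) with hxdef
    obtain ⟨c, hc⟩ := eig_top S (x : EuclideanSpace ℝ G) (hμt ▸ x.2)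
    have hnorm : inner ℝ (x : EuclideanSpace ℝ G) x = 1 := by
      have h1 := orthonormal_iff_ite.1 (stdOrthonormalBasis ℝ
        (Module.End.eigenspace (op S) μ)).orthonormal j j
      rw [if_pos rfl] at h1
      exact h1
    rw [inner_eq] at hnorm
    simp only [hc, Finset.sum_const, nsmul_eq_mul, Finset.card_univ] at hnorm
    have hc2 : c ^ 2 = 1 / Fintype.card G := by
      rw [eq_div_iff hn.ne']; linarith
    refine ⟨⟨S.card, fun g => by simp [hc]⟩, fun i => ?_⟩
    have : (∑ g, f i g * ((x : EuclideanSpace ℝ G) g) ^ 2) = (∑ g, f i g) / (Fintype.card G : ℝ) := by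
      simp only [hc, hc2, ← Finset.sum_mul]
      ring
    rw [this, sub_self, abs_zero]
    positivity
  · set V := Module.End.eigenspace (op S) μ with hVdef
    have hVtr : ∀ h, ∀ x ∈ V, tr h x ∈ V := fun h x hx => eig_tr S μ h x hx
    have hVs : ∀ x ∈ V, ∑ g, x g = 0 := fun x hx => eig_sum S μ hμt x hx
    have hCV := hdim V hVtr hμ hVs
    have hd : 0 < Module.finrank ℝ V := by
      rw [Nat.pos_iff_ne_zero, Ne, Submodule.finrank_eq_zero]
      exact hμ
    obtain ⟨b, hb⟩ := space hd hM V hVtr rfl f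
    refine ⟨b, fun j => ⟨⟨μ, fun g => ?_⟩, fun i => ?_⟩⟩
    · have h1 := (eig_iff S μ _).1 (b j).2 g
      rw [hVs _ (b j).2, add_zero] at h1
      exact h1
    · have h1 := hb j i
      have hd' : (0 : ℝ) < Module.finrank ℝ V := by exact_mod_cast hd
      set d : ℝ := (Module.finrank ℝ V : ℝ)
      rw [Real.sqrt_mul (by positivity), Real.sqrt_div (by positivity)] at h1
      have hsd : 0 < √d := Real.sqrt_pos.2 hd'
      have hsq : √d * √d = d := Real.mul_self_sqrt hd'.le
      refine le_trans ?_ (mul_le_mul_of_nonneg_right hCV (by positivity))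
      have h2 : 4 * Real.log (4 * M * d) / √d * (√(∑ g, f i g ^ 2) / √(Fintype.card G)) =
        (4 / d) * (Real.log (4 * M * d) * (√d / √(Fintype.card G) * √(∑ g, f i g ^ 2))) := by
        have : √(Fintype.card G : ℝ) ≠ 0 := (Real.sqrt_pos.2 hn).ne'
        field_simp
        rw [sq, hsq]
        ring
      rw [h2]
      refine le_trans (le_of_eq ?_) (mul_le_mul_of_nonneg_left h1 (by positivity))
      field_simp

lemma real_basis (S : Finset G) (hS : ∀ s ∈ S, s⁻¹ ∈ S) {M : ℕ} (hM : 0 < M)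
    (f : Fin M → G → ℝ) (C : ℝ) (hC : 0 ≤ C)
    (hdim : ∀ V : Submodule ℝ (EuclideanSpace ℝ G), (∀ h, ∀ x ∈ V, tr h x ∈ V) → V ≠ ⊥ →
      (∀ x ∈ V, ∑ g, x g = 0) →
      4 * Real.log (4 * M * (Module.finrank ℝ V : ℝ)) / √(Module.finrank ℝ V) ≤ C) :
    ∃ b : OrthonormalBasis G ℝ (EuclideanSpace ℝ G), ∀ j, Good S f C (b j) := by
  classical
  have hT := op_symm S hS
  choose b hb using fun μ : Module.End.Eigenvalues (op S) =>
    eig_basis S hM f C hC hdim μ μ.2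
  let B := hT.direct_sum_isInternal.collectedOrthonormalBasis hT.orthogonalFamily_eigenspaces' b
  have hB : ∀ a, Good S f C (B a) := by
    rintro ⟨μ, j⟩
    have : B ⟨μ, j⟩ = (b μ j : EuclideanSpace ℝ G) := by
      simp [B, DirectSum.IsInternal.collectedOrthonormalBasis]
    rw [this]
    exact hb μ j
  have hcard : Fintype.card ((μ : Module.End.Eigenvalues (op S)) ×
      Fin (Module.finrank ℝ (Module.End.eigenspace (op S) (μ : ℝ)))) = Fintype.card G := by
    rw [← Module.finrank_eq_card_basis B.toBasis]
    simp
  let e := Fintype.equivOfCardEq hcard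
  refine ⟨B.reindex e, fun j => ?_⟩
  rw [OrthonormalBasis.reindex_apply]
  exact hB _

end QUE

/-- **QUE for highly quasirandom groups** (Corollary 1.3): if `𝔇(G) ≥ (log |G|)²` then, for any
`M ≤ min((1/24)|G|^ε, (1/8)|G|⁻¹ e^{𝔇(G)/12})` real functions on `G`, there is a real orthonormal
eigenbasis of any Cayley graph of `G` equidistributing all of them with error
`64(ε+1)log|G|/√𝔇(G) · ‖f‖₂/√|G|`.  Here `D = 𝔇(G)` is the minimal dimension of a non-trivial
irreducible complex representation of `G`. -/
theorem stmt_2 (ε : ℝ) (hε : 0 < ε)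
    {G : Type} [Group G] [Fintype G]
    (D : ℕ)
    (hDmin : ∀ R : NontrivIrrep G, D ≤ Module.finrank ℂ R.W)
    (hDmem : ∃ R : NontrivIrrep G, Module.finrank ℂ R.W = D)
    (hDlog : (Real.log (Fintype.card G)) ^ 2 ≤ (D : ℝ))
    (S : Finset G) (hS : ∀ s ∈ S, s⁻¹ ∈ S)
    (M : ℕ) (hM : 0 < M)
    (hMle : (M : ℝ) ≤ min ((1 / 24) * (Fintype.card G : ℝ) ^ ε)
        ((1 / 8) * (Fintype.card G : ℝ)⁻¹ * Real.exp ((D : ℝ) / 12)))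
    (f : Fin M → G → ℝ) :
    ∃ B : OrthonormalBasis G ℂ (EuclideanSpace ℂ G),
      (∀ φ : G, (∀ g : G, (B φ g).im = 0) ∧
        ∃ μ : ℂ, ∀ g : G, ∑ s ∈ S, B φ (g * s) = μ * B φ g) ∧
      (∀ (φ : G) (i : Fin M),
        |(∑ g : G, f i g * ‖B φ g‖ ^ 2) - (∑ g : G, f i g) / (Fintype.card G : ℝ)| ≤
          64 * (ε + 1) * Real.log (Fintype.card G) / Real.sqrt D *
            (Real.sqrt (∑ g : G, f i g ^ 2) / Real.sqrt (Fintype.card G))) := by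
  have hn1 : (1 : ℝ) ≤ Fintype.card G := by exact_mod_cast Fintype.card_pos
  have hn : (0 : ℝ) < Fintype.card G := by linarith
  have hM1 : (1 : ℝ) ≤ M := by exact_mod_cast hM
  have hlog : 0 ≤ Real.log (Fintype.card G) := Real.log_nonneg hn1
  have hD : (0 : ℝ) < D := by
    rcases Nat.eq_zero_or_pos D with h | h
    · exfalso
      have h1 := hMle.trans (min_le_right _ _)
      rw [h] at h1
      simp at h1
      have : (Fintype.card G : ℝ)⁻¹ ≤ 1 := inv_le_one_of_one_le₀ hn1
      linarith
    · exact_mod_cast h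
  have hC : 0 ≤ 64 * (ε + 1) * Real.log (Fintype.card G) / Real.sqrt D := by positivity
  obtain ⟨b, hb⟩ := QUE.real_basis S hS hM f _ hC (by
    intro V hVtr hV0 hVs
    have hdD : (D : ℝ) ≤ Module.finrank ℝ V := by
      exact_mod_cast QUE.dim_ge D hDmin V hVtr hV0 hVs
    have hdn : (Module.finrank ℝ V : ℝ) ≤ Fintype.card G := by
      have := Submodule.finrank_le V
      rw [finrank_euclideanSpace] at this
      exact_mod_cast this
    set d : ℝ := (Module.finrank ℝ V : ℝ)
    have hd : 0 < d := by linarith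
    have hMn := hMle.trans (min_le_left _ _)
    have hne : 0 < (Fintype.card G : ℝ) ^ ε := Real.rpow_pos_of_pos hn ε
    have h1 : Real.log (4 * M * d) ≤ (ε + 1) * Real.log (Fintype.card G) := by
      rw [← Real.log_rpow hn]
      apply Real.log_le_log (by positivity)
      rw [Real.rpow_add hn, Real.rpow_one]
      have : 4 * (M : ℝ) ≤ (Fintype.card G : ℝ) ^ ε := by linarith
      exact mul_le_mul this hdn hd.le hne.le
    have h2 : 0 ≤ (ε + 1) * Real.log (Fintype.card G) := by positivity
    have h3 : √(D : ℝ) ≤ √d := Real.sqrt_le_sqrt hdD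
    have h4 : 0 < √(D : ℝ) := Real.sqrt_pos.2 hD
    apply div_le_div₀ (by positivity) (by linarith) h4 h3)
  let v : G → EuclideanSpace ℂ G := fun j => WithLp.toLp 2 fun g => ((b j g : ℝ) : ℂ)
  have hv : Orthonormal ℂ v := by
    classical
    rw [orthonormal_iff_ite]
    intro i j
    have h1 := orthonormal_iff_ite.1 b.orthonormal i j
    rw [QUE.inner_eq] at h1
    have h2 : inner ℂ (v i) (v j) = ((∑ g, b i g * b j g : ℝ) : ℂ) := by
      rw [PiLp.inner_apply]
      push_cast
      refine Finset.sum_congr rfl fun g _ => ?_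
      simp [v, mul_comm]
    rw [h2, h1]
    split_ifs <;> simp
  obtain ⟨B, hB⟩ := QUE.exists_onb v hv (by simp)
  have hval : ∀ j g, B j g = ((b j g : ℝ) : ℂ) := by
    intro j g
    rw [hB]
  refine ⟨B, fun j => ⟨fun g => by rw [hval]; simp, ?_⟩, fun j i => ?_⟩
  · obtain ⟨ν, hν⟩ := (hb j).1
    refine ⟨ν, fun g => ?_⟩
    simp only [hval]
    rw [← Complex.ofReal_mul, ← hν g]
    push_cast
    rfl
  · have h1 := (hb j).2 i
    have h2 : ∀ g, ‖B j g‖ ^ 2 = (b j g) ^ 2 := by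
      intro g
      rw [hval, Complex.norm_real, Real.norm_eq_abs, sq_abs]
    simp only [h2]
    exact h1
end
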